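/- Let α ∈ (0,1/4] ∪ [1/3,1/2]. Then the density g_α of the positive α-stable distribution, defined on (0,∞), is hyperbolically completely monotone (HCM). -/

import Mathlib

open MeasureTheory Complex Set Filter

/-- The function `G_α` from Fourati's paper: for `z` in the slit plane,
`G_α(z) = (2πi)⁻¹ ∫_0^∞ (exp(-e^{-iπα} y^α z^{1-α}) - exp(-e^{iπα} y^α z^{1-α})) z⁻¹ e^{-y} dy`,
all complex powers being principal branches. -/
noncomputable def Galpha (α : ℝ) (z : ℂ) : ℂ :=
  (2 * Real.pi * Complex.I)⁻¹ *
    ∫ y in Set.Ioi (0:ℝ),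
      ((Complex.exp (-(Complex.exp (-(Real.pi * α : ℂ) * Complex.I)) * (y:ℂ) ^ (α:ℂ) * z ^ (1 - (α:ℂ))) -
        Complex.exp (-(Complex.exp ((Real.pi * α : ℂ) * Complex.I)) * (y:ℂ) ^ (α:ℂ) * z ^ (1 - (α:ℂ)))) / z) *
      Complex.exp (-(y:ℂ))

/-- The upper boundary value `G_α(-r^+)`. -/
noncomputable def GalphaPlus (α r : ℝ) : ℂ :=
  (2 * Real.pi * Complex.I)⁻¹ *
    ∫ y in Set.Ioi (0:ℝ),
      ((Complex.exp ((r:ℂ) ^ (1 - (α:ℂ)) * (y:ℂ) ^ (α:ℂ)) -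
        Complex.exp (Complex.exp (-(2 * Real.pi * α : ℂ) * Complex.I) * (r:ℂ) ^ (1 - (α:ℂ)) * (y:ℂ) ^ (α:ℂ))) / (r:ℂ)) *
      Complex.exp (-(y:ℂ))

/-- `θ_α(r) = -arg(G_α(-r^+))/π`. -/
noncomputable def thetaFun (α r : ℝ) : ℝ := -(GalphaPlus α r).arg / Real.pi

/-- Zolotarev's integral formula for the density of the strictly `α`-stable
distribution with positivity parameter `ρ` (the integral is a real number; we take
the real part). -/
noncomputable def stableDensity (α ρ x : ℝ) : ℝ :=
  ((2 * Real.pi * Complex.I)⁻¹ *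
    ∫ y in Set.Ioi (0:ℝ),
      ((Complex.exp (-(Complex.exp (-(Real.pi * ρ * α : ℂ) * Complex.I)) * (y:ℂ) ^ (α:ℂ) * (x:ℂ) ^ (-(α:ℂ))) -
        Complex.exp (-(Complex.exp ((Real.pi * ρ * α : ℂ) * Complex.I)) * (y:ℂ) ^ (α:ℂ) * (x:ℂ) ^ (-(α:ℂ)))) / (x:ℂ)) *
      Complex.exp (-(y:ℂ))).re

/-- A function is completely monotone (on `(0,∞)`) if it is infinitely differentiable
there and `(-1)^n f^{(n)}(x) ≥ 0` for all `n` and `x > 0`. -/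
def CompletelyMonotone (φ : ℝ → ℝ) : Prop :=
  ContDiffOn ℝ (⊤ : ℕ∞) φ (Set.Ioi 0) ∧
  ∀ (n : ℕ) (x : ℝ), 0 < x → 0 ≤ (-1 : ℝ) ^ n * iteratedDeriv n φ x

/-- A function `H` on `(0,∞)` is hyperbolically completely monotone if for every `u > 0`
the function `v ↦ H(uv)H(u/v)` is a completely monotone function of `v + 1/v`. -/
def HCM (H : ℝ → ℝ) : Prop :=
  ∀ u : ℝ, 0 < u → ∃ φ : ℝ → ℝ, CompletelyMonotone φ ∧
    ∀ v : ℝ, 0 < v → H (u * v) * H (u / v) = φ (v + 1 / v)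

namespace StableHCM

open scoped Topology Real ComplexConjugate

/-! ### Completely monotone functions through iterated differences -/

/-- Iterated alternating differences of `f` along a list of increments. -/
def iterDiff : List ℝ → (ℝ → ℝ) → ℝ → ℝ
  | [], f, w => f w
  | h :: l, f, w => iterDiff l (fun x => f x - f (x + h)) w

/-- All iterated alternating differences of `f` with positive increments are nonnegative on `S`. -/
def DCM (S : Set ℝ) (f : ℝ → ℝ) : Prop :=
  ∀ l : List ℝ, (∀ h ∈ l, 0 < h) → ∀ w ∈ S, 0 ≤ iterDiff l f w

lemma IsUpperSet.add_mem {S : Set ℝ} (hS : IsUpperSet S) {w h : ℝ} (hw : w ∈ S) (hh : 0 ≤ h) :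
    w + h ∈ S := hS (by linarith) hw

lemma iterDiff_congr {S : Set ℝ} (hS : IsUpperSet S) (l : List ℝ) (hl : ∀ h ∈ l, 0 < h) :
    ∀ {f g : ℝ → ℝ}, (∀ w ∈ S, f w = g w) → ∀ w ∈ S, iterDiff l f w = iterDiff l g w := by
  induction l with
  | nil => intro f g h w hw; exact h w hw
  | cons a l ih =>
    intro f g h w hw
    have ha := hl a (by simp)
    exact ih (fun b hb => hl b (by simp [hb])) (fun x hx => by
      rw [h x hx, h _ (IsUpperSet.add_mem hS hx ha.le)]) w hw

lemma iterDiff_add (l : List ℝ) : ∀ (f g : ℝ → ℝ) (w : ℝ),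
    iterDiff l (fun x => f x + g x) w = iterDiff l f w + iterDiff l g w := by
  induction l with
  | nil => intro f g w; rfl
  | cons a l ih =>
    intro f g w
    simp only [iterDiff]
    rw [← ih]
    congr 1
    ext x
    ring

lemma iterDiff_const_mul (c : ℝ) (l : List ℝ) : ∀ (f : ℝ → ℝ) (w : ℝ),
    iterDiff l (fun x => c * f x) w = c * iterDiff l f w := by
  induction l with
  | nil => intro f w; rfl
  | cons a l ih =>
    intro f w
    simp only [iterDiff]
    rw [← ih]
    congr 1
    ext x
    ring

lemma iterDiff_sub_shift (h : ℝ) (l : List ℝ) : ∀ (f : ℝ → ℝ) (w : ℝ),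
    iterDiff l (fun x => f x - f (x + h)) w = iterDiff l f w - iterDiff l f (w + h) := by
  induction l with
  | nil => intro f w; rfl
  | cons a l ih =>
    intro f w
    simp only [iterDiff]
    rw [← ih]
    congr 1
    ext x
    ring_nf

lemma iterDiff_cons (h : ℝ) (l : List ℝ) (f : ℝ → ℝ) (w : ℝ) :
    iterDiff (h :: l) f w = iterDiff l f w - iterDiff l f (w + h) :=
  iterDiff_sub_shift h l f w

lemma iterDiff_comp_add (a : ℝ) (l : List ℝ) : ∀ (f : ℝ → ℝ) (w : ℝ),
    iterDiff l (fun x => f (x + a)) w = iterDiff l f (w + a) := by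
  induction l with
  | nil => intro f w; rfl
  | cons b l ih => intro f w; rw [iterDiff_cons, iterDiff_cons, ih, ih]; ring_nf

lemma iterDiff_integral {Ω : Type*} [MeasurableSpace Ω] {μ : Measure Ω} {S : Set ℝ}
    (hS : IsUpperSet S) (l : List ℝ) (hl : ∀ h ∈ l, 0 < h) (F : Ω → ℝ → ℝ)
    (hF : ∀ w ∈ S, Integrable (fun ω => F ω w) μ) : ∀ w ∈ S,
      Integrable (fun ω => iterDiff l (F ω) w) μ ∧
      iterDiff l (fun x => ∫ ω, F ω x ∂μ) w = ∫ ω, iterDiff l (F ω) w ∂μ := by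
  induction l with
  | nil => intro w hw; exact ⟨hF w hw, rfl⟩
  | cons a l ih =>
    intro w hw
    have ha := hl a (by simp)
    have ih' := ih (fun b hb => hl b (by simp [hb]))
    simp only [iterDiff_cons]
    have h1 := ih' w hw
    have h2 := ih' _ (IsUpperSet.add_mem hS hw ha.le)
    exact ⟨h1.1.sub h2.1, by rw [h1.2, h2.2, integral_sub h1.1 h2.1]⟩

lemma iterDiff_tendsto {ι : Type*} {u : Filter ι} {S : Set ℝ}
    (hS : IsUpperSet S) (l : List ℝ) (hl : ∀ h ∈ l, 0 < h) (F : ι → ℝ → ℝ) (f : ℝ → ℝ)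
    (hF : ∀ w ∈ S, Tendsto (fun i => F i w) u (𝓝 (f w))) : ∀ w ∈ S,
      Tendsto (fun i => iterDiff l (F i) w) u (𝓝 (iterDiff l f w)) := by
  induction l with
  | nil => exact hF
  | cons a l ih =>
    intro w hw
    have ha := hl a (by simp)
    have ih' := ih (fun b hb => hl b (by simp [hb]))
    simp only [iterDiff_cons]
    exact (ih' w hw).sub (ih' _ (IsUpperSet.add_mem hS hw ha.le))

namespace DCM

variable {S : Set ℝ} {f g : ℝ → ℝ}

lemma nonneg (hf : DCM S f) {w : ℝ} (hw : w ∈ S) : 0 ≤ f w := hf [] (by simp) w hw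

lemma sub_shift (hf : DCM S f) {h : ℝ} (hh : 0 < h) : DCM S (fun x => f x - f (x + h)) :=
  fun l hl w hw => hf (h :: l) (by simpa using ⟨hh, hl⟩) w hw

lemma mono {T : Set ℝ} (hf : DCM S f) (h : T ⊆ S) : DCM T f :=
  fun l hl w hw => hf l hl w (h hw)

lemma congr (hS : IsUpperSet S) (hf : DCM S f) (h : ∀ w ∈ S, g w = f w) : DCM S g :=
  fun l hl w hw => by rw [iterDiff_congr hS l hl h w hw]; exact hf l hl w hw

lemma add (hf : DCM S f) (hg : DCM S g) : DCM S (fun x => f x + g x) :=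
  fun l hl w hw => by rw [iterDiff_add]; exact add_nonneg (hf l hl w hw) (hg l hl w hw)

lemma const_mul {c : ℝ} (hc : 0 ≤ c) (hf : DCM S f) : DCM S (fun x => c * f x) :=
  fun l hl w hw => by rw [iterDiff_const_mul]; exact mul_nonneg hc (hf l hl w hw)

lemma comp_add (hS : IsUpperSet S) {a : ℝ} (ha : 0 ≤ a) (hf : DCM S f) :
    DCM S (fun x => f (x + a)) :=
  fun l hl w hw => by
    rw [iterDiff_comp_add]; exact hf l hl _ (IsUpperSet.add_mem hS hw ha)

lemma mul (hS : IsUpperSet S) (hf : DCM S f) (hg : DCM S g) : DCM S (fun x => f x * g x) := by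
  intro l
  induction l generalizing f g with
  | nil => intro _ w hw; exact mul_nonneg (hf.nonneg hw) (hg.nonneg hw)
  | cons a l ih =>
    intro hl w hw
    have ha := hl a (by simp)
    have hl' : ∀ b ∈ l, 0 < b := fun b hb => hl b (by simp [hb])
    have e : (fun x => f x * g x - f (x + a) * g (x + a)) =
        fun x => (f x - f (x + a)) * g (x + a) + f x * (g x - g (x + a)) := by
      ext x; ring
    rw [iterDiff, e, iterDiff_add]
    exact add_nonneg (ih (hf.sub_shift ha) (hg.comp_add hS ha.le) hl' w hw)
      (ih hf (hg.sub_shift ha) hl' w hw)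

lemma const {c : ℝ} (hc : 0 ≤ c) : DCM S (fun _ => c) := by
  intro l
  cases l with
  | nil => intro _ w _; exact hc
  | cons a l =>
    intro _ w _
    simp only [iterDiff, sub_self]
    have := iterDiff_const_mul 0 l (fun _ => 0) w
    simp only [zero_mul, mul_zero] at this
    exact this.ge

lemma pow (hS : IsUpperSet S) (hf : DCM S f) (n : ℕ) : DCM S (fun x => f x ^ n) := by
  induction n with
  | zero => simpa using const zero_le_one
  | succ n ih => simpa only [pow_succ] using ih.mul hS hf

lemma of_tendsto {ι : Type*} {u : Filter ι} [u.NeBot] (hS : IsUpperSet S) {F : ι → ℝ → ℝ}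
    (hF : ∀ᶠ i in u, DCM S (F i)) (h : ∀ w ∈ S, Tendsto (fun i => F i w) u (𝓝 (f w))) :
    DCM S f :=
  fun l hl w hw => ge_of_tendsto (iterDiff_tendsto hS l hl F f h w hw)
    (hF.mono fun _ hi => hi l hl w hw)

lemma integral {Ω : Type*} [MeasurableSpace Ω] {μ : Measure Ω} (hS : IsUpperSet S)
    {F : Ω → ℝ → ℝ} (hF : ∀ᵐ ω ∂μ, DCM S (F ω))
    (hfi : ∀ w ∈ S, Integrable (fun ω => F ω w) μ) : DCM S (fun x => ∫ ω, F ω x ∂μ) :=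
  fun l hl w hw => by
    rw [(iterDiff_integral hS l hl F hfi w hw).2]
    exact integral_nonneg_of_ae (hF.mono fun _ h => h l hl w hw)

lemma exp_neg {ξ : ℝ} (hξ : 0 ≤ ξ) : DCM S (fun w => Real.exp (-(ξ * w))) := by
  have key : ∀ l : List ℝ, (∀ h ∈ l, 0 < h) → ∃ c : ℝ, 0 ≤ c ∧
      ∀ w, iterDiff l (fun w => Real.exp (-(ξ * w))) w = c * Real.exp (-(ξ * w)) := by
    intro l
    induction l with
    | nil => intro _; exact ⟨1, zero_le_one, fun w => by simp [iterDiff]⟩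
    | cons a l ih =>
      intro hl
      obtain ⟨c, hc, h⟩ := ih (fun b hb => hl b (by simp [hb]))
      have ha := hl a (by simp)
      refine ⟨c * (1 - Real.exp (-(ξ * a))), mul_nonneg hc ?_, fun w => ?_⟩
      · rw [sub_nonneg, Real.exp_le_one_iff]; have := mul_nonneg hξ ha.le; linarith
      · rw [iterDiff_cons, h, h, mul_add, neg_add, Real.exp_add]; ring
  intro l hl w _
  obtain ⟨c, hc, h⟩ := key l hl
  rw [h]; positivity

lemma inv_add {y : ℝ} (hS : IsUpperSet S) (hy : ∀ w ∈ S, 0 < y + w) :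
    DCM S (fun w => 1 / (y + w)) := by
  have hfi : ∀ w ∈ S, IntegrableOn (fun a : ℝ => Real.exp (-(y + w) * a)) (Ioi 0) :=
    fun w hw => integrableOn_exp_mul_Ioi (by linarith [hy w hw]) 0
  have h := DCM.integral (μ := volume.restrict (Ioi (0:ℝ))) (S := S) hS
    (F := fun a w => Real.exp (-(y + w) * a)) ?_ hfi
  · refine h.congr hS fun w hw => ?_
    rw [integral_exp_mul_Ioi (by linarith [hy w hw]), mul_zero, Real.exp_zero, neg_div_neg_eq]
  · refine (ae_restrict_mem measurableSet_Ioi).mono fun a ha => ?_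
    have ha' : (0:ℝ) ≤ a := le_of_lt ha
    refine ((exp_neg (S := S) ha').const_mul (Real.exp_pos (-(y * a))).le).congr hS
      fun w _ => ?_
    rw [← Real.exp_add]
    ring_nf

/-- `exp (-f)` is approximated by `(1 + f/n)^{-n}`, so it is enough to know `1/(X + f)`. -/
lemma exp_neg_of_inv (hS : IsUpperSet S) {b : ℝ → ℝ} {X₀ : ℝ} (hb : ∀ w ∈ S, 0 ≤ b w)
    (h : ∀ X, X₀ ≤ X → DCM S (fun w => 1 / (X + b w))) {a : ℝ} (ha : 0 ≤ a) :
    DCM S (fun w => Real.exp (-(a * b w))) := by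
  rcases ha.eq_or_lt with rfl | ha
  · simpa using const zero_le_one
  refine of_tendsto (u := atTop) (F := fun (n : ℕ) w => ((1 + a * b w / n) ^ n)⁻¹) hS ?_ ?_
  · filter_upwards [eventually_gt_atTop 0, tendsto_natCast_atTop_atTop.eventually
      (eventually_ge_atTop (a * X₀))] with n hn hn'
    have hn0 : (0:ℝ) < n := by exact_mod_cast hn
    have hX : X₀ ≤ n / a := by rw [le_div_iff₀ ha]; linarith
    refine (((h _ hX).const_mul (c := n / a) (by positivity)).pow hS n).congr hS fun w hw => ?_
    rw [← inv_pow]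
    congr 1
    have := hb w hw
    have h1 : (n : ℝ) / a + b w ≠ 0 := by positivity
    have h2 : 1 + a * b w / n ≠ 0 := by positivity
    field_simp
  · intro w hw
    have := (Real.tendsto_one_add_div_pow_exp (a * b w)).inv₀ (Real.exp_pos _).ne'
    rwa [← Real.exp_neg] at this

end DCM

/-! ### A Cauchy formula in the strip `|Im ζ| ≤ π` -/

lemma integrable_exp_neg_mul_abs {a : ℝ} (ha : 0 < a) :
    Integrable (fun x : ℝ => Real.exp (-(a * |x|))) := by
  rw [← integrableOn_univ, ← Iic_union_Ioi (a := (0:ℝ))]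
  refine IntegrableOn.union ?_ ?_
  · refine (integrableOn_exp_mul_Iic ha 0).congr_fun (fun x hx => ?_) measurableSet_Iic
    simp [abs_of_nonpos (show x ≤ 0 from hx)]
  · refine (integrableOn_exp_mul_Ioi (neg_lt_zero.2 ha) 0).congr_fun (fun x hx => ?_)
      measurableSet_Ioi
    simp [abs_of_pos (show 0 < x from hx)]

/-- A function holomorphic in the closed strip `|Im ζ| ≤ π`, bounded there by a multiple
of `exp (-η Re ζ)` with `0 < η < 1`. -/
structure StripFun (f : ℂ → ℂ) (C η : ℝ) : Prop where
  pos : 0 < η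
  lt_one : η < 1
  diff : ∀ ζ : ℂ, |ζ.im| ≤ π → DifferentiableAt ℂ f ζ
  bound : ∀ ζ : ℂ, |ζ.im| ≤ π → ‖f ζ‖ ≤ C * Real.exp (-(η * ζ.re))

lemma norm_exp_add_exp_ge (p : ℂ) (x : ℝ) :
    Real.cos (p.im / 2) * (Real.exp x + Real.exp p.re) ≤ ‖cexp x + cexp p‖ := by
  have h : ‖cexp x + cexp p‖ ^ 2 = Real.exp x ^ 2 + Real.exp p.re ^ 2
      + 2 * Real.exp x * Real.exp p.re * Real.cos p.im := by
    rw [Complex.sq_norm, Complex.normSq_apply]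
    simp only [add_re, add_im, Complex.exp_re, Complex.exp_im, ofReal_re, ofReal_im, Real.cos_zero,
      Real.sin_zero, mul_one, mul_zero, zero_add]
    have := Real.sin_sq_add_cos_sq p.im
    linear_combination Real.exp p.re ^ 2 * this
  have h2 : Real.cos p.im = 2 * Real.cos (p.im / 2) ^ 2 - 1 := by
    rw [← Real.cos_two_mul]; ring_nf
  refine le_of_sq_le_sq ?_ (norm_nonneg _)
  rw [h, h2]
  have h3 := Real.cos_sq_le_one (p.im / 2)
  nlinarith [mul_nonneg (sub_nonneg.2 h3) (sq_nonneg (Real.exp x - Real.exp p.re))]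

lemma cos_half_pos {p : ℂ} (hp : |p.im| < π) : 0 < Real.cos (p.im / 2) := by
  rw [abs_lt] at hp
  exact Real.cos_pos_of_mem_Ioo ⟨by linarith, by linarith⟩

lemma exp_add_exp_ne_zero {p : ℂ} (hp : |p.im| < π) (x : ℝ) : cexp x + cexp p ≠ 0 := by
  rw [← norm_pos_iff]
  refine lt_of_lt_of_le ?_ (norm_exp_add_exp_ge p x)
  have := cos_half_pos hp
  positivity

lemma exp_mul_div_le {η : ℝ} (h0 : 0 < η) (h1 : η < 1) {A : ℝ} (hA : 0 < A) (x : ℝ) :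
    Real.exp (-(η * x)) * (Real.exp x / (Real.exp x + A)) ≤
      (1 + A⁻¹) * Real.exp (-(min η (1 - η) * |x|)) := by
  have hA' : 0 < A⁻¹ := inv_pos.2 hA
  rcases le_total 0 x with hx | hx
  · rw [abs_of_nonneg hx]
    have e1 : Real.exp (-(η * x)) ≤ Real.exp (-(min η (1 - η) * x)) := by
      apply Real.exp_le_exp.2
      nlinarith [min_le_left η (1 - η)]
    have e2 : Real.exp x / (Real.exp x + A) ≤ 1 := by
      rw [div_le_one (by positivity)]; linarith
    calc _ ≤ Real.exp (-(min η (1 - η) * x)) * 1 := by gcongr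
      _ ≤ _ := by nlinarith [Real.exp_pos (-(min η (1 - η) * x))]
  · rw [abs_of_nonpos hx]
    have e1 : Real.exp (-(η * x)) * Real.exp x ≤ Real.exp (-(min η (1 - η) * -x)) := by
      rw [← Real.exp_add]
      apply Real.exp_le_exp.2
      nlinarith [min_le_right η (1 - η)]
    have e2 : 1 / (Real.exp x + A) ≤ A⁻¹ := by
      rw [← one_div]; gcongr; linarith [Real.exp_pos x]
    calc Real.exp (-(η * x)) * (Real.exp x / (Real.exp x + A))
        = (Real.exp (-(η * x)) * Real.exp x) * (1 / (Real.exp x + A)) := by ring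
      _ ≤ Real.exp (-(min η (1 - η) * -x)) * A⁻¹ := by gcongr
      _ ≤ _ := by nlinarith [Real.exp_pos (-(min η (1 - η) * -x))]

namespace StripFun

variable {f : ℂ → ℂ} {C η : ℝ}

lemma const_nonneg (hf : StripFun f C η) : 0 ≤ C := by
  have := (norm_nonneg _).trans (hf.bound 0 (by simp [Real.pi_pos.le]))
  simpa using this

lemma continuous_line (hf : StripFun f C η) {a : ℝ} (ha : |a| ≤ π) :
    Continuous (fun x : ℝ => f (x + a * I)) := by
  rw [continuous_iff_continuousAt]
  intro x
  have h : ContinuousAt f ((x : ℂ) + a * I) := (hf.diff _ (by simpa using ha)).continuousAt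
  exact ContinuousAt.comp (f := fun x : ℝ => (x : ℂ) + a * I) h (by fun_prop)

lemma norm_line (hf : StripFun f C η) {a : ℝ} (ha : |a| ≤ π) (x : ℝ) :
    ‖f (x + a * I)‖ ≤ C * Real.exp (-(η * x)) := by
  simpa using hf.bound (x + a * I) (by simpa using ha)

lemma integrable_line (hf : StripFun f C η) {p : ℂ} (hp : |p.im| < π) {a : ℝ} (ha : |a| ≤ π) :
    Integrable (fun x : ℝ => f (x + a * I) * (cexp x / (cexp x + cexp p))) := by
  set c := Real.cos (p.im / 2) with hc
  have hc0 : 0 < c := cos_half_pos hp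
  have hε : 0 < min η (1 - η) := lt_min hf.pos (by linarith [hf.lt_one])
  refine Integrable.mono' ((integrable_exp_neg_mul_abs hε).const_mul
    (C * c⁻¹ * (1 + (Real.exp p.re)⁻¹))) ?_ (Eventually.of_forall fun x => ?_)
  · refine ((hf.continuous_line ha).mul ?_).aestronglyMeasurable
    exact Continuous.div (by fun_prop) (by fun_prop) (exp_add_exp_ne_zero hp)
  · have hC := hf.const_nonneg
    have h1 := hf.norm_line ha x
    have h2 : ‖cexp x / (cexp x + cexp p)‖ ≤ c⁻¹ * (Real.exp x / (Real.exp x + Real.exp p.re)) := by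
      rw [norm_div, ← ofReal_exp, norm_real, Real.norm_eq_abs, Real.abs_exp, ofReal_exp]
      have h3 : 0 < c * (Real.exp x + Real.exp p.re) := by positivity
      calc _ ≤ Real.exp x / (c * (Real.exp x + Real.exp p.re)) := by
            gcongr; exact norm_exp_add_exp_ge p x
        _ = _ := by field_simp
    rw [norm_mul]
    calc _ ≤ (C * Real.exp (-(η * x))) * (c⁻¹ * (Real.exp x / (Real.exp x + Real.exp p.re))) := by
          gcongr
      _ = C * c⁻¹ * (Real.exp (-(η * x)) * (Real.exp x / (Real.exp x + Real.exp p.re))) := by ring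
      _ ≤ C * c⁻¹ * ((1 + (Real.exp p.re)⁻¹) * Real.exp (-(min η (1 - η) * |x|))) := by
          exact mul_le_mul_of_nonneg_left
            (exp_mul_div_le hf.pos hf.lt_one (Real.exp_pos _) x) (by positivity)
      _ = _ := by ring

/-- Cauchy's formula for the strip. -/
theorem cauchy (hf : StripFun f C η) {p : ℂ} (hp : |p.im| < π) :
    2 * π * I * f p = ∫ x : ℝ, (f (x + (-π : ℝ) * I) - f (x + (π : ℝ) * I)) *
      (cexp x / (cexp x + cexp p)) := by
  have hpi := Real.pi_pos
  set T : Set ℂ := {ζ | |ζ.im| ≤ π} with hT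
  have hTp : T ∈ 𝓝 p := by
    have : {ζ : ℂ | |ζ.im| < π} ∈ 𝓝 p :=
      (isOpen_lt (by fun_prop) continuous_const).mem_nhds hp
    exact mem_of_superset this fun ζ (hζ : |ζ.im| < π) => hζ.le
  set G : ℂ → ℂ := fun ζ => dslope f p ζ * (cexp ζ / dslope cexp p ζ) with hG
  have hne : ∀ ζ ∈ T, dslope cexp p ζ ≠ 0 := by
    intro ζ hζ
    by_cases h : ζ = p
    · subst h; rw [dslope_same]; simp
    · rw [dslope_of_ne _ h, slope_def_field]
      refine div_ne_zero (fun h0 => ?_) (sub_ne_zero.2 h)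
      obtain ⟨n, hn⟩ := Complex.exp_eq_exp_iff_exists_int.1 (sub_eq_zero.1 h0)
      have him : ζ.im = p.im + n * (2 * π) := by
        rw [hn]; simp
      have hb : |ζ.im| ≤ π := hζ
      rw [abs_le] at hb
      rw [abs_lt] at hp
      have h1 : (n : ℝ) < 1 := by nlinarith
      have h2 : (-1 : ℝ) < n := by nlinarith
      have h3 : n = 0 := by
        have h1' : n < 1 := by exact_mod_cast h1
        have h2' : -1 < n := by exact_mod_cast h2
        omega
      apply h; rw [hn, h3]; simp
  have hGd : DifferentiableOn ℂ G T := by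
    refine DifferentiableOn.mul ?_ (DifferentiableOn.div ?_ ?_ hne)
    · exact (Complex.differentiableOn_dslope hTp).2
        fun ζ hζ => (hf.diff ζ hζ).differentiableWithinAt
    · exact Complex.differentiable_exp.differentiableOn
    · exact (Complex.differentiableOn_dslope hTp).2 Complex.differentiable_exp.differentiableOn
  have hGe : ∀ ζ ∈ T, ζ ≠ p → G ζ = (f ζ - f p) * (cexp ζ / (cexp ζ - cexp p)) := by
    intro ζ hζ h
    have h1 := hne ζ hζ
    simp only [hG]
    rw [dslope_of_ne _ h, slope_def_field] at h1 ⊢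
    rw [dslope_of_ne _ h, slope_def_field]
    have h2 := sub_ne_zero.2 h
    have h3 := (div_ne_zero_iff.1 h1).1
    field_simp
  have hcont : ∀ a : ℝ, |a| ≤ π → Continuous (fun x : ℝ => G (x + a * I)) := by
    intro a ha
    exact ContinuousOn.comp_continuous hGd.continuousOn (by fun_prop)
      (fun x => by simpa [hT] using ha)
  -- the rectangle
  have hrect : ∀ R : ℝ, 0 < R → (∫ x in -R..R, (G (x + (-π : ℝ) * I) - G (x + (π : ℝ) * I)))
      + I * (∫ y in -π..π, G (R + y * I)) - I * (∫ y in -π..π, G ((-R : ℝ) + y * I)) = 0 := by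
    intro R hR
    have h := Complex.integral_boundary_rect_eq_zero_of_differentiableOn G
      (-R - π * I) (R + π * I) (hGd.mono ?_)
    · rw [intervalIntegral.integral_sub ((hcont _ (by simp [abs_of_pos hpi])).intervalIntegrable _ _)
        ((hcont _ (by simp [abs_of_pos hpi])).intervalIntegrable _ _)]
      simpa using h
    · intro ζ hζ
      have := hζ.2
      simp only [sub_im, neg_im, ofReal_im, mul_im, ofReal_re, I_im, mul_one, I_re, mul_zero,
        add_im, neg_zero, zero_sub, zero_add, add_zero, mem_preimage] at this
      rw [uIcc_of_le (by linarith)] at this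
      exact abs_le.2 this
  have hexpI : ∀ x : ℝ, cexp (x + (-π : ℝ) * I) = - cexp x ∧ cexp (x + (π : ℝ) * I) = -cexp x := by
    intro x
    constructor
    · rw [Complex.exp_add]; simp [Complex.exp_neg]
    · rw [Complex.exp_add]; simp
  have hΦ : ∀ x : ℝ, G (x + (-π : ℝ) * I) - G (x + (π : ℝ) * I) =
      (f (x + (-π : ℝ) * I) - f (x + (π : ℝ) * I)) * (cexp x / (cexp x + cexp p)) := by
    intro x
    have hp' := abs_lt.1 hp
    rw [hGe, hGe, (hexpI x).1, (hexpI x).2]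
    · have := exp_add_exp_ne_zero hp x
      have h2 : -cexp x - cexp p ≠ 0 := by
        intro h; apply this; linear_combination -h
      field_simp
      ring
    · simp [hT, abs_of_pos hpi]
    · intro h; have := congrArg Complex.im h; simp at this; linarith
    · simp [hT, abs_of_pos hpi]
    · intro h; have := congrArg Complex.im h; simp at this; linarith
  set A := Real.exp p.re with hA
  have hA0 : 0 < A := Real.exp_pos _
  have hnormp : ‖cexp p‖ = A := Complex.norm_exp p
  have hC := hf.const_nonneg
  have hnexp : ∀ (x y : ℝ), ‖cexp (x + y * I)‖ = Real.exp x := by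
    intro x y; rw [Complex.norm_exp]; simp
  have hright : Tendsto (fun R : ℝ => ∫ y in -π..π, G (R + y * I)) atTop
      (𝓝 (-(2 * π) * f p)) := by
    rw [tendsto_iff_norm_sub_tendsto_zero]
    have hb : Tendsto (fun R : ℝ => (C * Real.exp (-(η * R)) * 2 + ‖f p‖ * (2 * A * Real.exp (-R)))
        * |π - -π|) atTop (𝓝 0) := by
      have h1 : Tendsto (fun R : ℝ => Real.exp (-(η * R))) atTop (𝓝 0) :=
        Real.tendsto_exp_neg_atTop_nhds_zero.comp (tendsto_id.const_mul_atTop hf.pos)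
      have h2 := Real.tendsto_exp_neg_atTop_nhds_zero
      have := (((h1.const_mul C).mul_const 2).add ((h2.const_mul (2 * A)).const_mul ‖f p‖)).mul_const
        |π - -π|
      simpa using this
    refine squeeze_zero' (Eventually.of_forall fun _ => norm_nonneg _) ?_ hb
    have hev := Real.tendsto_exp_atTop.eventually (eventually_gt_atTop (2 * A))
    filter_upwards [hev] with R hR
    have e : (∫ y in -π..π, G (R + y * I)) - -(2 * π) * f p =
        ∫ y in -π..π, (G (R + y * I) + f p) := by
      rw [intervalIntegral.integral_add, intervalIntegral.integral_const]
      · rw [Complex.real_smul]; push_cast; ring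
      · refine ContinuousOn.intervalIntegrable ?_
        refine hGd.continuousOn.comp (by fun_prop) ?_
        intro y hy
        rw [uIcc_of_le (by linarith)] at hy
        simpa [hT] using abs_le.2 hy
      · simp
    rw [e]
    refine intervalIntegral.norm_integral_le_of_norm_le_const fun y hy => ?_
    rw [uIoc_of_le (by linarith)] at hy
    have hy' : |y| ≤ π := abs_le.2 ⟨hy.1.le, hy.2⟩
    have hn : Real.exp R / 2 ≤ ‖cexp (R + y * I) - cexp p‖ := by
      have := norm_sub_norm_le (cexp (R + y * I)) (cexp p)
      rw [hnexp, hnormp] at this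
      linarith
    have hn0 : cexp (R + y * I) - cexp p ≠ 0 := by
      rw [← norm_pos_iff]; exact lt_of_lt_of_le (by positivity) hn
    rw [hGe _ (by simpa [hT] using hy')]
    · have e2 : (f (R + y * I) - f p) * (cexp (R + y * I) / (cexp (R + y * I) - cexp p)) + f p =
          f (R + y * I) * (cexp (R + y * I) / (cexp (R + y * I) - cexp p)) -
          f p * (cexp p / (cexp (R + y * I) - cexp p)) := by
        field_simp; ring
      rw [e2]
      refine (norm_sub_le _ _).trans ?_
      rw [norm_mul, norm_mul, norm_div, norm_div, hnexp, hnormp]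
      gcongr
      · exact hf.norm_line hy' R
      · rw [div_le_iff₀ (by linarith [Real.exp_pos R])]; linarith
      · rw [div_le_iff₀ (by linarith [Real.exp_pos R])]
        have : Real.exp (-R) * Real.exp R = 1 := by rw [← Real.exp_add]; simp
        have h5 := mul_le_mul_of_nonneg_left hn (show 0 ≤ 2 * A * Real.exp (-R) by positivity)
        linear_combination h5 - A * this
    · rintro rfl; simp at hn0
  have hleft : Tendsto (fun R : ℝ => ∫ y in -π..π, G ((-R : ℝ) + y * I)) atTop (𝓝 0) := by
    rw [tendsto_zero_iff_norm_tendsto_zero]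
    have hb : Tendsto (fun R : ℝ => ((C * Real.exp (-((1 - η) * R)) + ‖f p‖ * Real.exp (-R)) *
        (2 * A⁻¹)) * |π - -π|) atTop (𝓝 0) := by
      have h1 : Tendsto (fun R : ℝ => Real.exp (-((1 - η) * R))) atTop (𝓝 0) :=
        Real.tendsto_exp_neg_atTop_nhds_zero.comp
          (tendsto_id.const_mul_atTop (by linarith [hf.lt_one]))
      have h2 := Real.tendsto_exp_neg_atTop_nhds_zero
      have := (((h1.const_mul C).add (h2.const_mul ‖f p‖)).mul_const (2 * A⁻¹)).mul_const
        |π - -π|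
      simpa using this
    refine squeeze_zero' (Eventually.of_forall fun _ => norm_nonneg _) ?_ hb
    have hev := Real.tendsto_exp_neg_atTop_nhds_zero.eventually
      (eventually_lt_nhds (show 0 < A / 2 by positivity))
    filter_upwards [hev] with R hR
    refine intervalIntegral.norm_integral_le_of_norm_le_const fun y hy => ?_
    rw [uIoc_of_le (by linarith)] at hy
    have hy' : |y| ≤ π := abs_le.2 ⟨hy.1.le, hy.2⟩
    have hn : A / 2 ≤ ‖cexp ((-R : ℝ) + y * I) - cexp p‖ := by
      have := norm_sub_norm_le (cexp p) (cexp ((-R : ℝ) + y * I))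
      rw [norm_sub_rev, hnexp, hnormp] at this
      linarith
    have hn0 : cexp ((-R : ℝ) + y * I) - cexp p ≠ 0 := by
      rw [← norm_pos_iff]; exact lt_of_lt_of_le (by positivity) hn
    rw [hGe _ (by simpa [hT] using hy')]
    · rw [norm_mul, norm_div, hnexp]
      have h1 : ‖f ((-R : ℝ) + y * I) - f p‖ ≤ C * Real.exp (η * R) + ‖f p‖ := by
        refine (norm_sub_le _ _).trans ?_
        have := hf.norm_line hy' (-R)
        rw [mul_neg, neg_neg] at this
        linarith
      have h2 : Real.exp (-R) / ‖cexp ((-R : ℝ) + y * I) - cexp p‖ ≤ Real.exp (-R) * (2 * A⁻¹) := by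
        calc _ ≤ Real.exp (-R) / (A / 2) := by gcongr
          _ = _ := by field_simp
      calc _ ≤ (C * Real.exp (η * R) + ‖f p‖) * (Real.exp (-R) * (2 * A⁻¹)) := by gcongr
        _ = _ := by
          have : Real.exp (-((1 - η) * R)) = Real.exp (η * R) * Real.exp (-R) := by
            rw [← Real.exp_add]; ring_nf
          rw [this]; ring
    · intro h; rw [h] at hn0; simp at hn0
  have hfi : Integrable (fun x : ℝ => (f (x + (-π : ℝ) * I) - f (x + (π : ℝ) * I)) *
      (cexp x / (cexp x + cexp p))) := by
    have := (hf.integrable_line hp (a := -π) (by simp [abs_of_pos hpi])).sub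
      (hf.integrable_line hp (a := π) (by simp [abs_of_pos hpi]))
    refine this.congr (Eventually.of_forall fun x => ?_)
    simp only [Pi.sub_apply]; ring
  have hmain := intervalIntegral_tendsto_integral hfi tendsto_neg_atTop_atBot tendsto_id
  have hlim := (hmain.add (hright.const_mul I)).sub (hleft.const_mul I)
  have hz : Tendsto (fun _ : ℝ => (0:ℂ)) atTop (𝓝 0) := tendsto_const_nhds
  have := tendsto_nhds_unique (hlim.congr' ?_) hz
  · simp only [mul_zero, sub_zero] at this
    linear_combination -this
  · filter_upwards [eventually_gt_atTop 0] with R hR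
    have := hrect R hR
    simp only [hΦ] at this
    exact this

end StripFun

namespace StripFun

variable {f : ℂ → ℂ} {C η : ℝ}

lemma conj_line (hsym : ∀ ζ, f (conj ζ) = conj (f ζ)) (x : ℝ) :
    f (x + (-π : ℝ) * I) - f (x + (π : ℝ) * I) = ((-2 * (f (x + (π : ℝ) * I)).im : ℝ) : ℂ) * I := by
  have h : (x + (-π : ℝ) * I : ℂ) = conj (x + (π : ℝ) * I) := by simp
  rw [h, hsym]
  apply Complex.ext
  · simp
  · simp; ring

lemma integrable_im (hf : StripFun f C η) (p : ℝ) :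
    Integrable (fun x : ℝ => (-(f (x + (π : ℝ) * I)).im / π) *
      (Real.exp x / (Real.exp x + Real.exp p))) := by
  have h := (hf.integrable_line (p := p) (a := π) (by simp [Real.pi_pos])
    (by simp [abs_of_pos Real.pi_pos])).im.const_mul (-(1 / π))
  refine h.congr (Eventually.of_forall fun x => ?_)
  have : (cexp x / (cexp x + cexp p)) = ((Real.exp x / (Real.exp x + Real.exp p) : ℝ) : ℂ) := by
    push_cast; rfl
  simp only [this]
  change -(1 / π) * (f (x + (π : ℝ) * I) * _).im = _
  rw [Complex.im_mul_ofReal]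
  ring

lemma re_formula (hf : StripFun f C η) (hsym : ∀ ζ, f (conj ζ) = conj (f ζ)) (p : ℝ) :
    f p = ((∫ x : ℝ, (-(f (x + (π : ℝ) * I)).im / π) *
      (Real.exp x / (Real.exp x + Real.exp p)) : ℝ) : ℂ) := by
  have h := hf.cauchy (p := p) (by simp [Real.pi_pos])
  have e : ∀ x : ℝ, (f (x + (-π : ℝ) * I) - f (x + (π : ℝ) * I)) *
      (cexp x / (cexp x + cexp p)) = (2 * π * I) * (((-(f (x + (π : ℝ) * I)).im / π) *
      (Real.exp x / (Real.exp x + Real.exp p)) : ℝ) : ℂ) := by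
    intro x
    rw [conj_line hsym]
    have := Real.pi_ne_zero
    push_cast
    field_simp
  simp only [e] at h
  rw [integral_const_mul, integral_complex_ofReal] at h
  exact mul_left_cancel₀ (by simp [Real.pi_ne_zero]) h

/-- If the boundary values have nonpositive imaginary part, then `s ↦ f (log s)` is completely
monotone. -/
lemma dcm_log (hf : StripFun f C η) (hsym : ∀ ζ, f (conj ζ) = conj (f ζ))
    (him : ∀ x : ℝ, (f (x + (π : ℝ) * I)).im ≤ 0) :
    DCM (Ioi 0) (fun s => (f (Real.log s)).re) := by
  have hS : IsUpperSet (Ioi (0:ℝ)) := isUpperSet_Ioi 0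
  have hfi : ∀ s ∈ Ioi (0:ℝ), Integrable (fun x : ℝ => (-(f (x + (π : ℝ) * I)).im / π) *
      (Real.exp x / (Real.exp x + s))) := by
    intro s hs
    have := hf.integrable_im (Real.log s)
    rwa [Real.exp_log hs] at this
  refine (DCM.integral hS (Eventually.of_forall fun x => ?_) hfi).congr hS fun s hs => ?_
  · have h1 : DCM (Ioi 0) (fun s => 1 / (Real.exp x + s)) :=
      DCM.inv_add hS fun w hw => add_pos (Real.exp_pos x) hw
    have h2 : 0 ≤ -(f (x + (π : ℝ) * I)).im / π * Real.exp x := by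
      have := him x
      have := Real.pi_pos
      have : 0 ≤ -(f (x + (π : ℝ) * I)).im := by linarith
      positivity
    refine (h1.const_mul h2).congr hS fun s _ => by ring
  · rw [hf.re_formula hsym (Real.log s), Real.exp_log hs, ofReal_re]

lemma integrable_even (hf : StripFun f C η) (hsym : ∀ ζ, f (conj ζ) = conj (f ζ))
    (heven : ∀ ζ, f (-ζ) = f ζ) (p : ℝ) :
    IntegrableOn (fun x : ℝ => (-(f (x + (π : ℝ) * I)).im / π) * (2 * Real.sinh x) *
      (1 / (2 * Real.cosh x + 2 * Real.cosh p))) (Ioi 0) ∧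
    (f p).re = ∫ x in Ioi (0:ℝ), (-(f (x + (π : ℝ) * I)).im / π) * (2 * Real.sinh x) *
      (1 / (2 * Real.cosh x + 2 * Real.cosh p)) := by
  set Φ : ℝ → ℝ := fun x => (-(f (x + (π : ℝ) * I)).im / π) *
      (Real.exp x / (Real.exp x + Real.exp p)) with hΦ
  have hfi : Integrable Φ := hf.integrable_im p
  have hneg : ∀ x : ℝ, (f ((-x : ℝ) + (π : ℝ) * I)).im = -(f (x + (π : ℝ) * I)).im := by
    intro x
    have h : (((-x : ℝ) : ℂ) + (π : ℝ) * I) = -(conj (x + (π : ℝ) * I)) := by simp [add_comm]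
    rw [h, heven, hsym, Complex.conj_im]
  have key : ∀ x : ℝ, Φ x + Φ (-x) = (-(f (x + (π : ℝ) * I)).im / π) * (2 * Real.sinh x) *
      (1 / (2 * Real.cosh x + 2 * Real.cosh p)) := by
    intro x
    simp only [hΦ, hneg, Real.sinh_eq, Real.cosh_eq, Real.exp_neg]
    have h1 := Real.exp_pos x
    have h2 := Real.exp_pos p
    have := Real.pi_pos
    field_simp
    ring
  have hfi2 : Integrable (fun x => Φ x + Φ (-x)) := hfi.add hfi.comp_neg
  simp only [key] at hfi2
  refine ⟨hfi2.integrableOn, ?_⟩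
  have h := hf.re_formula hsym p
  rw [h, ofReal_re]
  have h3 := integral_comp_neg_Ioi (0:ℝ) Φ
  rw [neg_zero] at h3
  rw [← intervalIntegral.integral_Iic_add_Ioi (f := Φ) (b := 0) hfi.integrableOn hfi.integrableOn,
    ← h3, add_comm, ← integral_add hfi.integrableOn hfi.comp_neg.integrableOn]
  exact integral_congr_ae (Eventually.of_forall key)

end StripFun

/-- The point `p ≥ 0` with `2 cosh p = w`. -/
noncomputable def pOf (w : ℝ) : ℝ := Real.arcosh (w / 2)

lemma two_cosh_pOf {w : ℝ} (hw : 2 ≤ w) : 2 * Real.cosh (pOf w) = w := by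
  rw [pOf, Real.cosh_arcosh (by linarith)]; ring

lemma pOf_two_cosh {p : ℝ} (hp : 0 ≤ p) : pOf (2 * Real.cosh p) = p := by
  rw [pOf, mul_div_cancel_left₀ _ two_ne_zero, Real.arcosh_cosh hp]

lemma two_le_two_cosh (p : ℝ) : 2 ≤ 2 * Real.cosh p := by linarith [Real.one_le_cosh p]

lemma pOf_nonneg {w : ℝ} (hw : 2 ≤ w) : 0 ≤ pOf w := Real.arcosh_nonneg (by linarith)

namespace StripFun

variable {f : ℂ → ℂ} {C η : ℝ}

lemma dcm_even (hf : StripFun f C η) (hsym : ∀ ζ, f (conj ζ) = conj (f ζ))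
    (heven : ∀ ζ, f (-ζ) = f ζ) (him : ∀ x : ℝ, 0 ≤ x → (f (x + (π : ℝ) * I)).im ≤ 0)
    {b : ℝ → ℝ} (hinv : ∀ X, 2 ≤ X → DCM (Ici 2) (fun w => 1 / (X + 2 * Real.cosh (b w)))) :
    DCM (Ici 2) (fun w => (f (b w)).re) := by
  have hS : IsUpperSet (Ici (2:ℝ)) := isUpperSet_Ici 2
  have h := DCM.integral (μ := volume.restrict (Ioi (0:ℝ))) (S := Ici 2) hS
    (F := fun x w => (-(f (x + (π : ℝ) * I)).im / π) * (2 * Real.sinh x) *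
      (1 / (2 * Real.cosh x + 2 * Real.cosh (b w)))) ?_
      (fun w _ => (hf.integrable_even hsym heven (b w)).1)
  · exact h.congr hS fun w _ => (hf.integrable_even hsym heven (b w)).2
  · refine (ae_restrict_mem measurableSet_Ioi).mono fun x hx => ?_
    have hx' : (0:ℝ) ≤ x := le_of_lt hx
    refine (hinv (2 * Real.cosh x) (two_le_two_cosh x)).const_mul ?_
    have h1 := him x hx'
    have h2 := Real.sinh_nonneg_iff.2 hx'
    have h3 : 0 ≤ -(f (x + (π : ℝ) * I)).im := by linarith
    have := Real.pi_pos
    positivity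

end StripFun

lemma dcm_inv_add_two_cosh_pOf {X : ℝ} (hX : 2 ≤ X) :
    DCM (Ici 2) (fun w => 1 / (X + 2 * Real.cosh (pOf w))) := by
  have hS : IsUpperSet (Ici (2:ℝ)) := isUpperSet_Ici 2
  refine (DCM.inv_add (y := X) hS fun w hw => ?_).congr hS fun w hw => by rw [two_cosh_pOf hw]
  have : (2:ℝ) ≤ w := hw
  linarith

/-! ### Basic examples -/

lemma stripFun_inv_add_exp {X α : ℝ} (hX : 0 < X) (h0 : 0 < α) (h1 : α < 1) :
    StripFun (fun ζ => 1 / (X + cexp (α * ζ))) (Real.cos (α * π / 2))⁻¹ α := by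
  have hpi := Real.pi_pos
  have hc : 0 < Real.cos (α * π / 2) :=
    Real.cos_pos_of_mem_Ioo ⟨by nlinarith [mul_pos h0 hpi], by nlinarith⟩
  have hlow : ∀ ζ : ℂ, |ζ.im| ≤ π →
      Real.cos (α * π / 2) * Real.exp (α * ζ.re) ≤ ‖(X:ℂ) + cexp (α * ζ)‖ := by
    intro ζ hζ
    have h := norm_exp_add_exp_ge (α * ζ) (Real.log X)
    rw [← ofReal_exp, Real.exp_log hX] at h
    simp only [re_ofReal_mul, im_ofReal_mul] at h
    refine le_trans ?_ h
    have h2 : Real.cos (α * π / 2) ≤ Real.cos (α * ζ.im / 2) := by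
      rw [← Real.cos_abs (α * ζ.im / 2)]
      apply Real.cos_le_cos_of_nonneg_of_le_pi (abs_nonneg _) (by nlinarith)
      rw [abs_div, abs_mul, abs_of_pos h0, abs_two]
      gcongr
    have := Real.exp_pos (α * ζ.re)
    apply mul_le_mul h2 (by linarith) this.le (hc.le.trans h2)
  refine ⟨h0, h1, fun ζ hζ => ?_, fun ζ hζ => ?_⟩
  · refine DifferentiableAt.div (by fun_prop) (by fun_prop) ?_
    rw [← norm_pos_iff]
    exact lt_of_lt_of_le (by positivity) (hlow ζ hζ)
  · rw [norm_div, norm_one, Real.exp_neg, ← mul_inv, ← one_div]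
    exact one_div_le_one_div_of_le (by positivity) (hlow ζ hζ)

lemma dcm_inv_add_rpow {X α : ℝ} (hX : 0 < X) (h0 : 0 < α) (h1 : α < 1) :
    DCM (Ioi 0) (fun s => 1 / (X + s ^ α)) := by
  have hpi := Real.pi_pos
  refine ((stripFun_inv_add_exp hX h0 h1).dcm_log (fun ζ => ?_) (fun x => ?_)).congr
    (isUpperSet_Ioi 0) fun s hs => ?_
  · simp [← Complex.exp_conj]
  · simp only [one_div, Complex.inv_im, add_im, ofReal_im, zero_add]
    have h : 0 ≤ (cexp (α * (x + (π : ℝ) * I))).im := by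
      rw [Complex.exp_im]
      simp only [re_ofReal_mul, add_im, ofReal_im, mul_im, ofReal_re, I_im, mul_one,
        I_re, mul_zero, add_zero, zero_add, zero_mul]
      exact mul_nonneg (Real.exp_pos _).le
        (Real.sin_nonneg_of_nonneg_of_le_pi (by positivity) (by nlinarith))
    exact div_nonpos_of_nonpos_of_nonneg (by linarith) (normSq_nonneg _)
  · rw [Real.rpow_def_of_pos hs]
    have : (1 / ((X:ℂ) + cexp (α * (Real.log s : ℝ)))) =
      ((1 / (X + Real.exp (Real.log s * α)) : ℝ) : ℂ) := by push_cast; ring_nf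
    rw [this, ofReal_re]

lemma dcm_exp_neg_rpow {t α : ℝ} (ht : 0 ≤ t) (h0 : 0 < α) (h1 : α < 1) :
    DCM (Ioi 0) (fun s => Real.exp (-(t * s ^ α))) :=
  DCM.exp_neg_of_inv (X₀ := 1) (isUpperSet_Ioi 0) (fun _ hw => Real.rpow_nonneg (le_of_lt hw) α)
    (fun X hX => dcm_inv_add_rpow (by linarith) h0 h1) ht

lemma dcm_rpow_neg {δ : ℝ} (h0 : 0 < δ) (h1 : δ < 1) : DCM (Ioi 0) (fun s => s ^ (-δ)) := by
  have hpi := Real.pi_pos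
  have hf : StripFun (fun ζ => cexp (-(δ * ζ))) 1 δ := by
    refine ⟨h0, h1, fun ζ _ => by fun_prop, fun ζ _ => ?_⟩
    rw [Complex.norm_exp]; simp
  refine (hf.dcm_log (fun ζ => ?_) (fun x => ?_)).congr (isUpperSet_Ioi 0) fun s hs => ?_
  · simp [← Complex.exp_conj]
  · rw [Complex.exp_im]
    simp only [neg_im, neg_re, re_ofReal_mul, add_im, ofReal_im, mul_im, ofReal_re,
      I_im, mul_one, I_re, mul_zero, add_zero, zero_add, zero_mul, Real.sin_neg]
    have := Real.sin_nonneg_of_nonneg_of_le_pi (show 0 ≤ δ * π by positivity) (by nlinarith)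
    have := mul_nonneg (Real.exp_pos (-(δ * (x + (π : ℝ) * I : ℂ).re))).le this
    linarith
  · rw [Real.rpow_def_of_pos hs]
    have : cexp (-(δ * (Real.log s : ℝ))) = ((Real.exp (Real.log s * -δ) : ℝ) : ℂ) := by
      push_cast; ring_nf
    rw [this, ofReal_re]

lemma stripFun_inv_add_cosh {X q : ℝ} (hX : 2 ≤ X) (h0 : 0 < q) (h1 : q < 1) :
    StripFun (fun ζ => 1 / (X + 2 * Complex.cosh (q * ζ))) ((Real.cos (q * π / 2)) ^ 2)⁻¹ q := by
  have hpi := Real.pi_pos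
  have hc : 0 < Real.cos (q * π / 2) :=
    Real.cos_pos_of_mem_Ioo ⟨by nlinarith [mul_pos h0 hpi], by nlinarith⟩
  set a := pOf X with ha
  have hXa : X = Real.exp a + Real.exp (-a) := by
    rw [← two_cosh_pOf hX, Real.cosh_eq]; ring
  have hfac : ∀ ζ : ℂ, (X:ℂ) + 2 * Complex.cosh (q * ζ) =
      (cexp a + cexp (q * ζ)) * (cexp (0:ℝ) + cexp (-a - q * ζ)) := by
    intro ζ
    rw [hXa, Complex.cosh]
    push_cast
    rw [Complex.exp_zero, mul_add, mul_one, add_mul, ← Complex.exp_add, ← Complex.exp_add]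
    ring_nf
  have hlow : ∀ ζ : ℂ, |ζ.im| ≤ π →
      Real.cos (q * π / 2) ^ 2 * Real.exp (q * ζ.re) ≤ ‖(X:ℂ) + 2 * Complex.cosh (q * ζ)‖ := by
    intro ζ hζ
    have h := norm_exp_add_exp_ge (q * ζ) a
    have h' := norm_exp_add_exp_ge (-a - q * ζ) 0
    simp only [re_ofReal_mul, im_ofReal_mul, sub_im, neg_im, ofReal_im, neg_zero, zero_sub,
      Real.exp_zero] at h h'
    have h2 : Real.cos (q * π / 2) ≤ Real.cos (q * ζ.im / 2) := by
      rw [← Real.cos_abs (q * ζ.im / 2)]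
      apply Real.cos_le_cos_of_nonneg_of_le_pi (abs_nonneg _) (by nlinarith)
      rw [abs_div, abs_mul, abs_of_pos h0, abs_two]
      gcongr
    rw [neg_div, Real.cos_neg] at h'
    rw [hfac, norm_mul, sq, mul_assoc, mul_left_comm]
    refine mul_comm (Real.cos (q * π / 2)) _ ▸ mul_le_mul ?_ ?_ ?_ (norm_nonneg _)
    · exact le_trans (mul_le_mul h2 (by linarith [Real.exp_pos a]) (Real.exp_pos _).le
        (hc.le.trans h2)) h
    · refine le_trans ?_ h'
      nlinarith [Real.exp_pos ((-a - q * ζ : ℂ).re)]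
    · exact hc.le
  refine ⟨h0, h1, fun ζ hζ => ?_, fun ζ hζ => ?_⟩
  · refine DifferentiableAt.div (by fun_prop) (by fun_prop) ?_
    rw [← norm_pos_iff]
    exact lt_of_lt_of_le (by positivity) (hlow ζ hζ)
  · rw [norm_div, norm_one, Real.exp_neg, ← mul_inv, ← one_div]
    exact one_div_le_one_div_of_le (by positivity) (hlow ζ hζ)

lemma dcm_inv_add_cosh {X q : ℝ} (hX : 2 ≤ X) (h0 : 0 < q) (h1 : q < 1) :
    DCM (Ici 2) (fun w => 1 / (X + 2 * Real.cosh (q * pOf w))) := by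
  have hpi := Real.pi_pos
  refine ((stripFun_inv_add_cosh hX h0 h1).dcm_even (b := pOf) (fun ζ => ?_) (fun ζ => ?_)
    (fun x hx => ?_) (fun Y hY => dcm_inv_add_two_cosh_pOf hY)).congr (isUpperSet_Ici 2)
    fun w _ => ?_
  · simp [← Complex.cosh_conj, map_ofNat (starRingEnd ℂ)]
  · simp
  · simp only [one_div, Complex.inv_im, add_im, ofReal_im, zero_add]
    have h : 0 ≤ (2 * Complex.cosh (q * (x + (π : ℝ) * I))).im := by
      have e : (q * (x + (π : ℝ) * I) : ℂ) = ((q * x : ℝ) : ℂ) + ((q * π : ℝ) : ℂ) * I := by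
        push_cast; ring
      rw [e, Complex.cosh_add, Complex.cosh_mul_I, Complex.sinh_mul_I]
      have e2 : (2 * (Complex.cosh ((q * x : ℝ) : ℂ) * Complex.cos ((q * π : ℝ) : ℂ) +
          Complex.sinh ((q * x : ℝ) : ℂ) * (Complex.sin ((q * π : ℝ) : ℂ) * I))) =
          ((2 * (Real.cosh (q * x) * Real.cos (q * π)) : ℝ) : ℂ) +
          ((2 * (Real.sinh (q * x) * Real.sin (q * π)) : ℝ) : ℂ) * I := by push_cast; ring
      rw [e2]
      simp only [add_im, ofReal_im, mul_im, ofReal_re, I_im, mul_one, I_re, mul_zero, add_zero,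
        zero_add]
      have h3 := Real.sin_nonneg_of_nonneg_of_le_pi (show 0 ≤ q * π by positivity) (by nlinarith)
      have h4 := Real.sinh_nonneg_iff.2 (show 0 ≤ q * x by positivity)
      positivity
    exact div_nonpos_of_nonpos_of_nonneg (by linarith) (normSq_nonneg _)
  · have : (1 / ((X:ℂ) + 2 * Complex.cosh (q * (pOf w : ℝ)))) =
      ((1 / (X + 2 * Real.cosh (q * pOf w)) : ℝ) : ℂ) := by push_cast; ring_nf
    rw [this, ofReal_re]

lemma dcm_exp_neg_cosh {a q : ℝ} (ha : 0 ≤ a) (h0 : 0 < q) (h1 : q < 1) :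
    DCM (Ici 2) (fun w => Real.exp (-(a * (2 * Real.cosh (q * pOf w))))) :=
  DCM.exp_neg_of_inv (X₀ := 2) (isUpperSet_Ici 2)
    (fun w _ => by linarith [Real.one_le_cosh (q * pOf w)])
    (fun X hX => dcm_inv_add_cosh hX h0 h1) ha

/-! ### The entire function `Q` -/

lemma integral_exp_smul_comp_exp {E : Type*} [NormedAddCommGroup E] [NormedSpace ℝ E] (g : ℝ → E) :
    ∫ x : ℝ, Real.exp x • g (Real.exp x) = ∫ y in Ioi (0:ℝ), g y := by
  have h := integral_image_eq_integral_abs_deriv_smul (s := univ) (f := Real.exp) (f' := Real.exp)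
    MeasurableSet.univ (fun x _ => (Real.hasDerivAt_exp x).hasDerivWithinAt)
    (fun x _ y _ hxy => Real.exp_injective hxy) g
  rw [image_univ, Real.range_exp, setIntegral_univ] at h
  rw [h]
  simp only [Real.abs_exp]

lemma integrable_exp_smul_comp_exp {E : Type*} [NormedAddCommGroup E] [NormedSpace ℝ E]
    (g : ℝ → E) :
    Integrable (fun x : ℝ => Real.exp x • g (Real.exp x)) ↔ IntegrableOn g (Ioi (0:ℝ)) := by
  have h := integrableOn_image_iff_integrableOn_abs_deriv_smul (s := univ) (f := Real.exp)
    (f' := Real.exp) MeasurableSet.univ (fun x _ => (Real.hasDerivAt_exp x).hasDerivWithinAt)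
    (fun x _ y _ hxy => Real.exp_injective hxy) g
  rw [image_univ, Real.range_exp, integrableOn_univ] at h
  rw [h]
  simp only [Real.abs_exp]

lemma integrable_exp_sub_mul_exp {c : ℝ} (hc : 0 < c) :
    Integrable (fun x : ℝ => Real.exp (x - c * Real.exp x)) := by
  have h := (integrable_exp_smul_comp_exp (fun y => Real.exp (-c * y))).2
    (integrableOn_exp_mul_Ioi (neg_lt_zero.2 hc) 0)
  refine h.congr (Eventually.of_forall fun x => ?_)
  simp only [smul_eq_mul]
  rw [← Real.exp_add]
  ring_nf

lemma integral_exp_sub_mul_exp {c : ℝ} (hc : 0 < c) :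
    ∫ x : ℝ, Real.exp (x - c * Real.exp x) = 1 / c := by
  have h := integral_exp_smul_comp_exp (fun y => Real.exp (-c * y))
  rw [integral_exp_mul_Ioi (neg_lt_zero.2 hc) 0, mul_zero, Real.exp_zero, neg_div_neg_eq] at h
  rw [← h]
  refine integral_congr_ae (Eventually.of_forall fun x => ?_)
  simp only [smul_eq_mul]
  rw [← Real.exp_add]
  ring_nf

/-- The density of the logarithm of a standard exponential variable. -/
noncomputable def wt (x : ℝ) : ℝ := Real.exp (x - Real.exp x)

lemma wt_pos (x : ℝ) : 0 < wt x := Real.exp_pos _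

lemma continuous_wt : Continuous wt := by unfold wt; fun_prop

lemma integrable_wt : Integrable wt := by
  have h := integrable_exp_sub_mul_exp one_pos
  simp only [one_mul] at h
  exact h

lemma integral_wt : ∫ x, wt x = 1 := by
  simpa [wt] using integral_exp_sub_mul_exp one_pos

lemma young {α : ℝ} (h0 : 0 < α) (h1 : α < 1) {r : ℝ} (hr : 0 ≤ r) (x : ℝ) :
    r ^ (1 - α) * Real.exp (α * x) ≤ α * Real.exp x + (1 - α) * r := by
  have h := Real.geom_mean_le_arith_mean2_weighted (sub_nonneg.2 h1.le) h0.le hr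
    (Real.exp_pos x).le (by ring)
  rw [← Real.exp_mul, mul_comm x α] at h
  linarith

lemma exp_mul_wt_le {α : ℝ} (h0 : 0 < α) (h1 : α < 1) {r : ℝ} (hr : 0 ≤ r) (x : ℝ) :
    Real.exp (r ^ (1 - α) * Real.exp (α * x)) * wt x ≤
      Real.exp ((1 - α) * r) * Real.exp (x - (1 - α) * Real.exp x) := by
  rw [wt, ← Real.exp_add, ← Real.exp_add, Real.exp_le_exp]
  linarith [young h0 h1 hr x]

lemma integrable_exp_mul_wt {α : ℝ} (h0 : 0 < α) (h1 : α < 1) (B : ℝ) :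
    Integrable (fun x => Real.exp (B * Real.exp (α * x)) * wt x) := by
  have hα : 0 < 1 - α := by linarith
  set r := |B| ^ (1 - α)⁻¹ with hr
  have hB : r ^ (1 - α) = |B| := by rw [hr, Real.rpow_inv_rpow (abs_nonneg _) hα.ne']
  refine ((integrable_exp_sub_mul_exp hα).const_mul (Real.exp ((1 - α) * r))).mono'
    (by unfold wt; fun_prop) (Eventually.of_forall fun x => ?_)
  have hw := wt_pos x
  rw [Real.norm_of_nonneg (by positivity)]
  refine le_trans ?_ (exp_mul_wt_le h0 h1 (by positivity) x)
  rw [hB]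
  gcongr
  exact le_abs_self B

/-- `Q α lam = ∫ exp (-lam y^α) e^{-y} dy`, written with `y = e^x`. -/
noncomputable def Q (α : ℝ) (lam : ℂ) : ℂ :=
  ∫ x : ℝ, cexp (-(lam * Real.exp (α * x))) * (wt x : ℝ)

lemma norm_cexp_neg_mul_le (lam : ℂ) {a : ℝ} (ha : 0 ≤ a) :
    ‖cexp (-(lam * a))‖ ≤ Real.exp (‖lam‖ * a) := by
  rw [Complex.norm_exp, Real.exp_le_exp, neg_re, re_mul_ofReal]
  have := Complex.abs_re_le_norm lam
  have := neg_le_of_abs_le this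
  nlinarith

lemma norm_integrand_le (α : ℝ) {lam : ℂ} {B : ℝ} (hB : ‖lam‖ ≤ B) (x : ℝ) :
    ‖cexp (-(lam * Real.exp (α * x))) * (wt x : ℝ)‖ ≤ Real.exp (B * Real.exp (α * x)) * wt x := by
  rw [norm_mul, norm_real, Real.norm_of_nonneg (wt_pos x).le]
  refine mul_le_mul_of_nonneg_right ?_ (wt_pos x).le
  refine (norm_cexp_neg_mul_le lam (Real.exp_pos _).le).trans ?_
  gcongr

lemma integrable_Q {α : ℝ} (h0 : 0 < α) (h1 : α < 1) (lam : ℂ) :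
    Integrable (fun x : ℝ => cexp (-(lam * Real.exp (α * x))) * (wt x : ℝ)) := by
  refine (integrable_exp_mul_wt h0 h1 ‖lam‖).mono'
    (by unfold wt; fun_prop) (Eventually.of_forall fun x => norm_integrand_le α le_rfl x)

lemma norm_Q_le {α : ℝ} (h0 : 0 < α) (h1 : α < 1) {lam : ℂ} {r : ℝ} (hr : 0 ≤ r)
    (hlam : ‖lam‖ = r ^ (1 - α)) : ‖Q α lam‖ ≤ Real.exp ((1 - α) * r) / (1 - α) := by
  have hα : 0 < 1 - α := by linarith
  have h := norm_integral_le_of_norm_le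
    ((integrable_exp_sub_mul_exp hα).const_mul (Real.exp ((1 - α) * r)))
    (f := fun x : ℝ => cexp (-(lam * Real.exp (α * x))) * (wt x : ℝ))
    (Eventually.of_forall fun x => (norm_integrand_le α le_rfl x).trans
      (hlam ▸ exp_mul_wt_le h0 h1 hr x))
  rw [integral_const_mul, integral_exp_sub_mul_exp hα] at h
  rw [Q]
  refine h.trans (le_of_eq (by ring))

lemma differentiable_Q {α : ℝ} (h0 : 0 < α) (h1 : α < 1) : Differentiable ℂ (Q α) := by
  intro lam
  have h := hasDerivAt_integral_of_dominated_loc_of_deriv_le (μ := (volume : Measure ℝ))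
    (F := fun (l : ℂ) (x : ℝ) => cexp (-(l * Real.exp (α * x))) * (wt x : ℝ))
    (F' := fun (l : ℂ) (x : ℝ) => cexp (-(l * Real.exp (α * x))) * (-(Real.exp (α * x) : ℝ)) * (wt x : ℝ))
    (bound := fun x => Real.exp ((‖lam‖ + 2) * Real.exp (α * x)) * wt x)
    (x₀ := lam) (Metric.ball_mem_nhds lam one_pos)
    (Eventually.of_forall fun l => (integrable_Q h0 h1 l).aestronglyMeasurable)
    (integrable_Q h0 h1 lam) (by unfold wt; fun_prop) ?_ (integrable_exp_mul_wt h0 h1 _) ?_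
  · exact h.2.differentiableAt
  · refine Eventually.of_forall fun x l hl => ?_
    have hl' : ‖l‖ ≤ ‖lam‖ + 1 := by
      have := norm_sub_norm_le l lam
      rw [Metric.mem_ball, dist_eq_norm] at hl
      linarith
    have h2 := norm_integrand_le α hl' x
    rw [norm_mul, norm_mul, norm_neg, norm_real, Real.norm_of_nonneg (Real.exp_pos _).le]
    rw [norm_mul] at h2
    have e : Real.exp ((‖lam‖ + 2) * Real.exp (α * x)) =
        Real.exp (Real.exp (α * x)) * Real.exp ((‖lam‖ + 1) * Real.exp (α * x)) := by
      rw [← Real.exp_add]; ring_nf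
    rw [e]
    have e1 : Real.exp (α * x) ≤ Real.exp (Real.exp (α * x)) := by
      have := Real.add_one_le_exp (Real.exp (α * x)); linarith
    calc _ = Real.exp (α * x) * (‖cexp (-(l * Real.exp (α * x)))‖ * ‖((wt x : ℝ) : ℂ)‖) := by ring
      _ ≤ Real.exp (Real.exp (α * x)) *
          (Real.exp ((‖lam‖ + 1) * Real.exp (α * x)) * wt x) := by gcongr
      _ = _ := by ring
  · refine Eventually.of_forall fun x l _ => ?_
    have h1 : HasDerivAt (fun l : ℂ => -(l * Real.exp (α * x))) (-(Real.exp (α * x) : ℝ)) l := by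
      have := ((hasDerivAt_id l).mul_const ((Real.exp (α * x) : ℝ) : ℂ)).neg
      rw [one_mul] at this
      exact this
    exact h1.cexp.mul_const _

lemma Q_conj (α : ℝ) (lam : ℂ) : Q α (conj lam) = conj (Q α lam) := by
  rw [Q, Q, ← integral_conj]
  refine integral_congr_ae (Eventually.of_forall fun x => ?_)
  simp [← Complex.exp_conj]

/-- `N α t = Im Q(t e^{-iπα})`. -/
noncomputable def N (α t : ℝ) : ℝ := (Q α (t * cexp (-(π * α) * I))).im

/-- `gam α p = e^p g_α(e^p)` where `g_α` is the stable density. -/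
noncomputable def gam (α p : ℝ) : ℝ := N α (Real.exp (-(α * p))) / π

lemma continuous_N {α : ℝ} (h0 : 0 < α) (h1 : α < 1) : Continuous (N α) := by
  have := (differentiable_Q h0 h1).continuous
  unfold N
  fun_prop

lemma continuous_gam {α : ℝ} (h0 : 0 < α) (h1 : α < 1) : Continuous (gam α) := by
  have := continuous_N h0 h1
  unfold gam
  fun_prop

lemma Q_eq_integral_Ioi (α : ℝ) (lam : ℂ) :
    Q α lam = ∫ y in Ioi (0:ℝ), cexp (-(lam * (y : ℂ) ^ (α : ℂ))) * cexp (-(y:ℂ)) := by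
  rw [← integral_exp_smul_comp_exp, Q]
  refine integral_congr_ae (Eventually.of_forall fun x => ?_)
  simp only [real_smul, wt]
  rw [← ofReal_cpow (Real.exp_pos x).le, ← Real.exp_mul, Real.exp_sub, mul_comm x α]
  have : Real.exp (-Real.exp x) = (Real.exp (Real.exp x))⁻¹ := Real.exp_neg _
  rw [← ofReal_neg, ← ofReal_exp (-Real.exp x), this]
  push_cast
  ring

lemma integrableOn_Q {α : ℝ} (h0 : 0 < α) (h1 : α < 1) (lam : ℂ) :
    IntegrableOn (fun y : ℝ => cexp (-(lam * (y : ℂ) ^ (α : ℂ))) * cexp (-(y:ℂ))) (Ioi 0) := by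
  rw [← integrable_exp_smul_comp_exp]
  refine (integrable_Q h0 h1 lam).congr (Eventually.of_forall fun x => ?_)
  simp only [real_smul, wt]
  rw [← ofReal_cpow (Real.exp_pos x).le, ← Real.exp_mul, Real.exp_sub, mul_comm x α]
  have : Real.exp (-Real.exp x) = (Real.exp (Real.exp x))⁻¹ := Real.exp_neg _
  rw [← ofReal_neg, ← ofReal_exp (-Real.exp x), this]
  push_cast
  ring

lemma stableDensity_eq {α : ℝ} (h0 : 0 < α) (h1 : α < 1) {x : ℝ} (hx : 0 < x) :
    stableDensity α 1 x = gam α (Real.log x) / x := by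
  set lam : ℂ := ((x ^ (-α) : ℝ) : ℂ) * cexp (-(π * α) * I) with hlam
  have hx' : (x : ℂ) ≠ 0 := by exact_mod_cast hx.ne'
  have hc : (x : ℂ) ^ (-(α:ℂ)) = ((x ^ (-α) : ℝ) : ℂ) := by
    rw [ofReal_cpow hx.le]; simp
  have hconj : conj lam = ((x ^ (-α) : ℝ) : ℂ) * cexp ((π * α) * I) := by
    rw [hlam, map_mul, conj_ofReal, ← Complex.exp_conj]; simp
  have h : ∫ y in Ioi (0:ℝ),
      ((cexp (-(cexp (-(π * (1:ℝ) * α : ℂ) * I)) * (y:ℂ) ^ (α:ℂ) * (x:ℂ) ^ (-(α:ℂ))) -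
        cexp (-(cexp ((π * (1:ℝ) * α : ℂ) * I)) * (y:ℂ) ^ (α:ℂ) * (x:ℂ) ^ (-(α:ℂ)))) / (x:ℂ)) *
      cexp (-(y:ℂ)) = (Q α lam - Q α (conj lam)) / x := by
    rw [Q_eq_integral_Ioi, Q_eq_integral_Ioi, ← integral_sub (integrableOn_Q h0 h1 _)
      (integrableOn_Q h0 h1 _), ← integral_div]
    refine integral_congr_ae (Eventually.of_forall fun y => ?_)
    simp only
    rw [hc, hconj, hlam]
    simp only [ofReal_one, mul_one]
    rw [← sub_mul, div_mul_eq_mul_div]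
    ring_nf
  rw [stableDensity, h, Q_conj, gam, N]
  have hrp : Real.exp (-(α * Real.log x)) = x ^ (-α) := by
    rw [Real.rpow_def_of_pos hx]; ring_nf
  rw [hrp, ← hlam]
  have e : (2 * π * I)⁻¹ * ((Q α lam - conj (Q α lam)) / x) =
      (((Q α lam).im / π / x : ℝ) : ℂ) := by
    rw [Complex.sub_conj]
    have := Real.pi_ne_zero
    push_cast
    field_simp
  rw [e, ofReal_re]

/-! ### Stieltjes representation and positivity -/

lemma exp_neg_exp_le {d α k : ℝ} (hd : 0 < d) (hα : 0 < α) (hk : 0 < k) :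
    ∃ C : ℝ, 0 < C ∧ ∀ x : ℝ, Real.exp (-(d * Real.exp (α * x))) ≤ C * Real.exp (-(k * x)) := by
  refine ⟨Real.exp (-(k / α * (1 + Real.log (α * d / k)))), Real.exp_pos _, fun x => ?_⟩
  rw [← Real.exp_add, Real.exp_le_exp]
  have h := Real.add_one_le_exp (α * x + Real.log (α * d / k))
  rw [Real.exp_add, Real.exp_log (by positivity)] at h
  have h2 := mul_le_mul_of_nonneg_left h (show 0 ≤ k / α by positivity)
  have e1 : k / α * (Real.exp (α * x) * (α * d / k)) = d * Real.exp (α * x) := by field_simp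
  have e2 : k / α * (α * x + Real.log (α * d / k) + 1) =
      k * x + k / α * (1 + Real.log (α * d / k)) := by field_simp; ring
  rw [e1, e2] at h2
  linarith

/-- `hfun α t ζ = exp (-t e^{αζ})`. -/
noncomputable def hfun (α t : ℝ) (ζ : ℂ) : ℂ := cexp (-(t * cexp (α * ζ)))

/-- Minus the imaginary part of `hfun` on the upper boundary of the strip. -/
noncomputable def E (α t x : ℝ) : ℝ := -(hfun α t (x + (π : ℝ) * I)).im

lemma hfun_conj (α t : ℝ) (ζ : ℂ) : hfun α t (conj ζ) = conj (hfun α t ζ) := by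
  simp [hfun, ← Complex.exp_conj]

lemma norm_hfun (α t : ℝ) (ζ : ℂ) :
    ‖hfun α t ζ‖ = Real.exp (-(t * Real.cos (α * ζ.im) * Real.exp (α * ζ.re))) := by
  rw [hfun, Complex.norm_exp, neg_re, re_ofReal_mul, Complex.exp_re, re_ofReal_mul, im_ofReal_mul]
  ring_nf

lemma cos_pi_mul_pos {α : ℝ} (h0 : 0 < α) (h1 : α < 1 / 2) : 0 < Real.cos (α * π) := by
  have := Real.pi_pos
  exact Real.cos_pos_of_mem_Ioo ⟨by nlinarith [mul_pos h0 this], by nlinarith⟩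

lemma norm_hfun_le {α t : ℝ} (h0 : 0 < α) (h1 : α < 1 / 2) (ht : 0 < t) {ζ : ℂ} (hζ : |ζ.im| ≤ π) :
    ‖hfun α t ζ‖ ≤ Real.exp (-(t * Real.cos (α * π) * Real.exp (α * ζ.re))) := by
  have hpi := Real.pi_pos
  rw [norm_hfun, Real.exp_le_exp, neg_le_neg_iff]
  have h2 : Real.cos (α * π) ≤ Real.cos (α * ζ.im) := by
    rw [← Real.cos_abs (α * ζ.im)]
    apply Real.cos_le_cos_of_nonneg_of_le_pi (abs_nonneg _) (by nlinarith)
    rw [abs_mul, abs_of_pos h0]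
    gcongr
  gcongr

lemma stripFun_hfun {α t : ℝ} (h0 : 0 < α) (h1 : α < 1 / 2) (ht : 0 < t) :
    ∃ C, StripFun (hfun α t) C (1 / 2) := by
  have hc := cos_pi_mul_pos h0 h1
  obtain ⟨C, hC, h⟩ := exp_neg_exp_le (mul_pos ht hc) h0 (one_half_pos (α := ℝ))
  exact ⟨C, by norm_num, by norm_num, fun ζ _ => by unfold hfun; fun_prop,
    fun ζ hζ => (norm_hfun_le h0 h1 ht hζ).trans (h _)⟩

lemma hfun_eq_integral {α t : ℝ} (h0 : 0 < α) (h1 : α < 1 / 2) (ht : 0 < t) {ξ : ℂ}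
    (hξ : |ξ.im| < π) :
    Integrable (fun x : ℝ => (E α t x : ℂ) * (cexp x / (cexp x + cexp ξ))) ∧
    hfun α t ξ = (1 / π : ℝ) * ∫ x : ℝ, (E α t x : ℂ) * (cexp x / (cexp x + cexp ξ)) := by
  obtain ⟨C, hf⟩ := stripFun_hfun h0 h1 ht
  have hpi := Real.pi_pos
  have h := hf.cauchy hξ
  have e : ∀ x : ℝ, (hfun α t (x + (-π : ℝ) * I) - hfun α t (x + (π : ℝ) * I)) *
      (cexp x / (cexp x + cexp ξ)) =
      (2 * I) * ((E α t x : ℂ) * (cexp x / (cexp x + cexp ξ))) := by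
    intro x
    rw [StripFun.conj_line (hfun_conj α t), E]
    push_cast
    ring
  constructor
  · have := ((hf.integrable_line hξ (a := -π) (by simp [abs_of_pos hpi])).sub
      (hf.integrable_line hξ (a := π) (by simp [abs_of_pos hpi]))).const_mul (2 * I)⁻¹
    refine this.congr (Eventually.of_forall fun x => ?_)
    simp only [Pi.sub_apply]
    rw [← sub_mul, e, ← mul_assoc, inv_mul_cancel₀ (by simp), one_mul]
  · simp only [e] at h
    rw [integral_const_mul] at h
    have h2 : (2 * I : ℂ) * (π * hfun α t ξ) =
        2 * I * ∫ x : ℝ, (E α t x : ℂ) * (cexp x / (cexp x + cexp ξ)) := by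
      rw [← h]; ring
    rw [← mul_left_cancel₀ (by simp) h2]
    have : (π : ℂ) ≠ 0 := by exact_mod_cast hpi.ne'
    push_cast
    field_simp

lemma exp_neg_rpow_eq_integral {α t : ℝ} (h0 : 0 < α) (h1 : α < 1 / 2) (ht : 0 < t) {s : ℝ}
    (hs : 0 < s) :
    Integrable (fun x : ℝ => (E α t x * Real.exp x) * (1 / (Real.exp x + s))) ∧
    Real.exp (-(t * s ^ α)) = (1 / π) * ∫ x : ℝ, (E α t x * Real.exp x) * (1 / (Real.exp x + s)) := by
  obtain ⟨C, hf⟩ := stripFun_hfun h0 h1 ht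
  have e : (fun x : ℝ => -(hfun α t (x + (π : ℝ) * I)).im / π *
      (Real.exp x / (Real.exp x + Real.exp (Real.log s)))) =
      fun x => (1 / π) * ((E α t x * Real.exp x) * (1 / (Real.exp x + s))) := by
    ext x; rw [Real.exp_log hs, E]; ring
  have h1 := hf.integrable_im (Real.log s)
  have h2 := hf.re_formula (hfun_conj α t) (Real.log s)
  rw [e] at h1
  constructor
  · have := h1.const_mul π
    refine this.congr (Eventually.of_forall fun x => ?_)
    have := Real.pi_ne_zero
    field_simp
  · have e3 : hfun α t (Real.log s : ℝ) = ((Real.exp (-(t * s ^ α)) : ℝ) : ℂ) := by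
      rw [hfun, Real.rpow_def_of_pos hs]; push_cast; ring_nf
    rw [e3, e, integral_const_mul] at h2
    exact_mod_cast h2

lemma abs_E_le {α t : ℝ} (h0 : 0 < α) (h1 : α < 1 / 2) (ht : 0 < t) (x : ℝ) :
    |E α t x| ≤ Real.exp (-(t * Real.cos (α * π) * Real.exp (α * x))) := by
  have h := norm_hfun_le (ζ := x + (π : ℝ) * I) h0 h1 ht (by simp [abs_of_pos Real.pi_pos])
  rw [E, abs_neg]
  refine (Complex.abs_im_le_norm _).trans (h.trans (le_of_eq (by simp)))

lemma continuous_E (α t : ℝ) : Continuous (E α t) := by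
  unfold E hfun; fun_prop

lemma integrable_E_mul_exp {α t : ℝ} (h0 : 0 < α) (h1 : α < 1 / 2) (ht : 0 < t) :
    Integrable (fun x => E α t x * Real.exp x) := by
  have hd := mul_pos ht (cos_pi_mul_pos h0 h1)
  obtain ⟨C, hC, h⟩ := exp_neg_exp_le hd h0 two_pos
  refine ((integrable_exp_neg_mul_abs one_pos).const_mul (C + 1)).mono'
    ((continuous_E α t).mul Real.continuous_exp).aestronglyMeasurable
    (Eventually.of_forall fun x => ?_)
  rw [norm_mul, Real.norm_eq_abs, Real.norm_of_nonneg (Real.exp_pos x).le]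
  have hE := abs_E_le h0 h1 ht x
  rcases le_total 0 x with hx | hx
  · rw [abs_of_nonneg hx]
    calc _ ≤ (C * Real.exp (-(2 * x))) * Real.exp x := by gcongr; exact hE.trans (h x)
      _ = C * Real.exp (-(1 * x)) := by rw [mul_assoc, ← Real.exp_add]; ring_nf
      _ ≤ _ := by nlinarith [Real.exp_pos (-(1 * x))]
  · rw [abs_of_nonpos hx]
    have h3 : |E α t x| ≤ 1 := hE.trans (Real.exp_le_one_iff.2 (by
      have := Real.exp_pos (α * x); nlinarith [mul_pos hd this]))
    calc _ ≤ 1 * Real.exp x := by gcongr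
      _ = Real.exp (-(1 * -x)) := by ring_nf
      _ ≤ _ := by nlinarith [Real.exp_pos (-(1 * -x))]

lemma E_eq (α t x : ℝ) :
    (cexp (-((t * cexp (-(π * α) * I)) * Real.exp (α * x)))).im = E α t x := by
  rw [E, ← Complex.conj_im, ← hfun_conj, hfun]
  congr 3
  rw [mul_assoc, ofReal_exp, ← Complex.exp_add]
  congr 2
  simp
  ring

lemma integrable_E_mul_wt {α : ℝ} (h0 : 0 < α) (h1 : α < 1) (t : ℝ) :
    Integrable (fun x => E α t x * wt x) := by
  refine (integrable_Q h0 h1 (t * cexp (-(π * α) * I))).im.congr (Eventually.of_forall fun x => ?_)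
  change (cexp _ * ((wt x : ℝ) : ℂ)).im = _
  rw [Complex.im_mul_ofReal, E_eq]

lemma N_eq_integral {α : ℝ} (h0 : 0 < α) (h1 : α < 1) (t : ℝ) :
    N α t = ∫ x, E α t x * wt x := by
  rw [N, Q]
  have h := integral_im (𝕜 := ℂ) (integrable_Q h0 h1 (t * cexp (-(π * α) * I)))
  refine Eq.trans h.symm (integral_congr_ae (Eventually.of_forall fun x => ?_))
  change (cexp _ * ((wt x : ℝ) : ℂ)).im = _
  rw [Complex.im_mul_ofReal, E_eq]

lemma iterDiff_replicate_inv (y h : ℝ) (hh : 0 < h) (hy : 0 ≤ y) (n : ℕ) : ∀ s : ℝ, 0 < s →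
    iterDiff (List.replicate n h) (fun w => 1 / (y + w)) s =
      n.factorial * h ^ n * ∏ j ∈ Finset.range (n + 1), (y + (s + j * h))⁻¹ := by
  induction n with
  | zero => intro s _; simp [iterDiff]
  | succ n ih =>
    intro s hs
    rw [List.replicate_succ, iterDiff_cons, ih s hs, ih (s + h) (by linarith)]
    rw [Finset.prod_range_succ', Finset.prod_range_succ, Finset.prod_range_succ'
      (fun j : ℕ => (y + (s + j * h))⁻¹) (n + 1),
      Finset.prod_range_succ (fun j : ℕ => (y + (s + ((j + 1 : ℕ) : ℝ) * h))⁻¹) n]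
    have e : ∀ j : ℕ, (y + (s + h + j * h))⁻¹ = (y + (s + ((j + 1 : ℕ) : ℝ) * h))⁻¹ := by
      intro j; push_cast; ring_nf
    simp only [e]
    set P := ∏ j ∈ Finset.range n, (y + (s + ((j + 1 : ℕ) : ℝ) * h))⁻¹
    have h1 : y + (s + ((0 : ℕ) : ℝ) * h) ≠ 0 := by push_cast; nlinarith
    have h2 : y + (s + ((n + 1 : ℕ) : ℝ) * h) ≠ 0 := by positivity
    rw [Nat.factorial_succ]
    push_cast at *
    field_simp
    ring

lemma tendsto_prod_inv (y : ℝ) (hy : 0 ≤ y) :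
    Tendsto (fun n : ℕ => ∏ j ∈ Finset.range (n + 1), (1 + y / (n + j * (1 / (n + 1 : ℝ))))⁻¹)
      atTop (𝓝 (Real.exp (-y))) := by
  have hlow : Tendsto (fun n : ℕ => ((1 + y / n) ^ n)⁻¹ * (1 + y / n)⁻¹) atTop
      (𝓝 (Real.exp (-y))) := by
    have h1 := (Real.tendsto_one_add_div_pow_exp y).inv₀ (Real.exp_pos y).ne'
    have h2 : Tendsto (fun n : ℕ => (1 + y / (n:ℝ))⁻¹) atTop (𝓝 1) := by
      have := ((tendsto_const_div_atTop_nhds_zero_nat y).const_add 1).inv₀ (by norm_num)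
      simpa using this
    have := h1.mul h2
    rwa [mul_one, ← Real.exp_neg] at this
  have hup : Tendsto (fun n : ℕ => ((1 + y / ((n + 1 : ℕ) : ℝ)) ^ (n + 1))⁻¹) atTop
      (𝓝 (Real.exp (-y))) := by
    have h1 := (Real.tendsto_one_add_div_pow_exp y).inv₀ (Real.exp_pos y).ne'
    rw [← Real.exp_neg] at h1
    exact h1.comp (tendsto_add_atTop_nat 1)
  refine tendsto_of_tendsto_of_tendsto_of_le_of_le' hlow hup ?_ ?_
  · filter_upwards [eventually_gt_atTop 0] with n hn
    have hn0 : (0:ℝ) < n := by exact_mod_cast hn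
    calc ((1 + y / n) ^ n)⁻¹ * (1 + y / n)⁻¹ = ∏ _j ∈ Finset.range (n + 1), (1 + y / (n:ℝ))⁻¹ := by
          rw [Finset.prod_const, Finset.card_range, pow_succ, inv_pow]
      _ ≤ _ := by
          refine Finset.prod_le_prod (fun j _ => by positivity) fun j _ => ?_
          gcongr
          have : 0 ≤ (j:ℝ) * (1 / ((n:ℝ) + 1)) := by positivity
          linarith
  · filter_upwards [eventually_gt_atTop 0] with n hn
    have hn0 : (0:ℝ) < n := by exact_mod_cast hn
    calc _ ≤ ∏ _j ∈ Finset.range (n + 1), (1 + y / ((n + 1 : ℕ) : ℝ))⁻¹ := by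
          refine Finset.prod_le_prod (fun j _ => by positivity) fun j hj => ?_
          gcongr
          have hj' : (j:ℝ) ≤ n + 1 := by
            have := Finset.mem_range.1 hj
            exact_mod_cast this.le
          have : (j:ℝ) * (1 / ((n:ℝ) + 1)) ≤ 1 := by
            rw [mul_one_div, div_le_one (by positivity)]; exact hj'
          push_cast; linarith
      _ = _ := by rw [Finset.prod_const, Finset.card_range, inv_pow]

/-- If the Stieltjes transform of `J` is completely monotone, the Laplace transform of `J` at `1`
is nonnegative. -/
lemma integral_exp_neg_nonneg {J : ℝ → ℝ} (hJ : Integrable J) {y : ℝ → ℝ} (hy : ∀ x, 0 ≤ y x)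
    (hyc : Continuous y) (h : DCM (Ioi 0) (fun s => ∫ x, J x * (1 / (y x + s)))) :
    0 ≤ ∫ x, J x * Real.exp (-y x) := by
  have hfi : ∀ s ∈ Ioi (0:ℝ), Integrable (fun x => J x * (1 / (y x + s))) := by
    intro s hs
    have hs' : (0:ℝ) < s := hs
    refine (hJ.mul_const (1 / s)).mono (hJ.aestronglyMeasurable.mul ?_)
      (Eventually.of_forall fun x => ?_)
    · refine Continuous.aestronglyMeasurable (Continuous.div continuous_const (by fun_prop)
        fun x => ?_)
      have := hy x; positivity
    · rw [norm_mul, norm_mul]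
      have := hy x
      gcongr
      rw [Real.norm_of_nonneg (by positivity), Real.norm_of_nonneg (by positivity)]
      gcongr
      linarith
  have key : ∀ n : ℕ, 0 < n → 0 ≤ ∫ x, J x *
      ∏ j ∈ Finset.range (n + 1), (1 + y x / (n + j * (1 / (n + 1 : ℝ))))⁻¹ := by
    intro n hn
    have hn0 : (0:ℝ) < n := by exact_mod_cast hn
    set η : ℝ := 1 / (n + 1 : ℝ) with hη
    have hη0 : 0 < η := by positivity
    have hl : ∀ k ∈ List.replicate n η, 0 < k := by
      intro k hk; rw [List.eq_of_mem_replicate hk]; exact hη0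
    have h1 := h (List.replicate n η) hl n hn0
    have h2 := (iterDiff_integral (isUpperSet_Ioi (0:ℝ)) (List.replicate n η) hl
      (fun x s => J x * (1 / (y x + s))) hfi n hn0).2
    rw [h2] at h1
    simp only [iterDiff_const_mul] at h1
    simp only [iterDiff_replicate_inv _ η hη0 (hy _) n n hn0] at h1
    set c : ℝ := n.factorial * η ^ n * ∏ j ∈ Finset.range (n + 1), ((n : ℝ) + j * η)⁻¹ with hc
    have hc0 : 0 < c := by
      have : 0 < ∏ j ∈ Finset.range (n + 1), ((n : ℝ) + j * η)⁻¹ :=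
        Finset.prod_pos fun j _ => by positivity
      positivity
    have e : ∀ x, J x * (n.factorial * η ^ n * ∏ j ∈ Finset.range (n + 1), (y x + (n + j * η))⁻¹) =
        c * (J x * ∏ j ∈ Finset.range (n + 1), (1 + y x / (n + j * η))⁻¹) := by
      intro x
      have : ∏ j ∈ Finset.range (n + 1), (y x + (n + j * η))⁻¹ =
          (∏ j ∈ Finset.range (n + 1), ((n : ℝ) + j * η)⁻¹) *
          ∏ j ∈ Finset.range (n + 1), (1 + y x / (n + j * η))⁻¹ := by
        rw [← Finset.prod_mul_distrib]
        refine Finset.prod_congr rfl fun j _ => ?_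
        rw [← mul_inv]
        congr 1
        have : (n : ℝ) + j * η ≠ 0 := by positivity
        field_simp
        ring
      rw [this, hc]; ring
    simp only [e] at h1
    rw [integral_const_mul] at h1
    exact nonneg_of_mul_nonneg_right h1 hc0
  have hlim : Tendsto (fun n : ℕ => ∫ x, J x *
      ∏ j ∈ Finset.range (n + 1), (1 + y x / (n + j * (1 / (n + 1 : ℝ))))⁻¹) atTop
      (𝓝 (∫ x, J x * Real.exp (-y x))) := by
    refine tendsto_integral_of_dominated_convergence (fun x => ‖J x‖) (fun n => ?_) hJ.norm
      (fun n => Eventually.of_forall fun x => ?_)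
      (Eventually.of_forall fun x => (tendsto_prod_inv (y x) (hy x)).const_mul (J x))
    · refine hJ.aestronglyMeasurable.mul (Continuous.aestronglyMeasurable ?_)
      refine continuous_finsetProd _ fun j _ => Continuous.inv₀ (by fun_prop) fun x => ?_
      have := hy x; positivity
    · rw [norm_mul]
      refine mul_le_of_le_one_right (norm_nonneg _) ?_
      rw [Real.norm_of_nonneg (Finset.prod_nonneg fun j _ => by have := hy x; positivity)]
      refine Finset.prod_le_one (fun j _ => by have := hy x; positivity) fun j _ => ?_
      refine inv_le_one_of_one_le₀ ?_
      have : 0 ≤ y x / ((n : ℝ) + j * (1 / (n + 1))) := by have := hy x; positivity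
      linarith
  refine ge_of_tendsto hlim ?_
  filter_upwards [eventually_gt_atTop 0] with n hn using key n hn

lemma N_nonneg {α t : ℝ} (h0 : 0 < α) (h1 : α < 1 / 2) (ht : 0 < t) : 0 ≤ N α t := by
  have h := integral_exp_neg_nonneg (integrable_E_mul_exp h0 h1 ht)
    (fun x => (Real.exp_pos x).le) Real.continuous_exp
    (((dcm_exp_neg_rpow ht.le h0 (by linarith)).const_mul Real.pi_pos.le).congr (isUpperSet_Ioi 0)
      fun s hs => by
        rw [(exp_neg_rpow_eq_integral h0 h1 ht hs).2, one_div,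
          mul_inv_cancel_left₀ Real.pi_ne_zero])
  rw [N_eq_integral h0 (by linarith)]
  convert h using 2
  ext x
  rw [wt, mul_assoc, ← Real.exp_add, sub_eq_add_neg]

lemma dcm_exp_div_sub {α : ℝ} (h0 : 0 < α) (h1 : α < 1 / 2) {t₁ t₂ : ℝ} (ht : 0 < t₁)
    (h12 : t₁ ≤ t₂) :
    DCM (Ioi 0) (fun s => Real.exp (-(t₁ * s ^ α)) / t₁ - Real.exp (-(t₂ * s ^ α)) / t₂) := by
  have ht2 : 0 < t₂ := ht.trans_le h12
  set ell : ℝ → ℝ := fun w => α * w ^ (α - 1) *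
    (Real.exp (-(t₁ * w ^ α)) - Real.exp (-(t₂ * w ^ α))) with hell
  have hS : IsUpperSet (Ioi (0:ℝ)) := isUpperSet_Ioi 0
  have hell_dcm : DCM (Ioi 0) ell := by
    have hI : DCM (Ioi 0) (fun w => ∫ t in Ioc t₁ t₂, Real.exp (-(t * w ^ α))) := by
      refine DCM.integral hS ?_ fun w _ => ?_
      · refine (ae_restrict_mem measurableSet_Ioc).mono fun t ht' => ?_
        exact dcm_exp_neg_rpow (ht.trans ht'.1).le h0 (by linarith)
      · exact (Continuous.integrableOn_Icc (by fun_prop)).mono_set Ioc_subset_Icc_self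
    have hr : DCM (Ioi 0) (fun w => w ^ (-(1 - 2 * α))) :=
      dcm_rpow_neg (by linarith) (by linarith)
    refine ((hr.mul hS hI).const_mul h0.le).congr hS fun w hw => ?_
    have hw' : (0:ℝ) < w := hw
    have hv : 0 < w ^ α := Real.rpow_pos_of_pos hw' α
    have hfi : ∫ t in Ioc t₁ t₂, Real.exp (-(t * w ^ α)) =
        (Real.exp (-(t₁ * w ^ α)) - Real.exp (-(t₂ * w ^ α))) / w ^ α := by
      rw [← intervalIntegral.integral_of_le h12]
      have hd : ∀ t ∈ uIcc t₁ t₂, HasDerivAt (fun t => -(Real.exp (-(t * w ^ α)) / w ^ α))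
          (Real.exp (-(t * w ^ α))) t := by
        intro t _
        have h := ((((hasDerivAt_id t).mul_const (w ^ α)).fun_neg.exp).div_const (w ^ α)).fun_neg
        exact h.congr_deriv (by simp only [id]; field_simp)
      rw [intervalIntegral.integral_eq_sub_of_hasDerivAt hd
        ((by fun_prop : Continuous _).intervalIntegrable _ _)]
      ring
    rw [hfi, hell]
    have e : w ^ (α - 1) = w ^ (-(1 - 2 * α)) / w ^ α := by
      rw [← Real.rpow_sub hw']; ring_nf
    simp only [e]
    ring
  have hFTC : ∀ s : ℝ, 0 < s → IntegrableOn (fun u => ell (s + u)) (Ioi 0) ∧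
      ∫ u in Ioi (0:ℝ), ell (s + u) =
        Real.exp (-(t₁ * s ^ α)) / t₁ - Real.exp (-(t₂ * s ^ α)) / t₂ := by
    intro s hs
    set g : ℝ → ℝ := fun u => -(Real.exp (-(t₁ * (s + u) ^ α)) / t₁
      - Real.exp (-(t₂ * (s + u) ^ α)) / t₂) with hg
    have hder : ∀ u : ℝ, 0 ≤ u → HasDerivAt g (ell (s + u)) u := by
      intro u hu
      have hpos : s + u ≠ 0 := by positivity
      have hp : HasDerivAt (fun u => (s + u) ^ α) (1 * α * (s + u) ^ (α - 1)) u :=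
        ((hasDerivAt_id u).const_add s).rpow_const (Or.inl hpos)
      have hh := (((hp.const_mul t₁).fun_neg.exp.div_const t₁).fun_sub
        ((hp.const_mul t₂).fun_neg.exp.div_const t₂)).fun_neg
      exact hh.congr_deriv (by simp only [hell]; field_simp; ring)
    have hlim : Tendsto g atTop (𝓝 0) := by
      have h1 : Tendsto (fun u : ℝ => (s + u) ^ α) atTop atTop :=
        (tendsto_rpow_atTop h0).comp (tendsto_atTop_add_const_left _ s tendsto_id)
      have h2 : ∀ t : ℝ, 0 < t → Tendsto (fun u : ℝ => Real.exp (-(t * (s + u) ^ α)) / t) atTop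
          (𝓝 0) := by
        intro t ht
        have := (Real.tendsto_exp_neg_atTop_nhds_zero.comp (h1.const_mul_atTop ht)).div_const t
        simpa using this
      have h3 := ((h2 t₁ ht).sub (h2 t₂ ht2)).neg
      rw [sub_zero, neg_zero] at h3
      exact h3
    have hnn : ∀ u ∈ Ioi (0:ℝ), 0 ≤ ell (s + u) := fun u hu =>
      hell_dcm.nonneg (add_pos hs hu)
    refine ⟨integrableOn_Ioi_deriv_of_nonneg (hder 0 le_rfl).continuousAt.continuousWithinAt
      (fun u hu => hder u (le_of_lt hu)) hnn hlim, ?_⟩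
    rw [integral_Ioi_of_hasDerivAt_of_nonneg (hder 0 le_rfl).continuousAt.continuousWithinAt
      (fun u hu => hder u (le_of_lt hu)) hnn hlim]
    simp [hg]
  have h := DCM.integral (μ := volume.restrict (Ioi (0:ℝ))) (S := Ioi 0) hS
    (F := fun u s => ell (s + u)) ((ae_restrict_mem measurableSet_Ioi).mono fun u hu =>
      hell_dcm.comp_add hS (le_of_lt hu)) (fun s hs => (hFTC s hs).1)
  exact h.congr hS fun s hs => (hFTC s hs).2.symm

lemma N_div_anti {α : ℝ} (h0 : 0 < α) (h1 : α < 1 / 2) {t₁ t₂ : ℝ} (ht : 0 < t₁)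
    (h12 : t₁ ≤ t₂) : N α t₂ / t₂ ≤ N α t₁ / t₁ := by
  have ht2 : 0 < t₂ := ht.trans_le h12
  have i1 := integrable_E_mul_exp h0 h1 ht
  have i2 := integrable_E_mul_exp h0 h1 ht2
  have h := integral_exp_neg_nonneg
    (J := fun x => (E α t₁ x * Real.exp x) / t₁ - (E α t₂ x * Real.exp x) / t₂)
    ((i1.div_const t₁).sub (i2.div_const t₂))
    (fun x => (Real.exp_pos x).le) Real.continuous_exp
    (((dcm_exp_div_sub h0 h1 ht h12).const_mul Real.pi_pos.le).congr (isUpperSet_Ioi 0)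
      fun s hs => by
        have a1 := exp_neg_rpow_eq_integral h0 h1 ht hs
        have a2 := exp_neg_rpow_eq_integral h0 h1 ht2 hs
        have e : ∀ x, ((E α t₁ x * Real.exp x) / t₁ - (E α t₂ x * Real.exp x) / t₂) *
            (1 / (Real.exp x + s)) = (E α t₁ x * Real.exp x) * (1 / (Real.exp x + s)) / t₁ -
            (E α t₂ x * Real.exp x) * (1 / (Real.exp x + s)) / t₂ := fun x => by ring
        simp only [e]
        rw [integral_sub (a1.1.div_const _) (a2.1.div_const _), integral_div, integral_div,
          a1.2, a2.2]
        have := Real.pi_ne_zero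
        field_simp)
  have w1 := integrable_E_mul_wt h0 (by linarith) t₁
  have w2 := integrable_E_mul_wt h0 (by linarith) t₂
  have e : ∀ x, ((E α t₁ x * Real.exp x) / t₁ - (E α t₂ x * Real.exp x) / t₂) *
      Real.exp (-Real.exp x) = (E α t₁ x * wt x) / t₁ - (E α t₂ x * wt x) / t₂ := by
    intro x
    rw [wt, sub_eq_add_neg x, Real.exp_add]; ring
  simp only [e] at h
  rw [integral_sub (w1.div_const _) (w2.div_const _), integral_div, integral_div,
    ← N_eq_integral h0 (by linarith), ← N_eq_integral h0 (by linarith)] at h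
  linarith

/-! ### Monotonicity on the cut -/

lemma E_add (α t x z : ℝ) : E α t (x + z) = E α (t * Real.exp (α * z)) x := by
  rw [E, E, hfun, hfun]
  congr 3
  push_cast
  rw [mul_assoc, ← Complex.exp_add]
  ring_nf

/-- The Poisson-type kernel `-Im (e^z / (e^z + e^{iθ}))`. -/
noncomputable def ker (θ z : ℝ) : ℝ := -(cexp z / (cexp z + cexp (θ * I))).im

lemma ker_nonneg {θ : ℝ} (h0 : 0 < θ) (h1 : θ < π) (z : ℝ) : 0 ≤ ker θ z := by
  have hs := Real.sin_pos_of_pos_of_lt_pi h0 h1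
  rw [ker, ← ofReal_exp, div_eq_mul_inv, im_ofReal_mul, Complex.inv_im]
  have e : ((Real.exp z : ℂ) + cexp (θ * I)).im = Real.sin θ := by
    rw [add_im, ofReal_im, Complex.exp_im]; simp
  rw [e, neg_div, mul_neg, neg_neg]
  have := Complex.normSq_nonneg ((Real.exp z : ℂ) + cexp (θ * I))
  positivity

lemma ne_zero_ker {θ : ℝ} (h0 : 0 < θ) (h1 : θ < π) (z : ℝ) : cexp z + cexp (θ * I) ≠ 0 :=
  exp_add_exp_ne_zero (by simpa [abs_of_pos h0] using h1) z

lemma continuous_ker {θ : ℝ} (h0 : 0 < θ) (h1 : θ < π) : Continuous (ker θ) := by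
  unfold ker
  refine (Complex.continuous_im.comp (Continuous.div (by fun_prop) (by fun_prop)
    fun z => ne_zero_ker h0 h1 z)).neg

lemma integrable_ker {θ : ℝ} (h0 : 0 < θ) (h1 : θ < π) : Integrable (ker θ) := by
  have hθ : |((θ : ℂ) * I).im| < π := by simpa [abs_of_pos h0] using h1
  set c := Real.cos (((θ : ℂ) * I).im / 2) with hc
  have hc0 : 0 < c := cos_half_pos hθ
  refine ((integrable_exp_neg_mul_abs one_pos).const_mul (1 / c ^ 2)).mono'
    (continuous_ker h0 h1).aestronglyMeasurable (Eventually.of_forall fun z => ?_)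
  rw [Real.norm_of_nonneg (ker_nonneg h0 h1 z), ker, ← ofReal_exp, div_eq_mul_inv, im_ofReal_mul,
    Complex.inv_im]
  have e : ((Real.exp z : ℂ) + cexp (θ * I)).im = Real.sin θ := by
    rw [add_im, ofReal_im, Complex.exp_im]; simp
  rw [e, neg_div, mul_neg, neg_neg, ← Complex.sq_norm]
  have hz := Real.exp_pos z
  have hn := norm_exp_add_exp_ge ((θ : ℂ) * I) z
  simp only [← hc] at hn
  have hre : ((θ : ℂ) * I).re = 0 := by simp
  rw [hre, Real.exp_zero] at hn
  rw [← ofReal_exp] at hn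
  have hpos : 0 < c * (Real.exp z + 1) := by positivity
  have hsin : Real.sin θ ≤ 1 := Real.sin_le_one θ
  calc Real.exp z * (Real.sin θ / ‖(Real.exp z : ℂ) + cexp (θ * I)‖ ^ 2)
      ≤ Real.exp z * (1 / (c * (Real.exp z + 1)) ^ 2) := by
        gcongr
    _ = 1 / c ^ 2 * (Real.exp z / (Real.exp z + 1) ^ 2) := by
        rw [mul_pow]; field_simp
    _ ≤ 1 / c ^ 2 * Real.exp (-(1 * |z|)) := by
        gcongr
        rw [div_le_iff₀ (by positivity)]
        rcases le_total 0 z with h | h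
        · rw [abs_of_nonneg h, one_mul, Real.exp_neg]
          field_simp
          nlinarith
        · rw [abs_of_nonpos h, one_mul, neg_neg]
          nlinarith [mul_pos hz hz, mul_pos (mul_pos hz hz) hz]

lemma abs_E_le_one {α t : ℝ} (h0 : 0 < α) (h1 : α < 1 / 2) (ht : 0 < t) (x : ℝ) :
    |E α t x| ≤ 1 := by
  refine (abs_E_le h0 h1 ht x).trans (Real.exp_le_one_iff.2 ?_)
  have := mul_pos (mul_pos ht (cos_pi_mul_pos h0 h1)) (Real.exp_pos (α * x))
  linarith

lemma hfun_im_eq {α t : ℝ} (h0 : 0 < α) (h1 : α < 1 / 2) (ht : 0 < t) {θ : ℝ} (hθ0 : 0 < θ)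
    (hθ1 : θ < π) (x : ℝ) :
    -(hfun α t (x + θ * I)).im = (1 / π) * ∫ z, E α (t * Real.exp (α * z)) x * ker θ z := by
  have hξ : |((x : ℂ) + θ * I).im| < π := by simpa [abs_of_pos hθ0] using hθ1
  obtain ⟨hi, h⟩ := hfun_eq_integral h0 h1 ht hξ
  rw [h, im_ofReal_mul, ← mul_neg]
  congr 1
  have h2 := integral_im (𝕜 := ℂ) hi
  refine Eq.trans (congrArg _ h2.symm) ?_
  rw [← integral_neg, ← integral_add_left_eq_self (μ := volume) _ x]
  refine integral_congr_ae (Eventually.of_forall fun z => ?_)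
  change -((E α t (x + z) : ℂ) * _).im = E α (t * Real.exp (α * z)) x * ker θ z
  rw [im_ofReal_mul, ← mul_neg, E_add, ker]
  congr 3
  push_cast
  rw [Complex.exp_add, Complex.exp_add, ← mul_add, mul_div_mul_left _ _ (Complex.exp_ne_zero _)]

/-- `-Im Q(t e^{iαθ})`. -/
noncomputable def Ng (α θ t : ℝ) : ℝ := -(Q α (t * cexp (α * θ * I))).im

lemma Q_eq_integral_hfun (α θ t : ℝ) :
    Q α (t * cexp (α * θ * I)) = ∫ x : ℝ, hfun α t (x + θ * I) * (wt x : ℝ) := by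
  rw [Q]
  refine integral_congr_ae (Eventually.of_forall fun x => ?_)
  simp only [hfun]
  congr 3
  push_cast
  rw [mul_assoc, ← Complex.exp_add]
  ring_nf

lemma Ng_eq {α t : ℝ} (h0 : 0 < α) (h1 : α < 1 / 2) (ht : 0 < t) {θ : ℝ} (hθ0 : 0 < θ)
    (hθ1 : θ < π) :
    Integrable (fun z => ker θ z * N α (t * Real.exp (α * z))) ∧
    Ng α θ t = (1 / π) * ∫ z, ker θ z * N α (t * Real.exp (α * z)) := by
  have hfi : Integrable (fun p : ℝ × ℝ =>
      E α (t * Real.exp (α * p.2)) p.1 * ker θ p.2 * wt p.1) (volume.prod volume) := by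
    refine (integrable_wt.mul_prod (integrable_ker hθ0 hθ1)).mono'
      (Continuous.aestronglyMeasurable ?_) (Eventually.of_forall fun p => ?_)
    · have := continuous_ker hθ0 hθ1
      have := continuous_wt
      unfold E hfun
      fun_prop
    · rw [norm_mul, norm_mul, Real.norm_of_nonneg (wt_pos _).le,
        Real.norm_of_nonneg (ker_nonneg hθ0 hθ1 _)]
      have h2 := abs_E_le_one h0 h1 (mul_pos ht (Real.exp_pos (α * p.2))) p.1
      have h3 := ker_nonneg hθ0 hθ1 p.2
      have h4 := wt_pos p.1
      rw [← Real.norm_eq_abs] at h2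
      calc _ ≤ 1 * ker θ p.2 * wt p.1 := by gcongr
        _ = _ := by ring
  have e : ∀ z, ∫ x, E α (t * Real.exp (α * z)) x * ker θ z * wt x =
      ker θ z * N α (t * Real.exp (α * z)) := by
    intro z
    rw [N_eq_integral h0 (by linarith), ← integral_const_mul]
    congr 1; ext x; ring
  constructor
  · have := hfi.integral_prod_right
    simpa only [e] using this
  · rw [Ng, Q_eq_integral_hfun]
    have hi : Integrable (fun x : ℝ => hfun α t (x + θ * I) * (wt x : ℝ)) := by
      refine (integrable_Q h0 (by linarith) (t * cexp (α * θ * I))).congr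
        (Eventually.of_forall fun x => ?_)
      simp only [hfun]
      congr 3
      push_cast
      rw [mul_assoc, ← Complex.exp_add]
      ring_nf
    have h2 := integral_im (𝕜 := ℂ) hi
    refine Eq.trans (congrArg _ h2.symm) ?_
    rw [← integral_neg]
    have e2 : ∀ x : ℝ, -RCLike.im (hfun α t (x + θ * I) * ((wt x : ℝ) : ℂ)) =
        (1 / π) * ∫ z, E α (t * Real.exp (α * z)) x * ker θ z * wt x := by
      intro x
      change -(hfun α t (x + θ * I) * ((wt x : ℝ) : ℂ)).im = _
      rw [im_mul_ofReal, ← neg_mul, hfun_im_eq h0 h1 ht hθ0 hθ1, integral_mul_const, mul_assoc]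
    simp only [e2]
    rw [integral_const_mul, integral_integral_swap hfi]
    simp only [e]

lemma Ng_nonneg {α t : ℝ} (h0 : 0 < α) (h1 : α < 1 / 2) (ht : 0 < t) {θ : ℝ} (hθ0 : 0 < θ)
    (hθ1 : θ < π) : 0 ≤ Ng α θ t := by
  rw [(Ng_eq h0 h1 ht hθ0 hθ1).2]
  have := Real.pi_pos
  refine mul_nonneg (by positivity) (integral_nonneg fun z => ?_)
  exact mul_nonneg (ker_nonneg hθ0 hθ1 z) (N_nonneg h0 h1 (by positivity))

lemma Ng_div_anti {α : ℝ} (h0 : 0 < α) (h1 : α < 1 / 2) {θ : ℝ} (hθ0 : 0 < θ)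
    (hθ1 : θ < π) {t₁ t₂ : ℝ} (ht : 0 < t₁) (h12 : t₁ ≤ t₂) :
    Ng α θ t₂ / t₂ ≤ Ng α θ t₁ / t₁ := by
  have ht2 : 0 < t₂ := ht.trans_le h12
  obtain ⟨i1, e1⟩ := Ng_eq h0 h1 ht hθ0 hθ1
  obtain ⟨i2, e2⟩ := Ng_eq h0 h1 ht2 hθ0 hθ1
  have := Real.pi_pos
  rw [e1, e2, mul_div_assoc, mul_div_assoc, ← integral_div, ← integral_div]
  refine mul_le_mul_of_nonneg_left (integral_mono (i2.div_const _) (i1.div_const _) fun z => ?_)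
    (by positivity)
  have hz := Real.exp_pos (α * z)
  have h := N_div_anti h0 h1 (mul_pos ht hz) (mul_le_mul_of_nonneg_right h12 hz.le)
  have hk := ker_nonneg hθ0 hθ1 z
  have h3 := mul_le_mul_of_nonneg_left h (mul_nonneg hk hz.le)
  calc ker θ z * N α (t₂ * Real.exp (α * z)) / t₂
      = ker θ z * Real.exp (α * z) * (N α (t₂ * Real.exp (α * z)) / (t₂ * Real.exp (α * z))) := by
        field_simp
    _ ≤ _ := h3
    _ = _ := by field_simp

lemma exp_sub_re_mono {w : ℂ} (hw : ‖w‖ = 1) {s t : ℝ} (hs : 0 ≤ s) (hst : s ≤ t) :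
    t * (Real.exp s - (cexp (w * s)).re) ≤ s * (Real.exp t - (cexp (w * t)).re) := by
  have key : ∀ u : ℝ, HasSum (fun n : ℕ => u ^ n * (1 - (w ^ n).re) / n.factorial)
      (Real.exp u - (cexp (w * u)).re) := by
    intro u
    have h1 : HasSum (fun n : ℕ => u ^ n / n.factorial) (Real.exp u) := by
      rw [Real.exp_eq_exp_ℝ]; exact NormedSpace.expSeries_div_hasSum_exp u
    have h2 : HasSum (fun n : ℕ => ((w * u) ^ n / n.factorial : ℂ)) (cexp (w * u)) := by
      rw [Complex.exp_eq_exp_ℂ]; exact NormedSpace.expSeries_div_hasSum_exp _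
    have h3 := Complex.hasSum_re h2
    refine (h1.sub h3).congr_fun ?_
    intro n
    have : ((w * u) ^ n / n.factorial : ℂ) = ((u ^ n / n.factorial : ℝ) : ℂ) * w ^ n := by
      push_cast; rw [mul_pow]; ring
    rw [this, re_ofReal_mul]; ring
  refine hasSum_le (fun n => ?_) ((key s).mul_left t) ((key t).mul_left s)
  have hw1 : (w ^ n).re ≤ 1 := (Complex.re_le_norm _).trans (by rw [norm_pow, hw, one_pow])
  rcases n with _ | n
  · simp
  · have : s ^ n ≤ t ^ n := pow_le_pow_left₀ hs hst n
    have h5 : 0 ≤ 1 - (w ^ (n + 1)).re := by linarith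
    have ht := hs.trans hst
    calc t * (s ^ (n + 1) * (1 - (w ^ (n + 1)).re) / (n + 1).factorial)
        = s * t * s ^ n * ((1 - (w ^ (n + 1)).re) / (n + 1).factorial) := by ring
      _ ≤ s * t * t ^ n * ((1 - (w ^ (n + 1)).re) / (n + 1).factorial) := by gcongr
      _ = _ := by ring

/-- `Q(-t) - Re Q(t e^{iαθ})`. -/
noncomputable def Dg (α θ t : ℝ) : ℝ := (Q α (-t)).re - (Q α (t * cexp (α * θ * I))).re

lemma Dg_eq {α : ℝ} (h0 : 0 < α) (h1 : α < 1) (θ t : ℝ) :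
    Integrable (fun x => (Real.exp (t * Real.exp (α * x)) -
      (cexp (-cexp (α * θ * I) * (t * Real.exp (α * x) : ℝ))).re) * wt x) ∧
    Dg α θ t = ∫ x, (Real.exp (t * Real.exp (α * x)) -
      (cexp (-cexp (α * θ * I) * (t * Real.exp (α * x) : ℝ))).re) * wt x := by
  have i1 := (integrable_Q h0 h1 (-t)).re
  have i2 := (integrable_Q h0 h1 (t * cexp (α * θ * I))).re
  have e : ∀ x, (Real.exp (t * Real.exp (α * x)) -
      (cexp (-cexp (α * θ * I) * (t * Real.exp (α * x) : ℝ))).re) * wt x =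
      RCLike.re (cexp (-(-(t:ℂ) * Real.exp (α * x))) * (wt x : ℝ)) -
      RCLike.re (cexp (-(t * cexp (α * θ * I) * Real.exp (α * x))) * (wt x : ℝ)) := by
    intro x
    change _ = (cexp (-(-(t:ℂ) * Real.exp (α * x))) * (wt x : ℝ)).re -
      (cexp (-(t * cexp (α * θ * I) * Real.exp (α * x))) * (wt x : ℝ)).re
    rw [re_mul_ofReal, re_mul_ofReal, ← sub_mul]
    congr 2
    · have : (-(-(t:ℂ) * Real.exp (α * x))) = ((t * Real.exp (α * x) : ℝ) : ℂ) := by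
        push_cast; ring
      rw [this, ← ofReal_exp, ofReal_re]
    · congr 2; push_cast; ring
  simp only [e]
  refine ⟨i1.sub i2, ?_⟩
  rw [integral_sub i1 i2, Dg]
  congr 1
  · exact (integral_re (𝕜 := ℂ) (integrable_Q h0 h1 (-t))).symm
  · exact (integral_re (𝕜 := ℂ) (integrable_Q h0 h1 (t * cexp (α * θ * I)))).symm

lemma norm_neg_exp_mul_I (α θ : ℝ) : ‖-cexp (α * θ * I)‖ = 1 := by
  rw [norm_neg, ← ofReal_mul, Complex.norm_exp_ofReal_mul_I]

lemma Dg_nonneg {α : ℝ} (h0 : 0 < α) (h1 : α < 1) (θ : ℝ) {t : ℝ} (ht : 0 ≤ t) :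
    0 ≤ Dg α θ t := by
  rw [(Dg_eq h0 h1 θ t).2]
  refine integral_nonneg fun x => mul_nonneg ?_ (wt_pos x).le
  have h : (cexp (-cexp (α * θ * I) * (t * Real.exp (α * x) : ℝ))).re ≤ _ := Complex.re_le_norm _
  rw [Complex.norm_exp] at h
  refine sub_nonneg.2 (h.trans (Real.exp_le_exp.2 ((Complex.re_le_norm _).trans ?_)))
  rw [norm_mul, norm_neg_exp_mul_I, one_mul, norm_real, Real.norm_of_nonneg (by positivity)]

lemma Dg_div_mono {α : ℝ} (h0 : 0 < α) (h1 : α < 1) (θ : ℝ) {t₁ t₂ : ℝ} (ht : 0 < t₁)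
    (h12 : t₁ ≤ t₂) : t₂ * Dg α θ t₁ ≤ t₁ * Dg α θ t₂ := by
  obtain ⟨i1, e1⟩ := Dg_eq h0 h1 θ t₁
  obtain ⟨i2, e2⟩ := Dg_eq h0 h1 θ t₂
  rw [e1, e2, ← integral_const_mul, ← integral_const_mul]
  refine integral_mono (i1.const_mul _) (i2.const_mul _) fun x => ?_
  have hx := Real.exp_pos (α * x)
  have h := exp_sub_re_mono (norm_neg_exp_mul_I α θ) (mul_pos ht hx).le
    (mul_le_mul_of_nonneg_right h12 hx.le)
  have h2 : t₂ * (Real.exp (t₁ * Real.exp (α * x)) -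
      (cexp (-cexp (α * θ * I) * (t₁ * Real.exp (α * x) : ℝ))).re) ≤
      t₁ * (Real.exp (t₂ * Real.exp (α * x)) -
      (cexp (-cexp (α * θ * I) * (t₂ * Real.exp (α * x) : ℝ))).re) := by
    refine le_of_mul_le_mul_left ?_ hx
    linarith
  have := mul_le_mul_of_nonneg_right h2 (wt_pos x).le
  simpa only [mul_assoc] using this

lemma Ng_mul_Dg_le {α : ℝ} (h0 : 0 < α) (h1 : α < 1 / 2) {θ : ℝ} (hθ0 : 0 < θ)
    (hθ1 : θ < π) {t₁ t₂ : ℝ} (ht : 0 < t₁) (h12 : t₁ ≤ t₂) :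
    Ng α θ t₂ * Dg α θ t₁ ≤ Ng α θ t₁ * Dg α θ t₂ := by
  have ht2 : 0 < t₂ := ht.trans_le h12
  have hN := Ng_div_anti h0 h1 hθ0 hθ1 ht h12
  rw [div_le_div_iff₀ ht2 ht] at hN
  have hD := Dg_div_mono h0 (by linarith) θ ht h12
  have n1 := Ng_nonneg h0 h1 ht hθ0 hθ1
  have d1 := Dg_nonneg h0 (by linarith) θ ht.le
  have a := mul_le_mul_of_nonneg_right hN d1
  have b := mul_le_mul_of_nonneg_left hD n1
  refine le_of_mul_le_mul_left (a := t₁) ?_ ht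
  linarith

/-! ### Bounds for `Q` -/

lemma integral_shift {F : ℂ → ℂ} {C γ : ℝ} (hγ : 0 ≤ γ)
    (hd : ∀ ζ : ℂ, 0 ≤ ζ.im → ζ.im ≤ γ → DifferentiableAt ℂ F ζ)
    (hb : ∀ ζ : ℂ, 0 ≤ ζ.im → ζ.im ≤ γ → ‖F ζ‖ ≤ C * Real.exp (-(1 * |ζ.re|))) :
    ∫ x : ℝ, F x = ∫ x : ℝ, F (x + γ * I) := by
  have hcont : ∀ a : ℝ, 0 ≤ a → a ≤ γ → Continuous (fun x : ℝ => F (x + a * I)) := by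
    intro a ha ha'
    rw [continuous_iff_continuousAt]
    intro x
    have h : ContinuousAt F ((x : ℂ) + a * I) :=
      (hd _ (by simpa using ha) (by simpa using ha')).continuousAt
    exact ContinuousAt.comp (f := fun x : ℝ => (x : ℂ) + a * I) h (by fun_prop)
  have hfi : ∀ a : ℝ, 0 ≤ a → a ≤ γ → Integrable (fun x : ℝ => F (x + a * I)) := by
    intro a ha ha'
    refine ((integrable_exp_neg_mul_abs one_pos).const_mul C).mono'
      (hcont a ha ha').aestronglyMeasurable (Eventually.of_forall fun x => ?_)
    simpa using hb (x + a * I) (by simpa using ha) (by simpa using ha')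
  have hrect : ∀ R : ℝ, (∫ x in -R..R, (F (x + (0 : ℝ) * I) - F (x + γ * I)))
      + I * (∫ y in (0:ℝ)..γ, F (R + y * I)) - I * (∫ y in (0:ℝ)..γ, F ((-R : ℝ) + y * I)) = 0 := by
    intro R
    have h := Complex.integral_boundary_rect_eq_zero_of_differentiableOn F (-R : ℝ) (R + γ * I) ?_
    · rw [intervalIntegral.integral_sub ((hcont _ le_rfl hγ).intervalIntegrable _ _)
        ((hcont _ hγ le_rfl).intervalIntegrable _ _)]
      simpa using h
    · intro ζ hζ
      have := hζ.2
      simp only [ofReal_im, mul_im, ofReal_re, I_im, mul_one, I_re, mul_zero,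
        add_im, zero_add, add_zero, mem_preimage] at this
      rw [uIcc_of_le hγ] at this
      exact (hd ζ this.1 this.2).differentiableWithinAt
  have hside : ∀ s : ℝ, |s| = 1 → Tendsto (fun R : ℝ => ∫ y in (0:ℝ)..γ, F ((s * R : ℝ) + y * I))
      atTop (𝓝 0) := by
    intro s hs
    have hlim : Tendsto (fun R : ℝ => C * Real.exp (-R) * |γ - 0|) atTop (𝓝 0) := by
      have := (Real.tendsto_exp_neg_atTop_nhds_zero.const_mul C).mul_const |γ - 0|
      simpa using this
    refine squeeze_zero_norm' ?_ hlim
    filter_upwards [eventually_ge_atTop 0] with R hR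
    refine intervalIntegral.norm_integral_le_of_norm_le_const fun y hy => ?_
    rw [uIoc_of_le hγ] at hy
    have := hb ((s * R : ℝ) + y * I) (by simpa using hy.1.le) (by simpa using hy.2)
    simpa [abs_mul, hs, abs_of_nonneg hR] using this
  have hmain : Tendsto (fun R : ℝ => ∫ x in -R..R, (F (x + (0 : ℝ) * I) - F (x + γ * I))) atTop
      (𝓝 (∫ x : ℝ, (F (x + (0 : ℝ) * I) - F (x + γ * I)))) :=
    intervalIntegral_tendsto_integral ((hfi 0 le_rfl hγ).sub (hfi γ hγ le_rfl))
      tendsto_neg_atTop_atBot tendsto_id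
  have h1 := hside 1 (by simp)
  have h2 := hside (-1) (by simp)
  have h3 := (hmain.add (h1.const_mul I)).sub (h2.const_mul I)
  have h4 : ∀ R : ℝ, (∫ x in -R..R, (F (x + (0 : ℝ) * I) - F (x + γ * I)))
      + I * (∫ y in (0:ℝ)..γ, F ((1 * R : ℝ) + y * I))
      - I * (∫ y in (0:ℝ)..γ, F ((-1 * R : ℝ) + y * I)) = 0 := by
    intro R
    rw [one_mul, neg_one_mul]; exact hrect R
  simp only [h4] at h3
  have h5 := tendsto_nhds_unique h3 tendsto_const_nhds
  rw [integral_sub (hfi 0 le_rfl hγ) (hfi γ hγ le_rfl)] at h5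
  simp only [ofReal_zero, zero_mul, add_zero, mul_zero, sub_zero] at h5
  exact sub_eq_zero.1 h5

lemma exp_sub_add_le {α d t : ℝ} (h0 : 0 < α) (h1 : α < 1) (hd : 0 < d) (ht : 0 ≤ t) :
    ∃ C : ℝ, ∀ x : ℝ, Real.exp (x - d * Real.exp x + t * Real.exp (α * x)) ≤
      C * Real.exp (-(1 * |x|)) := by
  -- absorb the lower power
  obtain ⟨C₁, hC₁, h⟩ := exp_neg_exp_le (d := d / 2) (α := 1) (k := 2) (by positivity) one_pos two_pos
  set r : ℝ := (2 * t / d) ^ (1 - α)⁻¹ with hr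
  have hα : 0 < 1 - α := by linarith
  have hr0 : 0 ≤ r := by positivity
  have hrt : r ^ (1 - α) = 2 * t / d := by
    rw [hr, Real.rpow_inv_rpow (by positivity) hα.ne']
  have habs : ∀ x, t * Real.exp (α * x) ≤ d / 2 * Real.exp x + d / 2 * r := by
    intro x
    have := young h0 h1 hr0 x
    rw [hrt] at this
    have h2 := mul_le_mul_of_nonneg_left this (show 0 ≤ d / 2 by positivity)
    have e : d / 2 * (2 * t / d * Real.exp (α * x)) = t * Real.exp (α * x) := by field_simp
    rw [e] at h2
    have := Real.exp_pos x
    nlinarith [mul_pos hd this, mul_nonneg hd.le hr0]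
  refine ⟨Real.exp (d / 2 * r) * (C₁ + 1), fun x => ?_⟩
  have hle : Real.exp (x - d * Real.exp x + t * Real.exp (α * x)) ≤
      Real.exp (d / 2 * r) * (Real.exp x * Real.exp (-(d / 2 * Real.exp (1 * x)))) := by
    rw [← Real.exp_add, ← Real.exp_add, Real.exp_le_exp, one_mul]
    linarith [habs x]
  refine hle.trans ?_
  rw [mul_assoc]
  refine mul_le_mul_of_nonneg_left ?_ (Real.exp_pos _).le
  rcases le_total 0 x with hx | hx
  · rw [abs_of_nonneg hx]
    calc _ ≤ Real.exp x * (C₁ * Real.exp (-(2 * x))) := by gcongr; exact h x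
      _ = C₁ * Real.exp (-(1 * x)) := by rw [mul_left_comm, ← Real.exp_add]; ring_nf
      _ ≤ _ := by gcongr; linarith
  · rw [abs_of_nonpos hx]
    have : Real.exp (-(d / 2 * Real.exp (1 * x))) ≤ 1 := Real.exp_le_one_iff.2 (by
      have := Real.exp_pos (1 * x); nlinarith)
    calc _ ≤ Real.exp x * 1 := by gcongr
      _ = 1 * Real.exp (-(1 * -x)) := by ring_nf
      _ ≤ _ := by gcongr; linarith

lemma norm_Q_le_one {α : ℝ} {lam : ℂ} (h : 0 ≤ lam.re) : ‖Q α lam‖ ≤ 1 := by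
  have := norm_integral_le_of_norm_le integrable_wt
    (f := fun x : ℝ => cexp (-(lam * Real.exp (α * x))) * (wt x : ℝ))
    (Eventually.of_forall fun x => ?_)
  · rwa [integral_wt] at this
  · rw [norm_mul, norm_real, Real.norm_of_nonneg (wt_pos x).le]
    refine mul_le_of_le_one_left (wt_pos x).le ?_
    rw [Complex.norm_exp, neg_re, re_mul_ofReal]
    exact Real.exp_le_one_iff.2 (by have := mul_nonneg h (Real.exp_pos (α * x)).le; linarith)

lemma norm_Q_middle {α : ℝ} (h0 : 0 < α) (h1 : α < 1 / 2) :
    ∃ C : ℝ, ∀ X : ℝ, 1 ≤ X →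
      ‖Q α ((X ^ (1 - α) : ℝ) * cexp (-((π / 2 + π * α / 2 : ℝ) * I)))‖ ≤ C * X := by
  have hpi := Real.pi_pos
  have hpi4 := Real.pi_le_four
  have hk : 0 < 2 / π - α * α := by
    have : 1 / 2 ≤ 2 / π := by rw [div_le_div_iff₀ two_pos hpi]; linarith
    nlinarith
  refine ⟨Real.exp (α * (1 - α)) / (2 / π - α * α), fun X hX => ?_⟩
  have hX0 : 0 < X := by linarith
  set ε : ℝ := 1 / X with hε
  have hε0 : 0 < ε := by positivity
  have hε1 : ε ≤ 1 := by rw [hε, div_le_one hX0]; exact hX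
  set t : ℝ := X ^ (1 - α) with ht
  have ht0 : 0 < t := Real.rpow_pos_of_pos hX0 _
  have hp3 := Real.pi_gt_three
  set γ : ℝ := π / 2 - ε with hγ
  have hγ0 : 0 ≤ γ := by linarith
  have hsin : 0 < Real.sin ε := Real.sin_pos_of_pos_of_lt_pi hε0 (by linarith)
  set lam : ℂ := (t : ℂ) * cexp (-((π / 2 + π * α / 2 : ℝ) * I)) with hlam
  set F : ℂ → ℂ := fun ζ => cexp (-(lam * cexp (α * ζ))) * cexp (ζ - cexp ζ) with hF
  have hnlam : ‖lam‖ = t := by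
    rw [hlam, norm_mul, norm_real, Real.norm_of_nonneg ht0.le, ← neg_mul, ← ofReal_neg,
      Complex.norm_exp_ofReal_mul_I, mul_one]
  have hQ : Q α lam = ∫ x : ℝ, F x := by
    rw [Q]
    congr 1; ext x
    simp only [hF, wt]; push_cast; rfl
  have hFn : ∀ ζ : ℂ, ‖F ζ‖ = Real.exp (-(lam * cexp (α * ζ)).re + (ζ.re - Real.cos ζ.im * Real.exp ζ.re)) := by
    intro ζ
    rw [hF]
    simp only []
    rw [norm_mul, Complex.norm_exp, Complex.norm_exp, ← Real.exp_add, neg_re, sub_re,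
      Complex.exp_re ζ]
    ring_nf
  obtain ⟨C, hC⟩ := exp_sub_add_le h0 (by linarith : α < 1) hsin ht0.le
  have hshift := integral_shift (F := F) (C := C) hγ0 (fun ζ _ _ => by rw [hF]; fun_prop) (by
    intro ζ hz1 hz2
    refine le_trans ?_ (hC ζ.re)
    rw [hFn, Real.exp_le_exp]
    have hc : Real.sin ε ≤ Real.cos ζ.im := by
      rw [← Real.cos_pi_div_two_sub]
      exact Real.cos_le_cos_of_nonneg_of_le_pi hz1 (by linarith) (by linarith)
    have h2 : -(lam * cexp (α * ζ)).re ≤ t * Real.exp (α * ζ.re) := by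
      have := Complex.abs_re_le_norm (lam * cexp (α * ζ))
      rw [norm_mul, hnlam, Complex.norm_exp, re_ofReal_mul] at this
      exact (neg_le_abs _).trans this
    have := mul_le_mul_of_nonneg_right hc (Real.exp_pos ζ.re).le
    linarith)
  rw [hQ, hshift]
  have hε2 : 2 / π * ε ≤ Real.sin ε := Real.mul_le_sin hε0.le (by linarith)
  have hd : 0 < (2 / π - α * α) * ε := by positivity
  have hbound : ∀ x : ℝ, ‖F (x + γ * I)‖ ≤
      Real.exp (α * (1 - α)) * Real.exp (x - (2 / π - α * α) * ε * Real.exp x) := by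
    intro x
    rw [hFn, ← Real.exp_add, Real.exp_le_exp]
    have e1 : lam * cexp (α * (x + γ * I)) =
        ((t * Real.exp (α * x) : ℝ) : ℂ) * cexp ((-(π / 2 + α * ε) : ℝ) * I) := by
      rw [hlam, hγ]; push_cast
      rw [mul_assoc, mul_assoc, ← Complex.exp_add, ← Complex.exp_add]; ring_nf
    have e2 : (lam * cexp (α * (x + γ * I))).re = -(t * Real.exp (α * x) * Real.sin (α * ε)) := by
      rw [e1, re_ofReal_mul, Complex.exp_ofReal_mul_I_re, Real.cos_neg, add_comm (π / 2),
        Real.cos_add_pi_div_two]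
      ring
    rw [e2]
    have e3 : ((x : ℂ) + γ * I).re = x := by simp
    have e4 : ((x : ℂ) + γ * I).im = γ := by simp
    rw [e3, e4, hγ, Real.cos_pi_div_two_sub]
    have y := young h0 (by linarith : α < 1) hX0.le x
    rw [← ht] at y
    have s1 : Real.sin (α * ε) ≤ α * ε := Real.sin_le (by positivity)
    have y2 : t * Real.exp (α * x) * Real.sin (α * ε) ≤ (α * Real.exp x + (1 - α) * X) * (α * ε) := by
      have : 0 < t * Real.exp (α * x) := by positivity
      calc _ ≤ t * Real.exp (α * x) * (α * ε) := by gcongr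
        _ ≤ _ := by gcongr
    have e5 : (1 - α) * X * (α * ε) = α * (1 - α) := by rw [hε]; field_simp
    have := mul_le_mul_of_nonneg_right hε2 (Real.exp_pos x).le
    nlinarith
  have hfin := norm_integral_le_of_norm_le ((integrable_exp_sub_mul_exp hd).const_mul
    (Real.exp (α * (1 - α)))) (f := fun x : ℝ => F (x + γ * I)) (Eventually.of_forall hbound)
  rw [integral_const_mul, integral_exp_sub_mul_exp hd] at hfin
  refine hfin.trans (le_of_eq ?_)
  rw [hε]
  field_simp

lemma norm_Q_cut {α : ℝ} (h0 : 0 < α) (h1 : α < 1 / 2) {y₀ : ℝ} (hy₀ : 0 < y₀)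
    (hy : y₀ ^ (1 - α) = α) :
    ∃ C : ℝ, ∀ X : ℝ, 1 ≤ X → ‖Q α (-(X ^ (1 - α) : ℝ))‖ ≤
      C * Real.sqrt X * Real.exp (y₀ * (1 / α - 1) * X) := by
  have hpi := Real.pi_pos
  refine ⟨2 * Real.sqrt (2 * π) * (1 + Real.sqrt y₀), fun X hX => ?_⟩
  have hX0 : 0 < X := by linarith
  set Y := y₀ * X with hY
  have hY0 : 0 < Y := by positivity
  set G : ℝ → ℝ := fun u => Real.exp (y₀ * (1 / α - 1) * X) *
    (2 * Y * ((1 / Real.sqrt Y + 1) * Real.exp (-(Y / 2) * (u - 1) ^ 2))) with hG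
  have hGi : Integrable G := by
    have := (integrable_exp_neg_mul_sq (b := Y / 2) (by positivity)).comp_sub_right 1
    exact ((this.const_mul _).const_mul _).const_mul _
  have hGv : ∫ u, G u = Real.exp (y₀ * (1 / α - 1) * X) *
      (2 * Y * ((1 / Real.sqrt Y + 1) * Real.sqrt (π / (Y / 2)))) := by
    simp only [hG]
    rw [integral_const_mul, integral_const_mul, integral_const_mul,
      integral_sub_right_eq_self (fun u => Real.exp (-(Y / 2) * u ^ 2)), integral_gaussian]
  have hG0 : ∀ u, 0 ≤ G u := fun u => by positivity
  set f : ℝ → ℂ := fun x => cexp (-(-((X ^ (1 - α) : ℝ) : ℂ) * Real.exp (α * x))) * (wt x : ℝ) with hf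
  have hsub : ∫ x, f x = (2 : ℂ) * ∫ s, f (2 * s + Real.log Y) := by
    have e1 := integral_add_right_eq_self (μ := volume) f (Real.log Y)
    have e2 := Measure.integral_comp_mul_left (fun x => f (x + Real.log Y)) 2
    rw [e2, ← e1]
    simp
  have hexp := integral_exp_smul_comp_exp G
  have hbd : ∀ s : ℝ, ‖(2 : ℂ) * f (2 * s + Real.log Y)‖ ≤ Real.exp s • G (Real.exp s) := by
    intro s
    rw [norm_mul, hf]
    simp only []
    rw [norm_mul, norm_real, Real.norm_of_nonneg (wt_pos _).le, Complex.norm_exp, neg_re, neg_mul,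
      neg_re, neg_neg, ← ofReal_mul, ofReal_re, Complex.norm_ofNat, smul_eq_mul, hG, wt]
    simp only []
    have eY : Real.exp (2 * s + Real.log Y) = Y * Real.exp s ^ 2 := by
      rw [Real.exp_add, Real.exp_log hY0, ← Real.exp_nat_mul]; push_cast; ring
    have eα : X ^ (1 - α) * Real.exp (α * (2 * s + Real.log Y)) =
        Y / α * Real.exp (2 * α * s) := by
      have : Real.exp (α * (2 * s + Real.log Y)) = Y ^ α * Real.exp (2 * α * s) := by
        rw [Real.rpow_def_of_pos hY0, ← Real.exp_add]; ring_nf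
      rw [this, hY, Real.mul_rpow hy₀.le hX0.le]
      have a1 : X ^ (1 - α) * X ^ α = X := by rw [← Real.rpow_add hX0]; simp
      have a2 : y₀ ^ (1 - α) * y₀ ^ α = y₀ := by rw [← Real.rpow_add hy₀]; simp
      rw [hy] at a2
      calc _ = (X ^ (1 - α) * X ^ α) * y₀ ^ α * Real.exp (2 * α * s) := by ring
        _ = X * (α * y₀ ^ α) / α * Real.exp (2 * α * s) := by rw [a1]; field_simp
        _ = _ := by rw [a2]; ring
    rw [eα, Real.exp_sub, eY]
    set u := Real.exp s with hu
    have hu0 : 0 < u := Real.exp_pos s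
    have hb : Real.exp (2 * α * s) ≤ 1 + 2 * α * (u - 1) := by
      have := rpow_one_add_le_one_add_mul_self (s := u - 1) (by linarith) (p := 2 * α)
        (by linarith) (by linarith)
      rw [add_sub_cancel, hu, ← Real.exp_mul] at this
      rw [hu]; convert this using 2; ring
    have hkey : Y / α * Real.exp (2 * α * s) - Y * u ^ 2 ≤
        y₀ * (1 / α - 1) * X - Y * (u - 1) ^ 2 := by
      have := mul_le_mul_of_nonneg_left hb (show 0 ≤ Y / α by positivity)
      have e : Y / α * (1 + 2 * α * (u - 1)) = Y / α + 2 * Y * (u - 1) := by field_simp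
      rw [e] at this
      have e2 : y₀ * (1 / α - 1) * X = Y / α - Y := by rw [hY]; field_simp
      rw [e2]; nlinarith
    have hsq : Real.sqrt Y ^ 2 = Y := Real.sq_sqrt hY0.le
    have hsY : 0 < Real.sqrt Y := Real.sqrt_pos.2 hY0
    have hu1 : u * Real.exp (-Y * (u - 1) ^ 2) ≤
        (1 / Real.sqrt Y + 1) * Real.exp (-(Y / 2) * (u - 1) ^ 2) := by
      have e : Real.exp (-Y * (u - 1) ^ 2) =
          Real.exp (-(Y / 2) * (u - 1) ^ 2) * Real.exp (-(Y / 2) * (u - 1) ^ 2) := by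
        rw [← Real.exp_add]; ring_nf
      have h3 : u * Real.exp (-(Y / 2) * (u - 1) ^ 2) ≤ 1 / Real.sqrt Y + 1 := by
        set z := Real.sqrt Y * (u - 1) with hz
        have ez : -(Y / 2) * (u - 1) ^ 2 = -(z ^ 2 / 2) := by rw [hz, mul_pow, hsq]; ring
        have eu : u = z / Real.sqrt Y + 1 := by rw [hz]; field_simp; ring
        rw [ez, Real.exp_neg, ← div_eq_mul_inv, div_le_iff₀ (Real.exp_pos _)]
        have hE := Real.add_one_le_exp (z ^ 2 / 2)
        have hz1 : z ≤ Real.exp (z ^ 2 / 2) := by nlinarith [sq_nonneg (z - 1)]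
        have hz2 : 1 ≤ Real.exp (z ^ 2 / 2) := by nlinarith [sq_nonneg z]
        rw [eu, add_mul, div_mul_eq_mul_div, one_mul]
        gcongr
      rw [e, ← mul_assoc]
      gcongr
    calc 2 * (Real.exp (Y / α * Real.exp (2 * α * s)) * (Y * u ^ 2 / Real.exp (Y * u ^ 2)))
        = 2 * Y * u ^ 2 * Real.exp (Y / α * Real.exp (2 * α * s) - Y * u ^ 2) := by
          rw [Real.exp_sub]; ring
      _ ≤ 2 * Y * u ^ 2 * Real.exp (y₀ * (1 / α - 1) * X - Y * (u - 1) ^ 2) := by gcongr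
      _ = u * (Real.exp (y₀ * (1 / α - 1) * X) * (2 * Y * (u * Real.exp (-Y * (u - 1) ^ 2)))) := by
          rw [sub_eq_add_neg, Real.exp_add, neg_mul]; ring
      _ ≤ _ := by gcongr
  have hin : Integrable (fun s => Real.exp s • G (Real.exp s)) :=
    (integrable_exp_smul_comp_exp G).2 hGi.integrableOn
  have hle := norm_integral_le_of_norm_le hin (Eventually.of_forall hbd)
  rw [integral_const_mul, ← hsub, hexp] at hle
  have hle2 : ∫ u in Ioi 0, G u ≤ ∫ u, G u := setIntegral_le_integral hGi (Eventually.of_forall hG0)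
  have hQ : Q α (-(X ^ (1 - α) : ℝ)) = ∫ x, f x := rfl
  rw [hQ]
  refine hle.trans (hle2.trans ?_)
  rw [hGv]
  have hsY : 0 < Real.sqrt Y := Real.sqrt_pos.2 hY0
  have e1 : Real.sqrt (π / (Y / 2)) = Real.sqrt (2 * π) / Real.sqrt Y := by
    rw [← Real.sqrt_div (by positivity)]; congr 1; field_simp
  have hsq : Real.sqrt Y ^ 2 = Y := Real.sq_sqrt hY0.le
  have e2 : 2 * Y * ((1 / Real.sqrt Y + 1) * (Real.sqrt (2 * π) / Real.sqrt Y)) =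
      2 * Real.sqrt (2 * π) * (1 + Real.sqrt Y) := by
    nth_rewrite 1 [← hsq]; field_simp
  rw [e1, e2, hY, Real.sqrt_mul hy₀.le]
  have hX1 : 1 ≤ Real.sqrt X := Real.one_le_sqrt.2 hX
  have : 2 * Real.sqrt (2 * π) * (1 + Real.sqrt y₀ * Real.sqrt X) ≤
      2 * Real.sqrt (2 * π) * (1 + Real.sqrt y₀) * Real.sqrt X := by
    rw [mul_assoc (2 * Real.sqrt (2 * π))]
    gcongr
    nlinarith [Real.sqrt_nonneg y₀]
  calc _ ≤ Real.exp (y₀ * (1 / α - 1) * X) *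
      (2 * Real.sqrt (2 * π) * (1 + Real.sqrt y₀) * Real.sqrt X) := by gcongr
    _ = _ := by ring

/-! ### The Laplace transform of the stable density -/

lemma integral_wt_mul_exp {x : ℝ} {s : ℂ} (hs : 0 < s.re) :
    Integrable (fun p : ℝ => ((wt (x + p) : ℝ) : ℂ) * cexp (-(s * cexp p))) ∧
    ∫ p : ℝ, ((wt (x + p) : ℝ) : ℂ) * cexp (-(s * cexp p)) = cexp x / (cexp x + s) := by
  have hre : (-(cexp x + s)).re < 0 := by
    rw [neg_re, add_re, ← ofReal_exp, ofReal_re]; linarith [Real.exp_pos x]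
  have e : (fun p : ℝ => ((wt (x + p) : ℝ) : ℂ) * cexp (-(s * cexp p))) =
      fun p : ℝ => cexp x * (Real.exp p • cexp (-(cexp x + s) * (Real.exp p : ℝ))) := by
    ext p
    rw [wt, Complex.real_smul]; push_cast
    have h : (x + p - cexp (x + p) : ℂ) + -(s * cexp p) = x + (p + -(cexp x + s) * cexp p) := by
      rw [Complex.exp_add]; ring
    rw [← Complex.exp_add, h, Complex.exp_add, Complex.exp_add (p : ℂ)]
  rw [e]
  constructor
  · refine Integrable.const_mul ?_ _
    exact (integrable_exp_smul_comp_exp (fun v : ℝ => cexp (-(cexp x + s) * (v : ℝ)))).2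
      (integrableOn_exp_mul_complex_Ioi hre 0)
  · rw [integral_const_mul,
      integral_exp_smul_comp_exp (fun v : ℝ => cexp (-(cexp x + s) * (v : ℝ))),
      integral_exp_mul_complex_Ioi hre 0]
    simp only [ofReal_zero, mul_zero, Complex.exp_zero]
    rw [neg_div_neg_eq, mul_one_div]

lemma integral_E_mul_wt_add {α : ℝ} (h0 : 0 < α) (h1 : α < 1) (t p : ℝ) :
    ∫ x, E α t x * wt (x + p) = N α (t * Real.exp (-(α * p))) := by
  rw [← integral_sub_right_eq_self (μ := volume) (fun x => E α t x * wt (x + p)) p,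
    N_eq_integral h0 h1]
  congr 1; ext x
  rw [sub_add_cancel, sub_eq_add_neg, E_add, mul_neg]

lemma laplace_N {α t : ℝ} (h0 : 0 < α) (h1 : α < 1 / 2) (ht : 0 < t) {ξ : ℂ}
    (hξ : |ξ.im| < π / 2) :
    Integrable (fun p : ℝ => ((N α (t * Real.exp (-(α * p))) : ℝ) : ℂ) *
      cexp (-(cexp ξ * cexp p))) ∧
    hfun α t ξ = (1 / π : ℝ) * ∫ p : ℝ, ((N α (t * Real.exp (-(α * p))) : ℝ) : ℂ) *
      cexp (-(cexp ξ * cexp p)) := by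
  have hpi := Real.pi_pos
  have hd : 0 < (cexp ξ).re := by
    rw [Complex.exp_re]
    rw [abs_lt] at hξ
    exact mul_pos (Real.exp_pos _) (Real.cos_pos_of_mem_Ioo ⟨by linarith, by linarith⟩)
  set d := (cexp ξ).re with hd'
  have hnorm : ∀ p : ℝ, ‖cexp (-(cexp ξ * cexp p))‖ = Real.exp (-(d * Real.exp p)) := by
    intro p
    rw [Complex.norm_exp, neg_re, ← ofReal_exp, re_mul_ofReal]
  have hfi : Integrable (fun q : ℝ × ℝ => (E α t q.1 : ℂ) *
      (((wt (q.1 + q.2) : ℝ) : ℂ) * cexp (-(cexp ξ * cexp q.2)))) (volume.prod volume) := by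
    rw [integrable_prod_iff]
    · refine ⟨Eventually.of_forall fun x =>
        (integral_wt_mul_exp (x := x) hd).1.const_mul (E α t x : ℂ), ?_⟩
      have e : ∀ x : ℝ, ∫ p : ℝ, ‖(E α t x : ℂ) *
          (((wt (x + p) : ℝ) : ℂ) * cexp (-(cexp ξ * cexp p)))‖ =
          |E α t x| * (Real.exp x / (Real.exp x + d)) := by
        intro x
        have h3 := (integral_wt_mul_exp (x := x) (s := (d : ℂ)) (by simpa using hd)).2
        have e2 : ∀ p : ℝ, ((wt (x + p) : ℝ) : ℂ) * cexp (-(d * cexp p)) =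
            ((wt (x + p) * Real.exp (-(d * Real.exp p)) : ℝ) : ℂ) := by
          intro p; push_cast; ring
        simp only [e2] at h3
        rw [integral_complex_ofReal] at h3
        have h4 : ∫ p, wt (x + p) * Real.exp (-(d * Real.exp p)) =
            Real.exp x / (Real.exp x + d) := by
          have : ((∫ p, wt (x + p) * Real.exp (-(d * Real.exp p)) : ℝ) : ℂ) =
            ((Real.exp x / (Real.exp x + d) : ℝ) : ℂ) := by rw [h3]; push_cast; rfl
          exact_mod_cast this
        rw [← h4, ← integral_const_mul]
        congr 1; ext p
        rw [norm_mul, norm_mul, hnorm, norm_real, norm_real, Real.norm_eq_abs,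
          Real.norm_of_nonneg (wt_pos _).le]
      simp only [e]
      refine ((integrable_E_mul_exp h0 h1 ht).norm.mul_const (1 / d)).mono'
        (Continuous.aestronglyMeasurable ?_) (Eventually.of_forall fun x => ?_)
      · have := continuous_E α t
        refine (by fun_prop : Continuous fun x => |E α t x|).mul
          (Continuous.div (by fun_prop) (by fun_prop) fun x => ?_)
        have := Real.exp_pos x; positivity
      · have := Real.exp_pos x
        rw [Real.norm_of_nonneg (by positivity), norm_mul, Real.norm_eq_abs,
          Real.norm_of_nonneg this.le, mul_assoc, mul_one_div]
        gcongr
        linarith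
    · refine Continuous.aestronglyMeasurable ?_
      have := continuous_E α t
      have := continuous_wt
      fun_prop
  have e : ∀ p : ℝ, ∫ x : ℝ, (E α t x : ℂ) *
      (((wt (x + p) : ℝ) : ℂ) * cexp (-(cexp ξ * cexp p))) =
      ((N α (t * Real.exp (-(α * p))) : ℝ) : ℂ) * cexp (-(cexp ξ * cexp p)) := by
    intro p
    rw [← integral_E_mul_wt_add h0 (by linarith), ← integral_complex_ofReal, ← integral_mul_const]
    congr 1; ext x; push_cast; ring
  constructor
  · have := hfi.integral_prod_right
    simpa only [e] using this
  · rw [(hfun_eq_integral h0 h1 ht (ξ := ξ) (by linarith)).2]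
    congr 1
    simp only [← e]
    rw [← integral_integral_swap hfi]
    congr 1; ext x
    rw [integral_const_mul, (integral_wt_mul_exp hd).2]

lemma N_le_axis {α : ℝ} (h0 : 0 < α) (h1 : α < 1 / 2) {y₀ : ℝ} (hy₀ : 0 < y₀)
    (hy : y₀ ^ (1 - α) = α) :
    ∃ C : ℝ, ∀ X : ℝ, 1 ≤ X → N α (X ^ (1 - α)) ≤
      C * X * Real.exp (-(y₀ * (1 / α - 1) * X)) := by
  have hpi := Real.pi_pos
  refine ⟨π * Real.exp (α + 2 * y₀), fun X hX => ?_⟩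
  have hX0 : 0 < X := by linarith
  set t : ℝ := X ^ (1 - α) with ht
  have ht0 : 0 < t := Real.rpow_pos_of_pos hX0 _
  set s := y₀ * X with hs
  have hs0 : 0 < s := by positivity
  obtain ⟨hi, hL⟩ := laplace_N h0 h1 ht0 (ξ := ((Real.log s : ℝ) : ℂ)) (by simpa using hpi)
  have hexp : cexp ((Real.log s : ℝ) : ℂ) = (s : ℂ) := by
    rw [← ofReal_exp, Real.exp_log hs0]
  have e1 : ∀ p : ℝ, ((N α (t * Real.exp (-(α * p))) : ℝ) : ℂ) *
      cexp (-(cexp ((Real.log s : ℝ) : ℂ) * cexp p)) =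
      ((N α (t * Real.exp (-(α * p))) * Real.exp (-(s * Real.exp p)) : ℝ) : ℂ) := by
    intro p; rw [hexp]; push_cast; rfl
  simp only [e1] at hi hL
  have hi' : Integrable (fun p => N α (t * Real.exp (-(α * p))) * Real.exp (-(s * Real.exp p))) := by
    exact hi.re
  have a1 : t * s ^ α = y₀ / α * X := by
    have a1 : X ^ (1 - α) * X ^ α = X := by rw [← Real.rpow_add hX0]; simp
    have a2 : y₀ ^ (1 - α) * y₀ ^ α = y₀ := by rw [← Real.rpow_add hy₀]; simp
    rw [hy] at a2
    rw [hs, Real.mul_rpow hy₀.le hX0.le, ht]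
    calc _ = (X ^ (1 - α) * X ^ α) * (α * y₀ ^ α) / α := by field_simp
      _ = _ := by rw [a1, a2]; ring
  have hL' : Real.exp (-(y₀ / α * X)) =
      (1 / π) * ∫ p, N α (t * Real.exp (-(α * p))) * Real.exp (-(s * Real.exp p)) := by
    rw [integral_complex_ofReal] at hL
    have e3 : hfun α t (Real.log s : ℝ) = ((Real.exp (-(t * s ^ α)) : ℝ) : ℂ) := by
      rw [hfun, Real.rpow_def_of_pos hs0]; push_cast; ring_nf
    rw [e3, a1] at hL
    exact_mod_cast hL
  set ε := 1 / X with hε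
  have hε0 : 0 < ε := by positivity
  have hε1 : ε ≤ 1 := by rw [hε, div_le_one hX0]; exact hX
  have hnn : ∀ p : ℝ, 0 ≤ N α (t * Real.exp (-(α * p))) * Real.exp (-(s * Real.exp p)) := fun p =>
    mul_nonneg (N_nonneg h0 h1 (by positivity)) (Real.exp_pos _).le
  have hlow : ε * (Real.exp (-α) * N α t * Real.exp (-(s + 2 * y₀))) ≤
      ∫ p, N α (t * Real.exp (-(α * p))) * Real.exp (-(s * Real.exp p)) := by
    refine le_trans ?_ (setIntegral_le_integral (s := Icc 0 ε) hi' (Eventually.of_forall hnn))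
    have hc : ε * (Real.exp (-α) * N α t * Real.exp (-(s + 2 * y₀))) =
        ∫ _ in Icc (0:ℝ) ε, (Real.exp (-α) * N α t * Real.exp (-(s + 2 * y₀))) := by
      rw [setIntegral_const]; simp [hε0.le]
    rw [hc]
    refine setIntegral_mono_on (integrableOn_const (by simp)) hi'.integrableOn measurableSet_Icc
      fun p hp => ?_
    have hN := N_nonneg h0 h1 ht0
    have hαp : 0 ≤ α * p := mul_nonneg h0.le hp.1
    have hle1 : Real.exp (-(α * p)) ≤ 1 := Real.exp_le_one_iff.2 (by linarith)
    have h3 := N_div_anti h0 h1 (mul_pos ht0 (Real.exp_pos (-(α * p))))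
      (mul_le_of_le_one_right ht0.le hle1)
    rw [div_le_div_iff₀ ht0 (by positivity)] at h3
    have h4 : N α t * Real.exp (-(α * p)) ≤ N α (t * Real.exp (-(α * p))) := by
      refine le_of_mul_le_mul_right ?_ ht0
      linarith
    have h5 : Real.exp (-α) ≤ Real.exp (-(α * p)) := by
      rw [Real.exp_le_exp]; nlinarith [hp.2]
    have h6 : s * Real.exp p ≤ s + 2 * y₀ := by
      have hp1 : |p| ≤ 1 := by rw [abs_of_nonneg hp.1]; linarith [hp.2]
      have := Real.abs_exp_sub_one_le hp1
      rw [abs_of_nonneg hp.1] at this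
      have := (le_abs_self _).trans this
      have h7 : s * (Real.exp p - 1) ≤ s * (2 * ε) := by
        gcongr; linarith [hp.2]
      have h8 : s * (2 * ε) = 2 * y₀ := by rw [hs, hε]; field_simp
      linarith
    calc _ ≤ N α t * Real.exp (-(α * p)) * Real.exp (-(s * Real.exp p)) := by
          rw [mul_comm (Real.exp (-α))]
          gcongr
      _ ≤ _ := by gcongr
  have hfin : ε * (Real.exp (-α) * N α t * Real.exp (-(s + 2 * y₀))) ≤
      π * Real.exp (-(y₀ / α * X)) := by
    rw [hL', one_div, mul_inv_cancel_left₀ hpi.ne']; exact hlow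
  have e5 : N α t = X * Real.exp α * Real.exp (s + 2 * y₀) *
      (ε * (Real.exp (-α) * N α t * Real.exp (-(s + 2 * y₀)))) := by
    rw [Real.exp_neg, Real.exp_neg, hε]; field_simp
  rw [e5]
  calc _ ≤ X * Real.exp α * Real.exp (s + 2 * y₀) * (π * Real.exp (-(y₀ / α * X))) := by gcongr
    _ = π * X * (Real.exp α * Real.exp (s + 2 * y₀) * Real.exp (-(y₀ / α * X))) := by ring
    _ = π * X * (Real.exp (α + 2 * y₀) * Real.exp (-(y₀ * (1 / α - 1) * X))) := by
        rw [← Real.exp_add, ← Real.exp_add, ← Real.exp_add, hs]; ring_nf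
    _ = _ := by ring

/-! ### The logarithmic density as an entire function -/

/-- The entire function whose values on the real axis are those of the logarithmic density. -/
noncomputable def W (α : ℝ) (ζ : ℂ) : ℂ :=
  (2 * π * I)⁻¹ * (Q α (cexp ((1 - α : ℝ) * ζ + (-(π * α) : ℝ) * I)) -
    Q α (cexp ((1 - α : ℝ) * ζ + (π * α : ℝ) * I)))

/-- `W` with its exponential decay on the real axis removed. -/
noncomputable def K (α c : ℝ) (ζ : ℂ) : ℂ := W α ζ * cexp (c * cexp ζ)

lemma differentiable_K {α : ℝ} (h0 : 0 < α) (h1 : α < 1) (c : ℝ) : Differentiable ℂ (K α c) := by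
  have := differentiable_Q h0 h1
  unfold K W
  fun_prop

lemma W_conj (α : ℝ) (ζ : ℂ) : W α (conj ζ) = conj (W α ζ) := by
  have e1 : cexp ((1 - α : ℝ) * conj ζ + (-(π * α) : ℝ) * I) =
      conj (cexp ((1 - α : ℝ) * ζ + (π * α : ℝ) * I)) := by
    rw [← Complex.exp_conj]; simp
  have e2 : cexp ((1 - α : ℝ) * conj ζ + (π * α : ℝ) * I) =
      conj (cexp ((1 - α : ℝ) * ζ + (-(π * α) : ℝ) * I)) := by
    rw [← Complex.exp_conj]; simp
  rw [W, W, e1, e2, Q_conj, Q_conj]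
  simp only [map_mul, map_inv₀, map_sub, conj_I, conj_ofReal, map_ofNat (starRingEnd ℂ)]
  rw [mul_neg, inv_neg]
  ring

lemma K_conj (α c : ℝ) (ζ : ℂ) : K α c (conj ζ) = conj (K α c ζ) := by
  rw [K, K, W_conj, map_mul, ← Complex.exp_conj]
  congr 1
  rw [map_mul, conj_ofReal, Complex.exp_conj]

lemma norm_two_pi_I_inv : ‖(2 * π * I : ℂ)⁻¹‖ = 1 / (2 * π) := by
  simp [abs_of_pos Real.pi_pos]

lemma norm_inv_le_one : ‖(2 * π * I : ℂ)⁻¹‖ ≤ 1 := by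
  rw [norm_two_pi_I_inv, div_le_one (by positivity)]
  linarith [Real.pi_gt_three]

lemma norm_lam (α a : ℝ) (ζ : ℂ) :
    ‖cexp ((1 - α : ℝ) * ζ + a * I)‖ = Real.exp ((1 - α) * ζ.re) := by
  rw [Complex.norm_exp, add_re, re_ofReal_mul, re_ofReal_mul, I_re, mul_zero, add_zero]

lemma W_ofReal (α ξ : ℝ) : W α ξ = ((N α (Real.exp ((1 - α) * ξ)) / π : ℝ) : ℂ) := by
  have e : cexp ((1 - α : ℝ) * ξ + (π * α : ℝ) * I) =
      conj (cexp ((1 - α : ℝ) * ξ + (-(π * α) : ℝ) * I)) := by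
    rw [← Complex.exp_conj]; simp
  have e2 : (Real.exp ((1 - α) * ξ) : ℂ) * cexp (-(π * α) * I) =
      cexp ((1 - α : ℝ) * ξ + (-(π * α) : ℝ) * I) := by
    push_cast; rw [← Complex.exp_add]
  have hpi : (π : ℂ) ≠ 0 := by exact_mod_cast Real.pi_ne_zero
  rw [W, N, e2, e, Q_conj, Complex.sub_conj]
  push_cast
  field_simp

lemma gam_eq_W {α : ℝ} (h1 : α < 1) (p : ℝ) :
    (gam α p : ℂ) = W α ((-(α / (1 - α) * p) : ℝ) : ℂ) := by
  rw [W_ofReal, gam]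
  have : (1 - α) * -(α / (1 - α) * p) = -(α * p) := by
    field_simp [(by linarith : (1:ℝ) - α ≠ 0)]
  rw [this]

lemma W_add_pi {α : ℝ} (h0 : 0 < α) (ξ : ℝ) :
    W α (ξ + π * I) = (I / (2 * π)) *
      ((Dg α (π * (1 - 2 * α) / α) (Real.exp ((1 - α) * ξ)) : ℝ) +
       (Ng α (π * (1 - 2 * α) / α) (Real.exp ((1 - α) * ξ)) : ℝ) * I) := by
  have hα : (α : ℂ) ≠ 0 := by exact_mod_cast h0.ne'
  have hpi : (π : ℂ) ≠ 0 := by exact_mod_cast Real.pi_ne_zero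
  set t := Real.exp ((1 - α) * ξ) with ht
  have e1 : cexp ((1 - α : ℝ) * (ξ + π * I) + (-(π * α) : ℝ) * I) =
      t * cexp (α * (π * (1 - 2 * α) / α : ℝ) * I) := by
    rw [ht]; push_cast; rw [← Complex.exp_add]
    congr 1; field_simp; ring
  have e2 : cexp ((1 - α : ℝ) * (ξ + π * I) + (π * α : ℝ) * I) = -t := by
    have : (((1 - α : ℝ) : ℂ) * (ξ + π * I) + (π * α : ℝ) * I) = ((1 - α) * ξ : ℝ) + π * I := by
      push_cast; ring
    rw [this, Complex.exp_add, Complex.exp_pi_mul_I, ← ofReal_exp]; ring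
  have e3 : Q α (-t) = ((Q α (-t)).re : ℂ) := by
    have := Q_conj α (-t)
    rw [map_neg, conj_ofReal] at this
    exact (conj_eq_iff_re.1 this.symm).symm
  rw [W, e1, e2, Ng, Dg, e3]
  set z := Q α (t * cexp (α * (π * (1 - 2 * α) / α : ℝ) * I))
  conv_lhs => rw [← Complex.re_add_im z]
  simp only [ofReal_re]
  push_cast
  field_simp
  ring_nf
  simp only [I_sq, I_pow_three]
  ring

lemma norm_exp_mul_exp (c : ℝ) (ζ : ℂ) :
    ‖cexp (c * cexp ζ)‖ = Real.exp (c * (Real.exp ζ.re * Real.cos ζ.im)) := by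
  rw [Complex.norm_exp, re_ofReal_mul, Complex.exp_re]

lemma exists_lipschitz_Q {α : ℝ} (h0 : 0 < α) (h1 : α < 1) :
    ∃ L : ℝ, 0 ≤ L ∧ ∀ a b : ℂ, ‖a‖ ≤ 1 → ‖b‖ ≤ 1 → ‖Q α a - Q α b‖ ≤ L * ‖a - b‖ := by
  have hd := differentiable_Q h0 h1
  have hc : Continuous (deriv (Q α)) := (hd.contDiff (n := 1)).continuous_deriv le_rfl
  obtain ⟨L, hL⟩ := (isCompact_closedBall (0:ℂ) 1).exists_bound_of_continuousOn hc.continuousOn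
  refine ⟨L, (norm_nonneg _).trans (hL 0 (by simp)), fun a b ha hb => ?_⟩
  refine (convex_closedBall (0:ℂ) 1).norm_image_sub_le_of_norm_deriv_le (f := Q α)
    (fun x _ => hd x) (fun x hx => hL x hx) ?_ ?_ <;> simpa

lemma norm_K_le_left {α c : ℝ} (h0 : 0 < α) (h1 : α < 1) (hc : 0 ≤ c) :
    ∃ C : ℝ, 0 ≤ C ∧ ∀ ζ : ℂ, ζ.re ≤ 0 → ‖K α c ζ‖ ≤ C * Real.exp ((1 - α) * ζ.re) := by
  obtain ⟨L, hL0, hL⟩ := exists_lipschitz_Q h0 h1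
  refine ⟨L * 2 * Real.exp c, by positivity, fun ζ hζ => ?_⟩
  have hle : Real.exp ((1 - α) * ζ.re) ≤ 1 := by
    rw [Real.exp_le_one_iff]; nlinarith
  have h2 := hL (cexp ((1 - α : ℝ) * ζ + (-(π * α) : ℝ) * I))
    (cexp ((1 - α : ℝ) * ζ + (π * α : ℝ) * I)) (by rwa [norm_lam]) (by rwa [norm_lam])
  have h3 := norm_sub_le (cexp ((1 - α : ℝ) * ζ + (-(π * α) : ℝ) * I))
    (cexp ((1 - α : ℝ) * ζ + (π * α : ℝ) * I))
  rw [norm_lam, norm_lam] at h3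
  have h4 : ‖W α ζ‖ ≤ L * 2 * Real.exp ((1 - α) * ζ.re) := by
    rw [W, norm_mul]
    refine (mul_le_of_le_one_left (norm_nonneg _) norm_inv_le_one).trans (h2.trans ?_)
    nlinarith [mul_le_mul_of_nonneg_left h3 hL0]
  have h5 : ‖cexp (c * cexp ζ)‖ ≤ Real.exp c := by
    rw [norm_exp_mul_exp, Real.exp_le_exp]
    refine mul_le_of_le_one_right hc ?_
    have hx : Real.exp ζ.re ≤ 1 := Real.exp_le_one_iff.2 hζ
    nlinarith [Real.cos_le_one ζ.im, Real.exp_pos ζ.re]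
  rw [K, norm_mul]
  calc ‖W α ζ‖ * ‖cexp (c * cexp ζ)‖ ≤ (L * 2 * Real.exp ((1 - α) * ζ.re)) * Real.exp c :=
        mul_le_mul h4 h5 (norm_nonneg _) (by positivity)
    _ = _ := by ring

lemma norm_K_le_crude {α c : ℝ} (h0 : 0 < α) (h1 : α < 1) (hc : 0 ≤ c) (ζ : ℂ) :
    ‖K α c ζ‖ ≤ (2 / (1 - α)) * Real.exp ((1 - α + c) * Real.exp ζ.re) := by
  have hα : 0 < 1 - α := by linarith
  have hl : ∀ a : ℝ, ‖Q α (cexp ((1 - α : ℝ) * ζ + a * I))‖ ≤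
      Real.exp ((1 - α) * Real.exp ζ.re) / (1 - α) := by
    intro a
    refine norm_Q_le h0 h1 (Real.exp_pos _).le ?_
    rw [norm_lam, ← Real.exp_mul, mul_comm]
  have h4 : ‖W α ζ‖ ≤ 2 / (1 - α) * Real.exp ((1 - α) * Real.exp ζ.re) := by
    rw [W, norm_mul]
    refine (mul_le_of_le_one_left (norm_nonneg _) norm_inv_le_one).trans
      ((norm_sub_le _ _).trans ((add_le_add (hl _) (hl _)).trans_eq ?_))
    ring
  have h5 : ‖cexp (c * cexp ζ)‖ ≤ Real.exp (c * Real.exp ζ.re) := by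
    rw [norm_exp_mul_exp, Real.exp_le_exp]
    refine mul_le_mul_of_nonneg_left ?_ hc
    nlinarith [Real.cos_le_one ζ.im, Real.exp_pos ζ.re]
  rw [K, norm_mul, add_mul, Real.exp_add, ← mul_assoc]
  exact mul_le_mul h4 h5 (norm_nonneg _) (by positivity)

lemma exp_eq_rpow (α x : ℝ) : Real.exp ((1 - α) * x) = Real.exp x ^ (1 - α) := by
  rw [← Real.exp_mul, mul_comm]

lemma lam_eq (α x y a : ℝ) : cexp ((1 - α : ℝ) * (x + y * I : ℂ) + a * I) =
    (Real.exp x ^ (1 - α) : ℝ) * cexp (((1 - α) * y + a : ℝ) * I) := by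
  rw [← exp_eq_rpow]
  push_cast
  rw [← Complex.exp_add]
  congr 1; ring

lemma ofReal_mul_exp_re_nonneg {r a : ℝ} (hr : 0 ≤ r) (h1 : -(π / 2) ≤ a) (h2 : a ≤ π / 2) :
    0 ≤ ((r : ℂ) * cexp (a * I)).re := by
  rw [re_ofReal_mul, Complex.exp_ofReal_mul_I_re]
  exact mul_nonneg hr (Real.cos_nonneg_of_neg_pi_div_two_le_of_le h1 h2)

lemma norm_K_axis {α y₀ : ℝ} (h0 : 1 / 3 < α) (h1 : α < 1 / 2) (hy₀ : 0 < y₀)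
    (hy : y₀ ^ (1 - α) = α) : ∃ C : ℝ, 0 ≤ C ∧ ∀ x : ℝ, 0 ≤ x →
    ‖K α (y₀ * (1 / α - 1)) x‖ ≤ C * Real.exp x := by
  have hα : 0 < α := by linarith
  obtain ⟨C, hC⟩ := N_le_axis hα h1 hy₀ hy
  refine ⟨|C|, abs_nonneg _, fun x hx => ?_⟩
  have h := hC (Real.exp x) (Real.one_le_exp hx)
  have hN := N_nonneg hα h1 (t := Real.exp x ^ (1 - α)) (by positivity)
  have hpi := Real.pi_gt_three
  rw [K, norm_mul, norm_exp_mul_exp, W_ofReal, exp_eq_rpow, norm_real, ofReal_re, ofReal_im,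
    Real.cos_zero, mul_one, Real.norm_of_nonneg (by positivity)]
  set c := y₀ * (1 / α - 1)
  have h2 : N α (Real.exp x ^ (1 - α)) / π ≤ N α (Real.exp x ^ (1 - α)) :=
    div_le_self hN (by linarith)
  calc N α (Real.exp x ^ (1 - α)) / π * Real.exp (c * Real.exp x)
      ≤ (C * Real.exp x * Real.exp (-(c * Real.exp x))) * Real.exp (c * Real.exp x) :=
        mul_le_mul_of_nonneg_right (h2.trans h) (Real.exp_pos _).le
    _ = C * Real.exp x * (Real.exp (-(c * Real.exp x)) * Real.exp (c * Real.exp x)) := by ring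
    _ = C * Real.exp x := by rw [← Real.exp_add]; simp
    _ ≤ |C| * Real.exp x := mul_le_mul_of_nonneg_right (le_abs_self _) (Real.exp_pos _).le

lemma norm_K_middle {α : ℝ} (h0 : 1 / 3 < α) (h1 : α < 1 / 2) (c : ℝ) :
    ∃ C : ℝ, 0 ≤ C ∧ ∀ x : ℝ, 0 ≤ x → ‖K α c (x + (π / 2 : ℝ) * I)‖ ≤ C * Real.exp x := by
  have hα : 0 < α := by linarith
  have hpi := Real.pi_pos
  obtain ⟨C, hC⟩ := norm_Q_middle hα h1
  refine ⟨1 + |C|, by positivity, fun x hx => ?_⟩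
  have hX := Real.one_le_exp hx
  have h := hC (Real.exp x) hX
  rw [K, norm_mul, norm_exp_mul_exp]
  have him : ((x : ℂ) + (π / 2 : ℝ) * I).im = π / 2 := by
    rw [add_im, im_ofReal_mul, ofReal_im, I_im]; ring
  rw [him, Real.cos_pi_div_two, mul_zero, mul_zero, Real.exp_zero, mul_one, W, norm_mul, lam_eq,
    lam_eq]
  refine (mul_le_of_le_one_left (norm_nonneg _) norm_inv_le_one).trans
    ((norm_sub_le _ _).trans ?_)
  have e1 : ‖Q α ((Real.exp x ^ (1 - α) : ℝ) *
      cexp (((1 - α) * (π / 2) + -(π * α) : ℝ) * I))‖ ≤ 1 := by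
    refine norm_Q_le_one (ofReal_mul_exp_re_nonneg (by positivity) ?_ ?_) <;> nlinarith
  have e2 : ‖Q α ((Real.exp x ^ (1 - α) : ℝ) *
      cexp (((1 - α) * (π / 2) + π * α : ℝ) * I))‖ ≤ C * Real.exp x := by
    rw [← norm_conj, ← Q_conj]
    convert h using 3
    rw [map_mul, conj_ofReal, ← Complex.exp_conj]
    congr 2
    rw [map_mul, conj_ofReal, conj_I]
    push_cast; ring
  have := le_abs_self C
  nlinarith [Real.exp_pos x]

lemma norm_K_cut {α y₀ : ℝ} (h0 : 1 / 3 < α) (h1 : α < 1 / 2) (hy₀ : 0 < y₀)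
    (hy : y₀ ^ (1 - α) = α) : ∃ C : ℝ, 0 ≤ C ∧ ∀ x : ℝ, 0 ≤ x →
    ‖K α (y₀ * (1 / α - 1)) (x + π * I)‖ ≤ C * Real.exp (x / 2) := by
  have hα : 0 < α := by linarith
  have hpi := Real.pi_pos
  obtain ⟨C, hC⟩ := norm_Q_cut hα h1 hy₀ hy
  refine ⟨1 + |C|, by positivity, fun x hx => ?_⟩
  have hX := Real.one_le_exp hx
  have h := hC (Real.exp x) hX
  have hsq : Real.sqrt (Real.exp x) = Real.exp (x / 2) := by rw [Real.exp_half]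
  rw [hsq] at h
  have hc0 : 0 ≤ y₀ * (1 / α - 1) := by
    refine mul_nonneg hy₀.le ?_
    rw [sub_nonneg, le_div_iff₀ hα]; linarith
  set c := y₀ * (1 / α - 1) with hc
  have hX2 : 1 ≤ Real.exp (x / 2) := Real.one_le_exp (by linarith)
  rw [K, norm_mul, norm_exp_mul_exp]
  have him : ((x : ℂ) + π * I).im = π := by
    rw [add_im, im_ofReal_mul, ofReal_im, I_im]; ring
  have hre : ((x : ℂ) + π * I).re = x := by
    rw [add_re, re_ofReal_mul, ofReal_re, I_re]; ring
  have e1 : ‖Q α ((Real.exp x ^ (1 - α) : ℝ) *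
      cexp (((1 - α) * π + -(π * α) : ℝ) * I))‖ ≤ 1 := by
    refine norm_Q_le_one (ofReal_mul_exp_re_nonneg (by positivity) ?_ ?_) <;> nlinarith
  have e2 : ‖Q α ((Real.exp x ^ (1 - α) : ℝ) *
      cexp (((1 - α) * π + π * α : ℝ) * I))‖ ≤ C * Real.exp (x / 2) * Real.exp (c * Real.exp x) := by
    convert h using 3
    have : (1 - α) * π + π * α = π := by ring
    rw [this, Complex.exp_pi_mul_I]; ring
  have hW : ‖W α (x + π * I)‖ ≤ (1 + |C|) * Real.exp (x / 2) * Real.exp (c * Real.exp x) := by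
    rw [W, norm_mul, lam_eq, lam_eq]
    refine (mul_le_of_le_one_left (norm_nonneg _) norm_inv_le_one).trans
      ((norm_sub_le _ _).trans ((add_le_add e1 e2).trans ?_))
    have h3 : 1 ≤ Real.exp (c * Real.exp x) := Real.one_le_exp (by positivity)
    have h4 : 1 ≤ Real.exp (x / 2) * Real.exp (c * Real.exp x) := one_le_mul_of_one_le_of_one_le hX2 h3
    have := mul_le_mul_of_nonneg_right (le_abs_self C) (zero_le_one.trans h4)
    nlinarith
  rw [him, hre, Real.cos_pi, mul_neg_one, mul_neg]
  refine (mul_le_mul_of_nonneg_right hW (Real.exp_pos _).le).trans_eq ?_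
  rw [mul_assoc, ← Real.exp_add]; simp

lemma re_add_im_mul_I (ζ : ℂ) {y : ℝ} (h : ζ.im = y) : ζ = ζ.re + y * I := by
  rw [← h]; exact (Complex.re_add_im ζ).symm

lemma max_le_norm_exp_add_I {ζ : ℂ} (h1 : 0 ≤ ζ.im) (h2 : ζ.im ≤ π) :
    max (Real.exp ζ.re) 1 ≤ ‖cexp ζ + I‖ := by
  have h : ‖cexp ζ + I‖ ^ 2 = Real.exp ζ.re ^ 2 + 2 * (Real.exp ζ.re * Real.sin ζ.im) + 1 := by
    rw [Complex.sq_norm, Complex.normSq_apply]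
    simp only [add_re, add_im, Complex.exp_re, Complex.exp_im, I_re, I_im, add_zero]
    linear_combination Real.exp ζ.re ^ 2 * Real.sin_sq_add_cos_sq ζ.im
  have hs := mul_nonneg (Real.exp_pos ζ.re).le (Real.sin_nonneg_of_nonneg_of_le_pi h1 h2)
  refine max_le ?_ ?_ <;> refine le_of_sq_le_sq ?_ (norm_nonneg _) <;> rw [h] <;>
    nlinarith [Real.exp_pos ζ.re]

/-- Phragmén–Lindelöf in a strip of width `π / 2`. -/
lemma norm_le_of_strip {F : ℂ → ℂ} {a C A B : ℝ} (ha : 0 ≤ a) (ha' : a + π / 2 ≤ π) (hC : 0 ≤ C)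
    (hA : 0 ≤ A) (hB : 0 ≤ B) (hF : Differentiable ℂ F)
    (hcrude : ∀ ζ, ‖F ζ‖ ≤ A * Real.exp (B * Real.exp ζ.re))
    (hleft : ∀ ζ : ℂ, ζ.re ≤ 0 → ‖F ζ‖ ≤ C)
    (hbot : ∀ x : ℝ, 0 ≤ x → ‖F (x + a * I)‖ ≤ C * Real.exp x)
    (htop : ∀ x : ℝ, 0 ≤ x → ‖F (x + (a + π / 2 : ℝ) * I)‖ ≤ C * Real.exp x)
    {ζ : ℂ} (h1 : a ≤ ζ.im) (h2 : ζ.im ≤ a + π / 2) :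
    ‖F ζ‖ ≤ C * ‖cexp ζ + I‖ := by
  have hpi := Real.pi_pos
  have hne : ∀ z : ℂ, a ≤ z.im → z.im ≤ a + π / 2 → 0 < ‖cexp z + I‖ := fun z hz1 hz2 =>
    zero_lt_one.trans_le ((le_max_right _ _).trans
      (max_le_norm_exp_add_I (ha.trans hz1) (hz2.trans ha')))
  have hline : ∀ y : ℝ, a ≤ y → y ≤ a + π / 2 →
      (∀ x : ℝ, 0 ≤ x → ‖F (x + y * I)‖ ≤ C * Real.exp x) →
      ∀ z : ℂ, z.im = y → ‖F z / (cexp z + I)‖ ≤ C := by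
    intro y hy1 hy2 hb z hz
    rw [norm_div, div_le_iff₀ (hne z (hz ▸ hy1) (hz ▸ hy2))]
    have hm := max_le_norm_exp_add_I (ζ := z) (ha.trans (hz ▸ hy1)) ((hz ▸ hy2).trans ha')
    rcases le_total z.re 0 with hx | hx
    · exact (hleft z hx).trans (le_mul_of_one_le_right hC ((le_max_right _ _).trans hm))
    · have := hb z.re hx
      rw [← re_add_im_mul_I z hz] at this
      exact this.trans (mul_le_mul_of_nonneg_left ((le_max_left _ _).trans hm) hC)
  have key := PhragmenLindelof.horizontal_strip (f := fun z => F z / (cexp z + I)) (a := a)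
    (b := a + π / 2) (C := C) (z := ζ) ?_ ?_ (hline a le_rfl (by linarith) hbot)
    (hline (a + π / 2) (by linarith) le_rfl htop) h1 h2
  · rwa [norm_div, div_le_iff₀ (hne ζ h1 h2)] at key
  · refine DifferentiableOn.diffContOnCl fun z hz => ?_
    have hcl : closure (im ⁻¹' Ioo a (a + π / 2)) ⊆ im ⁻¹' Icc a (a + π / 2) :=
      closure_minimal (preimage_mono Ioo_subset_Icc_self) (isClosed_Icc.preimage continuous_im)
    have hz' := hcl hz
    have : cexp z + I ≠ 0 := norm_pos_iff.1 (hne z hz'.1 hz'.2)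
    exact ((hF z).div (by fun_prop) this).differentiableWithinAt
  · refine ⟨1, ?_, B, ?_⟩
    · rw [add_sub_cancel_left]; field_simp; norm_num
    refine Asymptotics.IsBigO.of_bound A ?_
    filter_upwards [mem_inf_of_right (mem_principal_self _)] with z hz
    have hm := (le_max_right (Real.exp z.re) 1).trans
      (max_le_norm_exp_add_I (ζ := z) (ha.trans hz.1.le) (hz.2.le.trans ha'))
    rw [norm_div, Real.norm_of_nonneg (Real.exp_pos _).le]
    refine (div_le_self (norm_nonneg _) hm).trans ((hcrude z).trans ?_)
    refine mul_le_mul_of_nonneg_left (Real.exp_le_exp.2 (mul_le_mul_of_nonneg_left ?_ hB)) hA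
    rw [one_mul]
    exact Real.exp_le_exp.2 (le_abs_self _)

lemma norm_le_of_wide_strip {F : ℂ → ℂ} {C B : ℝ} (hC : 0 ≤ C) (hB : 0 ≤ B)
    (hF : Differentiable ℂ F)
    (hcrude : ∀ ζ : ℂ, |ζ.im| ≤ π → 0 ≤ ζ.re → ‖F ζ‖ ≤ B * Real.exp ζ.re)
    (hleft : ∀ ζ : ℂ, ζ.re ≤ 0 → ‖F ζ‖ ≤ C * Real.exp (ζ.re / 2))
    (hbd : ∀ ζ : ℂ, |ζ.im| = π → 0 ≤ ζ.re → ‖F ζ‖ ≤ C * Real.exp (ζ.re / 2))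
    {ζ : ℂ} (h : |ζ.im| ≤ π) : ‖F ζ‖ ≤ C * Real.exp (ζ.re / 2) := by
  have hpi := Real.pi_pos
  have hn : ∀ z : ℂ, ‖F z * cexp (-(z / 2))‖ = ‖F z‖ * (Real.exp (z.re / 2))⁻¹ := by
    intro z
    rw [norm_mul, Complex.norm_exp, neg_re, Complex.div_ofNat_re, Real.exp_neg]
  have hiff : ∀ (z : ℂ) (D : ℝ), ‖F z * cexp (-(z / 2))‖ ≤ D ↔ ‖F z‖ ≤ D * Real.exp (z.re / 2) := by
    intro z D
    rw [hn, ← div_eq_mul_inv, div_le_iff₀ (Real.exp_pos _)]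
  have hl : ∀ z : ℂ, |z.im| = π → ‖F z * cexp (-(z / 2))‖ ≤ C := by
    intro z hz
    rw [hiff]
    rcases le_total z.re 0 with hx | hx
    · exact hleft z hx
    · exact hbd z hz hx
  rw [← hiff]
  refine PhragmenLindelof.horizontal_strip (f := fun z => F z * cexp (-(z / 2))) (a := -π)
    (b := π) (C := C) (z := ζ) (Differentiable.diffContOnCl (by fun_prop)) ?_
    (fun z hz => hl z (by rw [hz, abs_neg, abs_of_pos hpi]))
    (fun z hz => hl z (by rw [hz, abs_of_pos hpi])) (abs_le.1 h).1 (abs_le.1 h).2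
  refine ⟨1 / 4, ?_, 4, ?_⟩
  · rw [lt_div_iff₀ (by linarith)]; linarith
  refine Asymptotics.IsBigO.of_bound (B + C) ?_
  filter_upwards [mem_inf_of_right (mem_principal_self _)] with z hz
  have hz' : |z.im| ≤ π := abs_le.2 ⟨hz.1.le, hz.2.le⟩
  rw [Real.norm_of_nonneg (Real.exp_pos _).le]
  have h1 : 1 ≤ Real.exp (4 * Real.exp (1 / 4 * |z.re|)) := Real.one_le_exp (by positivity)
  rcases le_total z.re 0 with hx | hx
  · refine ((hiff z C).2 (hleft z hx)).trans ?_
    nlinarith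
  · rw [hn]
    have h2 : (Real.exp (z.re / 2))⁻¹ ≤ 1 := inv_le_one_of_one_le₀ (Real.one_le_exp (by linarith))
    have h3 : Real.exp z.re ≤ Real.exp (4 * Real.exp (1 / 4 * |z.re|)) := by
      rw [Real.exp_le_exp, abs_of_nonneg hx]
      linarith [Real.add_one_le_exp (1 / 4 * z.re)]
    calc ‖F z‖ * (Real.exp (z.re / 2))⁻¹ ≤ ‖F z‖ := mul_le_of_le_one_right (norm_nonneg _) h2
      _ ≤ B * Real.exp z.re := hcrude z hz' hx
      _ ≤ B * Real.exp (4 * Real.exp (1 / 4 * |z.re|)) := mul_le_mul_of_nonneg_left h3 hB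
      _ ≤ _ := mul_le_mul_of_nonneg_right (by linarith) (Real.exp_pos _).le

lemma norm_K_le {α y₀ : ℝ} (h0 : 1 / 3 < α) (h1 : α < 1 / 2) (hy₀ : 0 < y₀)
    (hy : y₀ ^ (1 - α) = α) : ∃ C : ℝ, 0 ≤ C ∧ ∀ ζ : ℂ, |ζ.im| ≤ π →
      ‖K α (y₀ * (1 / α - 1)) ζ‖ ≤ C * Real.exp (ζ.re / 2) ∧
      ‖K α (y₀ * (1 / α - 1)) ζ‖ ≤ C * Real.exp ((1 - α) * ζ.re) := by
  have hα : 0 < α := by linarith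
  have hα1 : α < 1 := by linarith
  have hpi := Real.pi_pos
  obtain ⟨C₁, hC₁, b₁⟩ := norm_K_axis h0 h1 hy₀ hy
  obtain ⟨C₂, hC₂, b₂⟩ := norm_K_middle h0 h1 (y₀ * (1 / α - 1))
  obtain ⟨C₃, hC₃, b₃⟩ := norm_K_cut h0 h1 hy₀ hy
  have hc0 : 0 ≤ y₀ * (1 / α - 1) := by
    refine mul_nonneg hy₀.le ?_
    rw [sub_nonneg, le_div_iff₀ hα]; linarith
  set c := y₀ * (1 / α - 1) with hc
  obtain ⟨C₄, hC₄, b₄⟩ := norm_K_le_left hα hα1 hc0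
  have bc := norm_K_le_crude hα hα1 hc0
  have hK := differentiable_K hα hα1 c
  set D := C₁ + C₂ + C₃ + C₄ with hD
  have hD0 : 0 ≤ D := by positivity
  have hleft : ∀ ζ : ℂ, ζ.re ≤ 0 → ‖K α c ζ‖ ≤ D := fun ζ hζ =>
    (b₄ ζ hζ).trans ((mul_le_of_le_one_right hC₄ (Real.exp_le_one_iff.2 (by nlinarith))).trans
      (by linarith))
  have hbd : ∀ {c' : ℝ} {x y : ℝ}, c' ≤ D → y ≤ x → c' * Real.exp y ≤ D * Real.exp x :=
    fun h h' => (mul_le_mul_of_nonneg_right h (Real.exp_pos _).le).trans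
      (mul_le_mul_of_nonneg_left (Real.exp_le_exp.2 h') hD0)
  have hup : ∀ ζ : ℂ, 0 ≤ ζ.im → ζ.im ≤ π → ‖K α c ζ‖ ≤ D * ‖cexp ζ + I‖ := by
    intro ζ hζ1 hζ2
    rcases le_total ζ.im (π / 2) with hy2 | hy2
    · refine norm_le_of_strip (a := 0) le_rfl (by linarith) hD0 (by
        have : 0 < 1 - α := by linarith
        positivity) (by linarith) hK bc hleft (fun x hx => ?_) (fun x hx => ?_) hζ1 (by linarith)
      · simpa using (b₁ x hx).trans (hbd (by linarith) le_rfl)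
      · simpa using (b₂ x hx).trans (hbd (by linarith) le_rfl)
    · refine norm_le_of_strip (a := π / 2) (by linarith) (by linarith) hD0 (by
        have : 0 < 1 - α := by linarith
        positivity) (by linarith) hK bc hleft (fun x hx => ?_) (fun x hx => ?_) hy2 (by linarith)
      · exact (b₂ x hx).trans (hbd (by linarith) le_rfl)
      · rw [add_halves]
        exact (b₃ x hx).trans (hbd (by linarith) (by linarith))
  have hup' : ∀ ζ : ℂ, 0 ≤ ζ.im → ζ.im ≤ π → 0 ≤ ζ.re → ‖K α c ζ‖ ≤ 2 * D * Real.exp ζ.re := by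
    intro ζ hζ1 hζ2 hx
    have h3 : ‖cexp ζ + I‖ ≤ 2 * Real.exp ζ.re := by
      refine (norm_add_le _ _).trans ?_
      rw [Complex.norm_exp, norm_I]
      linarith [Real.one_le_exp hx]
    refine (hup ζ hζ1 hζ2).trans ((mul_le_mul_of_nonneg_left h3 hD0).trans_eq (by ring))
  have hfull : ∀ ζ : ℂ, |ζ.im| ≤ π → 0 ≤ ζ.re → ‖K α c ζ‖ ≤ 2 * D * Real.exp ζ.re := by
    intro ζ hζ hx
    rcases le_total 0 ζ.im with h | h
    · exact hup' ζ h (le_of_abs_le hζ) hx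
    · have := hup' (conj ζ) (by rw [conj_im]; linarith)
        (by rw [conj_im]; linarith [(abs_le.1 hζ).1]) (by rwa [conj_re])
      rwa [K_conj, norm_conj, conj_re] at this
  have hmain : ∀ ζ : ℂ, |ζ.im| ≤ π → ‖K α c ζ‖ ≤ D * Real.exp (ζ.re / 2) := by
    intro ζ hζ
    refine norm_le_of_wide_strip hD0 (by linarith : 0 ≤ 2 * D) hK hfull (fun z hz => ?_)
      (fun z hz hx => ?_) hζ
    · exact (b₄ z hz).trans (hbd (by linarith) (by nlinarith))
    · rcases abs_choice z.im with h | h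
      · have := b₃ z.re hx
        rw [← re_add_im_mul_I z (h ▸ hz)] at this
        exact this.trans (hbd (by linarith) le_rfl)
      · have := b₃ z.re hx
        have e := re_add_im_mul_I (conj z) (y := π) (by rw [conj_im, ← h, hz])
        rw [conj_re] at e
        rw [← e, K_conj, norm_conj] at this
        exact this.trans (hbd (by linarith) le_rfl)
  refine ⟨D, hD0, fun ζ hζ => ⟨hmain ζ hζ, ?_⟩⟩
  rcases le_total ζ.re 0 with hx | hx
  · exact (b₄ ζ hx).trans (hbd (by linarith) le_rfl)
  · exact (hmain ζ hζ).trans (hbd le_rfl (by nlinarith))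

/-- A function of `p` all of whose symmetric products `γ (m + p) γ (m - p)` are completely
monotone in `2 cosh p`. -/
def LHCM (γ : ℝ → ℝ) : Prop := ∀ m : ℝ, DCM (Ici 2) (fun w => γ (m + pOf w) * γ (m - pOf w))

theorem lhcm_gam_base {α : ℝ} (h0 : 1 / 3 < α) (h1 : α < 1 / 2) : LHCM (gam α) := by
  intro m
  have hα : 0 < α := by linarith
  have hα1 : α < 1 := by linarith
  have hα1' : 0 < 1 - α := by linarith
  have hpi := Real.pi_pos
  obtain ⟨y₀, hy₀, hy⟩ : ∃ y₀ : ℝ, 0 < y₀ ∧ y₀ ^ (1 - α) = α :=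
    ⟨α ^ (1 - α)⁻¹, by positivity, Real.rpow_inv_rpow hα.le hα1'.ne'⟩
  obtain ⟨C, hC, hK⟩ := norm_K_le h0 h1 hy₀ hy
  have hc0 : 0 ≤ y₀ * (1 / α - 1) := by
    refine mul_nonneg hy₀.le ?_
    rw [sub_nonneg, le_div_iff₀ hα]; linarith
  set c := y₀ * (1 / α - 1) with hc
  set q := α / (1 - α) with hq
  have hq0 : 0 < q := by positivity
  have hq1 : q < 1 := by rw [hq, div_lt_one hα1']; linarith
  set M : ℝ := -(q * m) with hM
  set f : ℂ → ℂ := fun ζ => K α c (M + ζ) * K α c (M - ζ) with hf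
  have hstrip : StripFun f (C * C * Real.exp (M / 2 + (1 - α) * M)) (1 / 2 - α) := by
    refine ⟨by linarith, by linarith, fun ζ _ => ?_, fun ζ hζ => ?_⟩
    · have := differentiable_K hα hα1 c
      exact (by fun_prop : Differentiable ℂ f) ζ
    · have k1 := (hK (M + ζ) (by simpa using hζ)).1
      have k2 := (hK (M - ζ) (by simpa using hζ)).2
      rw [hf, norm_mul]
      refine (mul_le_mul k1 k2 (norm_nonneg _) (by positivity)).trans_eq ?_
      rw [add_re, sub_re, ofReal_re, mul_mul_mul_comm, ← Real.exp_add, mul_assoc (C * C),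
        ← Real.exp_add]
      congr 2; ring
  have hsym : ∀ ζ, f (conj ζ) = conj (f ζ) := by
    intro ζ
    simp only [hf]
    rw [map_mul, ← K_conj, ← K_conj, map_add, map_sub, conj_ofReal]
  have heven : ∀ ζ, f (-ζ) = f ζ := by
    intro ζ
    simp only [hf]
    rw [sub_neg_eq_add, ← sub_eq_add_neg, mul_comm]
  have hKpi : ∀ ξ : ℝ, K α c (ξ + π * I) = (I / (2 * π)) *
      ((Dg α (π * (1 - 2 * α) / α) (Real.exp ((1 - α) * ξ)) : ℝ) +
       (Ng α (π * (1 - 2 * α) / α) (Real.exp ((1 - α) * ξ)) : ℝ) * I) *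
       (Real.exp (-(c * Real.exp ξ)) : ℝ) := by
    intro ξ
    rw [K, W_add_pi hα]
    congr 1
    rw [Complex.exp_add, Complex.exp_pi_mul_I]
    push_cast; congr 1; ring
  have him : ∀ x : ℝ, 0 ≤ x → (f (x + (π : ℝ) * I)).im ≤ 0 := by
    intro x hx
    have e : f (x + (π : ℝ) * I) = K α c ((M + x : ℝ) + π * I) *
        conj (K α c ((M - x : ℝ) + π * I)) := by
      simp only [hf]
      rw [← K_conj]
      congr 2
      · push_cast; ring
      · rw [map_add, map_mul, conj_ofReal, conj_ofReal, conj_I]; push_cast; ring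
    rw [e, hKpi, hKpi]
    have hθ0 : 0 < π * (1 - 2 * α) / α := by
      have : 0 < 1 - 2 * α := by linarith
      positivity
    have hθ1 : π * (1 - 2 * α) / α < π := by rw [div_lt_iff₀ hα]; nlinarith
    have h12 : Real.exp ((1 - α) * (M - x)) ≤ Real.exp ((1 - α) * (M + x)) :=
      Real.exp_le_exp.2 (by nlinarith)
    have h := Ng_mul_Dg_le hα h1 hθ0 hθ1 (Real.exp_pos _) h12
    set D₁ := Dg α (π * (1 - 2 * α) / α) (Real.exp ((1 - α) * (M - x)))
    set D₂ := Dg α (π * (1 - 2 * α) / α) (Real.exp ((1 - α) * (M + x)))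
    set N₁ := Ng α (π * (1 - 2 * α) / α) (Real.exp ((1 - α) * (M - x)))
    set N₂ := Ng α (π * (1 - 2 * α) / α) (Real.exp ((1 - α) * (M + x)))
    set e₁ := Real.exp (-(c * Real.exp (M - x)))
    set e₂ := Real.exp (-(c * Real.exp (M + x)))
    have e' : I / (2 * π) * (D₂ + N₂ * I) * e₂ * conj (I / (2 * π) * (D₁ + N₁ * I) * e₁ : ℂ) =
        ((1 / (4 * π ^ 2) * e₁ * e₂ : ℝ) : ℂ) *
          ((D₂ * D₁ + N₂ * N₁ : ℝ) + (N₂ * D₁ - N₁ * D₂ : ℝ) * I) := by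
      have hpi' : (π : ℂ) ≠ 0 := by exact_mod_cast hpi.ne'
      simp only [map_mul, map_add, map_div₀, conj_I, conj_ofReal, map_ofNat (starRingEnd ℂ)]
      push_cast
      field_simp
      ring_nf
      simp only [I_sq, I_pow_three, I_pow_four]
      ring
    rw [e', im_ofReal_mul]
    refine mul_nonpos_of_nonneg_of_nonpos (by positivity) ?_
    rw [add_im, im_ofReal_mul, ofReal_im, I_im]
    linarith
  have hd := hstrip.dcm_even hsym heven him (b := fun w => q * pOf w)
    (fun X hX => dcm_inv_add_cosh hX hq0 hq1)
  have hS : IsUpperSet (Ici (2:ℝ)) := isUpperSet_Ici 2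
  refine ((dcm_exp_neg_cosh (a := c * Real.exp M) (by positivity) hq0 hq1).mul hS hd).congr hS
    fun w _ => ?_
  have hK' : ∀ ξ : ℝ, K α c ξ = W α ξ * (Real.exp (c * Real.exp ξ) : ℝ) := by
    intro ξ; rw [K]; push_cast; rfl
  have g1 : W α ((M - q * pOf w : ℝ) : ℂ) = gam α (m + pOf w) := by
    rw [gam_eq_W hα1]; congr 2; rw [hM]; ring
  have g2 : W α ((M + q * pOf w : ℝ) : ℂ) = gam α (m - pOf w) := by
    rw [gam_eq_W hα1]; congr 2; rw [hM]; ring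
  have e : f ((q * pOf w : ℝ)) = ((gam α (m + pOf w) * gam α (m - pOf w) *
      (Real.exp (c * Real.exp (M + q * pOf w)) * Real.exp (c * Real.exp (M - q * pOf w))) : ℝ) : ℂ) := by
    simp only [hf]
    rw [← ofReal_add, ← ofReal_sub, hK', hK', g1, g2]
    push_cast; ring
  rw [e, ofReal_re, ← Real.exp_add, Real.cosh_eq, sub_eq_add_neg M, Real.exp_add M,
    Real.exp_add M, mul_comm (gam α (m + pOf w) * gam α (m - pOf w)), ← mul_assoc, ← Real.exp_add]
  rw [show -(c * Real.exp M * (2 * ((Real.exp (q * pOf w) + Real.exp (-(q * pOf w))) / 2))) +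
    (c * (Real.exp M * Real.exp (q * pOf w)) + c * (Real.exp M * Real.exp (-(q * pOf w)))) = 0 by ring,
    Real.exp_zero, one_mul]

/-! ### Approximation of completely monotone functions by exponential sums -/

/-- The `n`-fold alternating difference of `f` with step `h`. -/
noncomputable def stepDiff (f : ℝ → ℝ) (h : ℝ) (n : ℕ) (x : ℝ) : ℝ :=
  iterDiff (List.replicate n h) f x

lemma stepDiff_succ_add (f : ℝ → ℝ) (h : ℝ) (n : ℕ) (x : ℝ) :
    stepDiff f h (n + 1) x + stepDiff f h n (x + h) = stepDiff f h n x := by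
  rw [stepDiff, List.replicate_succ, iterDiff_cons, stepDiff, stepDiff]; ring

lemma sum_choose_mul_stepDiff (f : ℝ → ℝ) (h : ℝ) (m : ℕ) (x : ℝ) :
    ∑ i ∈ Finset.range (m + 1), (m.choose i : ℝ) * stepDiff f h (m - i) (x + i * h) = f x := by
  rw [← Finset.Nat.sum_antidiagonal_eq_sum_range_succ
    (fun i j => (m.choose i : ℝ) * stepDiff f h j (x + i * h))]
  induction m with
  | zero => simp [stepDiff, iterDiff]
  | succ m ih =>
    rw [Finset.sum_antidiagonal_choose_succ_mul (fun i j => stepDiff f h j (x + i * h)),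
      ← Finset.sum_add_distrib, ← ih]
    refine Finset.sum_congr rfl fun ij hij => ?_
    rw [Finset.HasAntidiagonal.mem_antidiagonal] at hij
    rw [Nat.choose_symm_of_eq_add (by omega : m = ij.2 + ij.1), ← mul_add]
    congr 1
    rw [← stepDiff_succ_add f h ij.2 (x + ij.1 * h)]
    push_cast; ring_nf

lemma sum_choose_mul_ratio (f : ℝ → ℝ) (h : ℝ) {n j : ℕ} (hj : j ≤ n) :
    ∑ k ∈ Finset.range (n + 1), (n.choose k : ℝ) * stepDiff f h (n - k) (k * h) *
      ((k.choose j : ℝ) / n.choose j) = f (j * h) := by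
  obtain ⟨m, rfl⟩ := Nat.exists_eq_add_of_le hj
  have hc : ((j + m).choose j : ℝ) ≠ 0 := by
    exact_mod_cast (Nat.choose_pos hj).ne'
  rw [add_assoc, Finset.sum_range_add, Finset.sum_eq_zero, zero_add,
    ← sum_choose_mul_stepDiff f h m (j * h)]
  · refine Finset.sum_congr rfl fun i _ => ?_
    have h1 := Nat.choose_mul (n := j + m) (k := j + i) (s := j) (by omega)
    rw [Nat.add_sub_cancel_left, Nat.add_sub_cancel_left] at h1
    have h2 : ((j + m).choose (j + i) : ℝ) * (j + i).choose j = (j + m).choose j * m.choose i := by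
      exact_mod_cast h1
    rw [Nat.add_sub_add_left, mul_right_comm, mul_div_assoc', h2, mul_div_cancel_left₀ _ hc]
    push_cast; ring_nf
  · intro k hk
    rw [Nat.choose_eq_zero_of_lt (Finset.mem_range.1 hk)]; simp

lemma abs_choose_ratio_sub_pow_le {n k : ℕ} (hk : k ≤ n) {J : ℕ} (hJ : J < n) {j : ℕ}
    (hj : j ≤ J) : 0 ≤ (k.choose j : ℝ) / n.choose j ∧ (k.choose j : ℝ) / n.choose j ≤ 1 ∧
    |(k.choose j : ℝ) / n.choose j - (k / n : ℝ) ^ j| ≤ j * (J / (n - J : ℝ)) := by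
  have hnJ : (0:ℝ) < n - J := by
    have : (J:ℝ) < n := by exact_mod_cast hJ
    linarith
  have hn : (0:ℝ) < n := by exact_mod_cast (by omega : 0 < n)
  have hx0 : (0:ℝ) ≤ k / n := by positivity
  have hx1 : (k / n : ℝ) ≤ 1 := by rw [div_le_one hn]; exact_mod_cast hk
  induction j with
  | zero => simp
  | succ j ih =>
    obtain ⟨a0, a1, a2⟩ := ih (by omega)
    have hjn : j < n := by omega
    have hden : (0:ℝ) < n - j := by
      have : (j:ℝ) < n := by exact_mod_cast hjn
      linarith
    have e : (k.choose (j + 1) : ℝ) / n.choose (j + 1) =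
        (k.choose j : ℝ) / n.choose j * (((k - j : ℕ) : ℝ) / (n - j)) := by
      have h1 : (k.choose (j + 1) : ℝ) * (j + 1) = k.choose j * ((k - j : ℕ) : ℝ) := by
        exact_mod_cast Nat.choose_succ_right_eq k j
      have h2 : (n.choose (j + 1) : ℝ) * (j + 1) = n.choose j * (n - j) := by
        rw [← Nat.cast_sub hjn.le]
        exact_mod_cast Nat.choose_succ_right_eq n j
      have p1 : (0:ℝ) < n.choose j := by exact_mod_cast Nat.choose_pos hjn.le
      have p2 : (0:ℝ) < n.choose (j + 1) := by exact_mod_cast Nat.choose_pos (by omega)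
      rw [div_mul_div_comm, div_eq_div_iff p2.ne' (by positivity), ← h1, ← h2]; ring
    set s := ((k - j : ℕ) : ℝ) / (n - j) with hs
    have s0 : 0 ≤ s := by positivity
    have s1 : s ≤ 1 := by
      rw [hs, div_le_one hden, ← Nat.cast_sub hjn.le]; exact_mod_cast Nat.sub_le_sub_right hk j
    have hsx : |s - k / n| ≤ J / (n - J : ℝ) := by
      have hjJ : (j:ℝ) ≤ J := by exact_mod_cast (by omega : j ≤ J)
      have hb : (j:ℝ) / (n - j) ≤ J / (n - J) := div_le_div₀ (by positivity) hjJ hnJ (by linarith)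
      refine le_trans ?_ hb
      rcases le_or_gt j k with hjk | hjk
      · have hkn : (k:ℝ) ≤ n := by exact_mod_cast hk
        have : s - k / n = -(j * (n - k) / (n * (n - j))) := by
          rw [hs, Nat.cast_sub hjk]; field_simp; ring
        have hj0 : (0:ℝ) ≤ j := by positivity
        rw [this, abs_neg, abs_of_nonneg (by
          have : (0:ℝ) ≤ n - k := by linarith
          positivity), div_le_div_iff₀ (by positivity) hden]
        have h3 : (j:ℝ) * (n - k) ≤ j * n := mul_le_mul_of_nonneg_left (by linarith [(Nat.cast_nonneg k : (0:ℝ) ≤ k)]) hj0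
        nlinarith
      · have : s = 0 := by rw [hs, Nat.sub_eq_zero_of_le hjk.le]; simp
        rw [this, zero_sub, abs_neg, abs_of_nonneg hx0]
        have hkj : (k:ℝ) ≤ j := by exact_mod_cast hjk.le
        have hj0 : (0:ℝ) ≤ j := by positivity
        exact div_le_div₀ hj0 hkj hden (by linarith)
    rw [e]
    refine ⟨mul_nonneg a0 s0, mul_le_one₀ a1 s0 s1, ?_⟩
    have e2 : (k.choose j : ℝ) / n.choose j * s - (k / n : ℝ) ^ (j + 1) =
        ((k.choose j : ℝ) / n.choose j) * (s - k / n) +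
        ((k.choose j : ℝ) / n.choose j - (k / n : ℝ) ^ j) * (k / n) := by
      rw [pow_succ]; ring
    rw [e2]
    refine (abs_add_le _ _).trans ?_
    rw [abs_mul, abs_mul, abs_of_nonneg a0, abs_of_nonneg hx0]
    push_cast
    have b1 := mul_le_mul a1 hsx (abs_nonneg _) zero_le_one
    have b2 := mul_le_mul a2 hx1 hx0 ((abs_nonneg _).trans a2)
    linarith

lemma stepDiff_nonneg {f : ℝ → ℝ} (hf : DCM (Ici 0) f) {h : ℝ} (hh : 0 < h) (n : ℕ) {x : ℝ}
    (hx : 0 ≤ x) : 0 ≤ stepDiff f h n x :=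
  hf _ (fun _ hb => by rw [List.eq_of_mem_replicate hb]; exact hh) x hx

lemma exists_moment_approx {f : ℝ → ℝ} (hf : DCM (Ici 0) f) {h : ℝ} (hh : 0 < h) (J : ℕ) {ε : ℝ}
    (hε : 0 < ε) : ∃ n : ℕ, 0 < n ∧ ∀ j ≤ J,
      |∑ k ∈ Finset.range (n + 1), (n.choose k : ℝ) * stepDiff f h (n - k) (k * h) * (k / n : ℝ) ^ j -
        f (j * h)| ≤ ε := by
  have hlim : Tendsto (fun n : ℕ => f 0 * (J * (J / (n - J : ℝ)))) atTop (𝓝 0) := by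
    have h1 : Tendsto (fun n : ℕ => (n - J : ℝ)) atTop atTop :=
      tendsto_atTop_add_const_right _ _ tendsto_natCast_atTop_atTop
    have h2 := ((h1.const_div_atTop (J:ℝ)).const_mul (J:ℝ)).const_mul (f 0)
    simpa using h2
  obtain ⟨n, hn1, hn2⟩ := ((hlim.eventually_le_const hε).and (eventually_gt_atTop J)).exists
  refine ⟨n, by omega, fun j hj => ?_⟩
  have hJ : (0:ℝ) ≤ J / (n - J : ℝ) := by
    have : (J:ℝ) < n := by exact_mod_cast hn2
    exact div_nonneg (by positivity) (by linarith)
  rw [← sum_choose_mul_ratio f h (n := n) (j := j) (by omega), ← Finset.sum_sub_distrib]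
  have h0 := sum_choose_mul_stepDiff f h n 0
  simp only [zero_add] at h0
  refine le_trans ?_ hn1
  rw [← h0, Finset.sum_mul]
  refine (Finset.abs_sum_le_sum_abs _ _).trans (Finset.sum_le_sum fun k hk => ?_)
  have hk' : k ≤ n := by simpa [Nat.lt_succ_iff] using hk
  have hr := (abs_choose_ratio_sub_pow_le hk' hn2 hj).2.2
  have hc : 0 ≤ (n.choose k : ℝ) * stepDiff f h (n - k) (k * h) :=
    mul_nonneg (by positivity) (stepDiff_nonneg hf hh _ (by positivity))
  rw [← mul_sub, abs_mul, abs_of_nonneg hc, abs_sub_comm]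
  refine mul_le_mul_of_nonneg_left (hr.trans ?_) hc
  exact mul_le_mul_of_nonneg_right (by exact_mod_cast hj) hJ

/-- A finite combination of decaying exponentials with nonnegative coefficients. -/
structure ExpSum where
  n : ℕ
  c : ℕ → ℝ
  a : ℕ → ℝ
  c_nonneg : ∀ k, 0 ≤ c k
  a_nonneg : ∀ k, 0 ≤ a k

/-- The value of an exponential sum. -/
noncomputable def ExpSum.eval (g : ExpSum) (w : ℝ) : ℝ :=
  ∑ k ∈ Finset.range g.n, g.c k * Real.exp (-(g.a k * w))

lemma ExpSum.eval_anti (g : ExpSum) {w w' : ℝ} (h : w ≤ w') : g.eval w' ≤ g.eval w :=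
  Finset.sum_le_sum fun k _ => mul_le_mul_of_nonneg_left
    (Real.exp_le_exp.2 (neg_le_neg (mul_le_mul_of_nonneg_left h (g.a_nonneg k)))) (g.c_nonneg k)

lemma ExpSum.eval_nonneg (g : ExpSum) (w : ℝ) : 0 ≤ g.eval w :=
  Finset.sum_nonneg fun k _ => mul_nonneg (g.c_nonneg k) (Real.exp_pos _).le

lemma ExpSum.continuous_eval (g : ExpSum) : Continuous g.eval := by
  unfold ExpSum.eval; fun_prop

lemma exists_expSum_grid {f : ℝ → ℝ} (hf : DCM (Ici 0) f) {h : ℝ} (hh : 0 < h) (J : ℕ) {ε : ℝ}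
    (hε : 0 < ε) : ∃ g : ExpSum, g.eval 0 ≤ f 0 ∧
      ∀ j, 1 ≤ j → j ≤ J → |g.eval (j * h) - f (j * h)| ≤ ε := by
  obtain ⟨n, hn, happ⟩ := exists_moment_approx hf hh J hε
  have hc : ∀ k, 0 ≤ (n.choose k : ℝ) * stepDiff f h (n - k) (k * h) := fun k =>
    mul_nonneg (by positivity) (stepDiff_nonneg hf hh _ (by positivity))
  refine ⟨⟨n, fun k => (n.choose (k + 1) : ℝ) * stepDiff f h (n - (k + 1)) ((k + 1 : ℕ) * h),
    fun k => |Real.log ((k + 1 : ℕ) / n : ℝ)| / h, fun k => hc (k + 1), fun k => by positivity⟩, ?_,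
    fun j hj1 hj2 => ?_⟩
  · have h0 := sum_choose_mul_stepDiff f h n 0
    simp only [zero_add] at h0
    rw [Finset.sum_range_succ'] at h0
    simp only [ExpSum.eval, mul_zero, neg_zero, Real.exp_zero, mul_one]
    rw [← h0]
    have := hc 0
    linarith
  · have h1 := happ j hj2
    rw [Finset.sum_range_succ', Nat.cast_zero, zero_div, zero_pow (by omega), mul_zero, add_zero] at h1
    convert h1 using 3
    simp only [ExpSum.eval]
    refine Finset.sum_congr rfl fun k hk => ?_
    have hk' : k + 1 ≤ n := Finset.mem_range.1 hk
    have hn' : (0:ℝ) < n := by exact_mod_cast hn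
    have hp : (0:ℝ) < (k + 1 : ℕ) / n := by positivity
    have hle : ((k + 1 : ℕ) / n : ℝ) ≤ 1 := by rw [div_le_one hn']; exact_mod_cast hk'
    congr 1
    rw [abs_of_nonpos (Real.log_nonpos hp.le hle), ← Real.rpow_natCast, Real.rpow_def_of_pos hp]
    congr 1; field_simp

lemma exists_expSum_tendsto_zero {f : ℝ → ℝ} (hf : DCM (Ici 0) f) (hc : ContinuousOn f (Ioi 0)) :
    ∃ g : ℕ → ExpSum, (∀ N, (g N).eval 0 ≤ f 0) ∧
      ∀ x, 0 < x → Tendsto (fun N => (g N).eval x) atTop (𝓝 (f x)) := by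
  have hex : ∀ N : ℕ, ∃ g : ExpSum, g.eval 0 ≤ f 0 ∧ ∀ j, 1 ≤ j → j ≤ (N + 1) ^ 2 →
      |g.eval (j * (1 / (N + 1 : ℝ))) - f (j * (1 / (N + 1 : ℝ)))| ≤ 1 / (N + 1 : ℝ) := fun N =>
    exists_expSum_grid hf (by positivity) _ (by positivity)
  choose g hg0 hg using hex
  refine ⟨g, hg0, fun x hx => ?_⟩
  have hε : Tendsto (fun N : ℕ => 1 / (N + 1 : ℝ)) atTop (𝓝 0) := tendsto_one_div_add_atTop_nhds_zero_nat
  set j : ℕ → ℕ := fun N => ⌊x * (N + 1)⌋₊ with hj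
  have hj1 : ∀ N, (j N : ℝ) * (1 / (N + 1 : ℝ)) ≤ x := by
    intro N
    have : (j N : ℝ) ≤ x * (N + 1) := Nat.floor_le (by positivity)
    rw [mul_one_div, div_le_iff₀ (by positivity)]; exact this
  have hj2 : ∀ N, x ≤ ((j N + 1 : ℕ) : ℝ) * (1 / (N + 1 : ℝ)) := by
    intro N
    have : x * (N + 1) < j N + 1 := Nat.lt_floor_add_one _
    rw [mul_one_div, le_div_iff₀ (by positivity)]; push_cast; exact this.le
  have l1 : Tendsto (fun N => (j N : ℝ) * (1 / (N + 1 : ℝ))) atTop (𝓝 x) := by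
    refine tendsto_of_tendsto_of_tendsto_of_le_of_le (g := fun N : ℕ => x - 1 / (N + 1 : ℝ))
      (h := fun _ => x) ?_ tendsto_const_nhds (fun N => ?_) hj1
    · simpa using hε.const_sub x
    · have := hj2 N
      push_cast at this
      simp only
      linarith
  have l2 : Tendsto (fun N => ((j N + 1 : ℕ) : ℝ) * (1 / (N + 1 : ℝ))) atTop (𝓝 x) := by
    have := l1.add hε
    rw [add_zero] at this
    refine this.congr fun N => ?_
    push_cast; ring
  have hcx : ContinuousAt f x := hc.continuousAt (Ioi_mem_nhds hx)
  have hbig : ∀ᶠ N : ℕ in atTop, 1 ≤ j N ∧ j N + 1 ≤ (N + 1) ^ 2 := by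
    have e1 : ∀ᶠ N : ℕ in atTop, 1 / x ≤ N :=
      tendsto_natCast_atTop_atTop.eventually_ge_atTop _
    have e2 : ∀ᶠ N : ℕ in atTop, x + 1 ≤ N :=
      tendsto_natCast_atTop_atTop.eventually_ge_atTop _
    filter_upwards [e1, e2] with N h1 h2
    constructor
    · refine Nat.le_floor ?_
      rw [div_le_iff₀ hx] at h1
      push_cast; nlinarith
    · have : (j N : ℝ) ≤ x * (N + 1) := Nat.floor_le (by positivity)
      have h3 : (j N : ℝ) + 1 ≤ (N + 1) ^ 2 := by nlinarith
      exact_mod_cast h3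
  refine tendsto_of_tendsto_of_tendsto_of_le_of_le'
    (g := fun N : ℕ => f (((j N + 1 : ℕ) : ℝ) * (1 / (N + 1 : ℝ))) - 1 / (N + 1 : ℝ))
    (h := fun N : ℕ => f ((j N : ℝ) * (1 / (N + 1 : ℝ))) + 1 / (N + 1 : ℝ)) ?_ ?_ ?_ ?_
  · simpa using (hcx.tendsto.comp l2).sub hε
  · simpa using (hcx.tendsto.comp l1).add hε
  · filter_upwards [hbig] with N hN
    have := (abs_le.1 (hg N (j N + 1) (by omega) hN.2)).1
    have h2 := (g N).eval_anti (hj2 N)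
    linarith
  · filter_upwards [hbig] with N hN
    have := (abs_le.1 (hg N (j N) hN.1 (by omega))).2
    have h2 := (g N).eval_anti (hj1 N)
    linarith

theorem exists_expSum_tendsto {φ : ℝ → ℝ} (hφ : DCM (Ici 2) φ) (hc : ContinuousOn φ (Ioi 2)) :
    ∃ g : ℕ → ExpSum, (∀ N w, 2 ≤ w → (g N).eval w ≤ φ 2) ∧
      ∀ w, 2 < w → Tendsto (fun N => (g N).eval w) atTop (𝓝 (φ w)) := by
  have hf : DCM (Ici 0) (fun x => φ (x + 2)) := by
    intro l hl w hw
    rw [iterDiff_comp_add]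
    exact hφ l hl _ (by simpa using hw)
  obtain ⟨g, hg0, hg⟩ := exists_expSum_tendsto_zero hf (hc.comp (by fun_prop) fun x hx => by
    simpa using hx)
  let G : ℕ → ExpSum := fun N => ⟨(g N).n, fun k => (g N).c k * Real.exp ((g N).a k * 2), (g N).a,
    fun k => mul_nonneg ((g N).c_nonneg k) (Real.exp_pos _).le, (g N).a_nonneg⟩
  have hG : ∀ N w, (G N).eval w = (g N).eval (w - 2) := by
    intro N w
    simp only [ExpSum.eval, G]
    refine Finset.sum_congr rfl fun k _ => ?_
    rw [mul_assoc, ← Real.exp_add]; ring_nf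
  refine ⟨G, fun N w hw => ?_, fun w hw => ?_⟩
  · rw [hG]
    refine ((g N).eval_anti (sub_nonneg.2 hw)).trans ((hg0 N).trans_eq ?_)
    simp
  · simp only [hG]
    simpa using hg (w - 2) (by linarith)

lemma DCM.sum {S : Set ℝ} {ι : Type*} (s : Finset ι) {f : ι → ℝ → ℝ} (hf : ∀ i ∈ s, DCM S (f i)) :
    DCM S (fun w => ∑ i ∈ s, f i w) := by
  classical
  induction s using Finset.induction_on with
  | empty => simpa using DCM.const (S := S) le_rfl
  | insert i s hi ih =>
    simp only [Finset.sum_insert hi]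
    exact (hf i (by simp)).add (ih fun j hj => hf j (by simp [hj]))

lemma DCM.of_Ioi {f : ℝ → ℝ} {a : ℝ} (hf : DCM (Ioi a) f) (hc : ContinuousOn f (Ici a)) :
    DCM (Ici a) f := by
  refine DCM.of_tendsto (u := atTop) (F := fun (i : ℕ) w => f (w + 1 / ((i : ℝ) + 1)))
    (isUpperSet_Ici a) (Eventually.of_forall fun i l hl w hw => ?_) fun w hw => ?_
  · rw [iterDiff_comp_add]
    refine hf l hl _ ?_
    have : 0 < 1 / ((i : ℝ) + 1) := by positivity
    have h2 : a ≤ w := hw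
    simp only [mem_Ioi]; linarith
  · refine ((hc w hw).tendsto).comp (tendsto_nhdsWithin_iff.2 ⟨?_, Eventually.of_forall fun i => ?_⟩)
    · simpa using tendsto_const_nhds.add (tendsto_one_div_add_atTop_nhds_zero_nat (𝕜 := ℝ))
    · have : 0 < 1 / ((i : ℝ) + 1) := by positivity
      have h2 : a ≤ w := hw
      simp only [mem_Ici]; linarith

lemma continuousOn_pOf : ContinuousOn pOf (Ici 2) :=
  Real.continuousOn_arcosh.comp (by fun_prop) fun w hw => by
    have : (2:ℝ) ≤ w := hw
    simp only [mem_Ici]; linarith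

lemma pOf_pos {w : ℝ} (hw : 2 < w) : 0 < pOf w := Real.arcosh_pos (by linarith)

lemma pOf_two_cosh_abs (x : ℝ) : pOf (2 * Real.cosh x) = |x| := by
  rw [← Real.cosh_abs, pOf_two_cosh (abs_nonneg x)]

lemma symm_prod_pOf (γ : ℝ → ℝ) (m x : ℝ) :
    γ (m + pOf (2 * Real.cosh x)) * γ (m - pOf (2 * Real.cosh x)) = γ (m + x) * γ (m - x) := by
  rw [pOf_two_cosh_abs]
  rcases abs_cases x with ⟨h, -⟩ | ⟨h, -⟩ <;> rw [h]
  rw [mul_comm]; ring_nf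

lemma continuousOn_symm_prod {γ : ℝ → ℝ} (hγ : Continuous γ) (m : ℝ) :
    ContinuousOn (fun w => γ (m + pOf w) * γ (m - pOf w)) (Ici 2) :=
  (hγ.comp_continuousOn (continuousOn_const.add continuousOn_pOf)).mul
    (hγ.comp_continuousOn (continuousOn_const.sub continuousOn_pOf))

lemma two_lt_two_cosh {x : ℝ} (hx : x ≠ 0) : 2 < 2 * Real.cosh x := by
  linarith [Real.one_lt_cosh.2 hx]

lemma LHCM.dilate {γ : ℝ → ℝ} (h : LHCM γ) (hγ : Continuous γ) {q : ℝ} (h0 : 0 < q) (h1 : q < 1) :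
    LHCM (fun p => γ (q * p)) := by
  intro m
  have hγq : Continuous fun p => γ (q * p) := by fun_prop
  refine DCM.of_Ioi ?_ (continuousOn_symm_prod hγq m)
  obtain ⟨g, -, hg⟩ := exists_expSum_tendsto (h (q * m))
    ((continuousOn_symm_prod hγ (q * m)).mono Ioi_subset_Ici_self)
  refine DCM.of_tendsto (u := atTop) (F := fun N w => (g N).eval (2 * Real.cosh (q * pOf w)))
    (isUpperSet_Ioi 2) (Eventually.of_forall fun N => ?_) fun w hw => ?_
  · refine (DCM.sum _ fun k _ => ?_).mono Ioi_subset_Ici_self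
    exact (dcm_exp_neg_cosh ((g N).a_nonneg k) h0 h1).const_mul ((g N).c_nonneg k)
  · have := hg _ (two_lt_two_cosh (mul_pos h0 (pOf_pos hw)).ne')
    rw [symm_prod_pOf] at this
    simpa only [mul_add, mul_sub] using this

lemma LHCM.const_mul {γ : ℝ → ℝ} (h : LHCM γ) (c : ℝ) : LHCM (fun p => c * γ p) := by
  intro m
  refine ((h m).const_mul (mul_self_nonneg c)).congr (isUpperSet_Ici 2) fun w _ => by ring

lemma LHCM.of_tendsto {ι : Type*} {u : Filter ι} [u.NeBot] {F : ι → ℝ → ℝ} {γ : ℝ → ℝ}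
    (hF : ∀ᶠ i in u, LHCM (F i)) (h : ∀ p, Tendsto (fun i => F i p) u (𝓝 (γ p))) : LHCM γ :=
  fun m => DCM.of_tendsto (isUpperSet_Ici 2) (hF.mono fun _ hi => hi m)
    fun _ _ => (h _).mul (h _)

lemma integrable_exp_neg_two_cosh {ε : ℝ} (hε : 0 < ε) :
    Integrable (fun τ : ℝ => Real.exp (-(ε * (2 * Real.cosh τ)))) := by
  refine (integrable_exp_neg_mul_abs hε).mono' (by fun_prop) (Eventually.of_forall fun τ => ?_)
  rw [Real.norm_of_nonneg (Real.exp_pos _).le, Real.exp_le_exp, neg_le_neg_iff]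
  refine mul_le_mul_of_nonneg_left ?_ hε.le
  rw [← Real.cosh_abs, Real.cosh_eq]
  linarith [Real.add_one_le_exp |τ|, Real.exp_pos (-|τ|)]

lemma integrable_exp_neg_add_exp {A B : ℝ} (hA : 0 < A) (hB : 0 < B) :
    Integrable (fun τ : ℝ => Real.exp (-(A * Real.exp τ + B * Real.exp (-τ)))) := by
  have hm : 0 < min A B := lt_min hA hB
  refine (integrable_exp_neg_two_cosh hm).mono' (by fun_prop) (Eventually.of_forall fun τ => ?_)
  rw [Real.norm_of_nonneg (Real.exp_pos _).le, Real.exp_le_exp, neg_le_neg_iff, Real.cosh_eq]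
  nlinarith [Real.exp_pos τ, Real.exp_pos (-τ), min_le_left A B, min_le_right A B,
    mul_le_mul_of_nonneg_right (min_le_left A B) (Real.exp_pos τ).le,
    mul_le_mul_of_nonneg_right (min_le_right A B) (Real.exp_pos (-τ)).le]

lemma exp_neg_cosh_add_cosh (a b p τ : ℝ) :
    a * (2 * Real.cosh (p - τ)) + b * (2 * Real.cosh τ) =
      (a * Real.exp (-p) + b) * Real.exp τ + (a * Real.exp p + b) * Real.exp (-τ) := by
  have e1 : Real.exp (p - τ) = Real.exp p * Real.exp (-τ) := by rw [← Real.exp_add]; ring_nf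
  have e2 : Real.exp (-(p - τ)) = Real.exp (-p) * Real.exp τ := by rw [← Real.exp_add]; ring_nf
  rw [Real.cosh_eq, Real.cosh_eq, e1, e2]; ring

lemma integrable_exp_neg_cosh_add_cosh {a b : ℝ} (ha : 0 < a) (hb : 0 < b) (p : ℝ) :
    Integrable (fun τ : ℝ => Real.exp (-(a * (2 * Real.cosh (p - τ)) + b * (2 * Real.cosh τ)))) := by
  simp only [exp_neg_cosh_add_cosh]
  exact integrable_exp_neg_add_exp (by positivity) (by positivity)

lemma dcm_integral_exp_neg_cosh_add_cosh {a b : ℝ} (ha : 0 < a) (hb : 0 < b) :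
    DCM (Ici 2) (fun w =>
      ∫ τ : ℝ, Real.exp (-(a * (2 * Real.cosh (pOf w - τ)) + b * (2 * Real.cosh τ)))) := by
  have key : ∀ w ∈ Ici (2:ℝ),
      (∫ τ : ℝ, Real.exp (-(a * (2 * Real.cosh (pOf w - τ)) + b * (2 * Real.cosh τ)))) =
      ∫ τ : ℝ, Real.exp (-((a ^ 2 + b ^ 2 + a * b * w) * Real.exp τ + 1 * Real.exp (-τ))) := by
    intro w hw
    simp only [exp_neg_cosh_add_cosh]
    set p := pOf w
    have hw' : Real.exp p + Real.exp (-p) = w := by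
      rw [← two_cosh_pOf hw, Real.cosh_eq]; ring
    have hB : 0 < a * Real.exp p + b := by positivity
    rw [← integral_add_right_eq_self _ (Real.log (a * Real.exp p + b))]
    congr 1; ext τ
    rw [neg_add τ, Real.exp_add, Real.exp_add, Real.exp_neg (Real.log _), Real.exp_log hB]
    congr 2
    have e3 : Real.exp p * Real.exp (-p) = 1 := by rw [← Real.exp_add]; simp
    rw [← hw']
    field_simp
    linear_combination a ^ 2 * Real.exp τ * e3
  refine DCM.congr (isUpperSet_Ici 2) ?_ key
  refine DCM.integral (F := fun (τ : ℝ) w =>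
    Real.exp (-((a ^ 2 + b ^ 2 + a * b * w) * Real.exp τ + 1 * Real.exp (-τ))))
    (isUpperSet_Ici 2) (Eventually.of_forall fun τ => ?_) fun w hw => ?_
  · refine ((DCM.exp_neg (S := Ici 2) (ξ := a * b * Real.exp τ) (by positivity)).const_mul
      (Real.exp_pos (-((a ^ 2 + b ^ 2) * Real.exp τ + 1 * Real.exp (-τ)))).le).congr
      (isUpperSet_Ici 2) fun w _ => ?_
    rw [← Real.exp_add]; ring_nf
  · have : (2:ℝ) ≤ w := hw
    exact integrable_exp_neg_add_exp (by positivity) one_pos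

/-- The damping factor used to truncate the convolution integrals. -/
noncomputable def damp (ε p τ : ℝ) : ℝ :=
  Real.exp (-(ε * (2 * Real.cosh (p - τ)) + ε * (2 * Real.cosh τ)))

lemma damp_nonneg (ε p τ : ℝ) : 0 ≤ damp ε p τ := (Real.exp_pos _).le

lemma damp_le_one {ε : ℝ} (hε : 0 ≤ ε) (p τ : ℝ) : damp ε p τ ≤ 1 := by
  rw [damp, Real.exp_le_one_iff]
  have := Real.cosh_pos (p - τ)
  have := Real.cosh_pos τ
  simp only [Left.neg_nonpos_iff]
  positivity

lemma continuous_damp (ε p : ℝ) : Continuous (damp ε p) := by unfold damp; fun_prop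

lemma dcm_integral_damp_expSum {ε : ℝ} (hε : 0 < ε) (g₁ g₂ : ExpSum) :
    DCM (Ici 2) (fun w => ∫ τ : ℝ, damp ε (pOf w) τ *
      (g₁.eval (2 * Real.cosh (pOf w - τ)) * g₂.eval (2 * Real.cosh τ))) := by
  have key : ∀ w, (∫ τ : ℝ, damp ε (pOf w) τ *
      (g₁.eval (2 * Real.cosh (pOf w - τ)) * g₂.eval (2 * Real.cosh τ))) =
      ∑ i ∈ Finset.range g₁.n, ∑ j ∈ Finset.range g₂.n, (g₁.c i * g₂.c j) *
        ∫ τ : ℝ, Real.exp (-((g₁.a i + ε) * (2 * Real.cosh (pOf w - τ)) +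
          (g₂.a j + ε) * (2 * Real.cosh τ))) := by
    intro w
    have hfi : ∀ i j, Integrable (fun τ : ℝ => (g₁.c i * g₂.c j) *
        Real.exp (-((g₁.a i + ε) * (2 * Real.cosh (pOf w - τ)) +
          (g₂.a j + ε) * (2 * Real.cosh τ)))) := fun i j =>
      (integrable_exp_neg_cosh_add_cosh (by linarith [g₁.a_nonneg i])
        (by linarith [g₂.a_nonneg j]) _).const_mul _
    simp only [← integral_const_mul]
    simp_rw [← integral_finsetSum _ fun j _ => hfi _ j]
    rw [← integral_finsetSum _ fun i _ => integrable_finsetSum _ fun j _ => hfi i j]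
    congr 1; ext τ
    rw [ExpSum.eval, ExpSum.eval, Finset.sum_mul_sum, Finset.mul_sum]
    refine Finset.sum_congr rfl fun i _ => ?_
    rw [Finset.mul_sum]
    refine Finset.sum_congr rfl fun j _ => ?_
    rw [damp, show ∀ a b c d e : ℝ, a * (b * c * (d * e)) = b * d * (a * c * e) by intros; ring,
      ← Real.exp_add, ← Real.exp_add]
    ring_nf
  simp only [key]
  refine DCM.sum _ fun i _ => DCM.sum _ fun j _ => DCM.const_mul
    (mul_nonneg (g₁.c_nonneg i) (g₂.c_nonneg j)) ?_
  exact dcm_integral_exp_neg_cosh_add_cosh (by linarith [g₁.a_nonneg i])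
    (by linarith [g₂.a_nonneg j])

lemma dcm_integral_damp {γ₁ γ₂ : ℝ → ℝ} (h₁ : LHCM γ₁) (h₂ : LHCM γ₂) (c₁ : Continuous γ₁)
    (c₂ : Continuous γ₂) {ε : ℝ} (hε : 0 < ε) (r s : ℝ) :
    DCM (Ici 2) (fun w => ∫ τ : ℝ, damp ε (pOf w) τ *
      (γ₁ (r + (pOf w - τ)) * γ₁ (r - (pOf w - τ)) * (γ₂ (s + τ) * γ₂ (s - τ)))) := by
  obtain ⟨f, hf, hf'⟩ := exists_expSum_tendsto (h₁ r)
    ((continuousOn_symm_prod c₁ r).mono Ioi_subset_Ici_self)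
  obtain ⟨g, hg, hg'⟩ := exists_expSum_tendsto (h₂ s)
    ((continuousOn_symm_prod c₂ s).mono Ioi_subset_Ici_self)
  refine DCM.of_tendsto (u := atTop) (F := fun N w => ∫ τ : ℝ, damp ε (pOf w) τ *
      ((f N).eval (2 * Real.cosh (pOf w - τ)) * (g N).eval (2 * Real.cosh τ)))
    (isUpperSet_Ici 2) (Eventually.of_forall fun N => dcm_integral_damp_expSum hε _ _) fun w _ => ?_
  set C₁ := γ₁ (r + pOf 2) * γ₁ (r - pOf 2)
  set C₂ := γ₂ (s + pOf 2) * γ₂ (s - pOf 2)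
  refine tendsto_integral_of_dominated_convergence (fun τ => damp ε (pOf w) τ * (C₁ * C₂))
    (fun N => ?_) ((integrable_exp_neg_cosh_add_cosh hε hε _).mul_const _) (fun N =>
      Eventually.of_forall fun τ => ?_) ?_
  · have := (f N).continuous_eval
    have := (g N).continuous_eval
    have := continuous_damp ε (pOf w)
    exact Continuous.aestronglyMeasurable (by fun_prop)
  · have e1 := (f N).eval_nonneg (2 * Real.cosh (pOf w - τ))
    have e2 := (g N).eval_nonneg (2 * Real.cosh τ)
    have e3 := hf N _ (two_le_two_cosh (pOf w - τ))
    have e4 := hg N _ (two_le_two_cosh τ)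
    rw [Real.norm_of_nonneg (mul_nonneg (damp_nonneg _ _ _) (mul_nonneg e1 e2))]
    exact mul_le_mul_of_nonneg_left (mul_le_mul e3 e4 e2 (e1.trans e3)) (damp_nonneg _ _ _)
  · have n1 : ∀ᵐ τ : ℝ, τ ≠ 0 := by simp [ae_iff, measure_singleton]
    have n2 : ∀ᵐ τ : ℝ, τ ≠ pOf w := by simp [ae_iff, measure_singleton]
    filter_upwards [n1, n2] with τ t1 t2
    have a1 := hf' _ (two_lt_two_cosh (sub_ne_zero.2 t2.symm))
    have a2 := hg' _ (two_lt_two_cosh t1)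
    rw [symm_prod_pOf] at a1 a2
    exact (a1.mul a2).const_mul _

/-- The linear change of variables `(s, τ) ↦ (s + τ, s - τ)`. -/
noncomputable def shear : (ℝ × ℝ) ≃L[ℝ] (ℝ × ℝ) :=
  LinearEquiv.toContinuousLinearEquiv
    { toFun := fun z => (z.1 + z.2, z.1 - z.2)
      invFun := fun z => ((z.1 + z.2) / 2, (z.1 - z.2) / 2)
      map_add' := fun x y => by ext <;> simp <;> ring
      map_smul' := fun c x => by ext <;> simp <;> ring
      left_inv := fun x => by ext <;> simp
      right_inv := fun x => by ext <;> simp <;> ring }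

lemma integral_comp_shear : ∃ c : ℝ, 0 ≤ c ∧ ∀ F : ℝ × ℝ → ℝ, Integrable F →
    Integrable (fun z : ℝ × ℝ => F (z.1 + z.2, z.1 - z.2)) ∧
    ∫ z, F z = c * ∫ z : ℝ × ℝ, F (z.1 + z.2, z.1 - z.2) := by
  have hdet : (shear : (ℝ × ℝ) →L[ℝ] (ℝ × ℝ)).det ≠ 0 :=
    (LinearEquiv.isUnit_det' shear.toLinearEquiv).ne_zero
  have hmap := Measure.map_linearMap_addHaar_eq_smul_addHaar (volume : Measure (ℝ × ℝ))
    (f := (shear : (ℝ × ℝ) →L[ℝ] (ℝ × ℝ)).toLinearMap) hdet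
  set k := |(LinearMap.det (shear : (ℝ × ℝ) →L[ℝ] (ℝ × ℝ)).toLinearMap)⁻¹| with hk
  have hk0 : 0 < k := abs_pos.2 (inv_ne_zero hdet)
  have hmap' : Measure.map shear.toHomeomorph.toMeasurableEquiv volume =
    ENNReal.ofReal k • (volume : Measure (ℝ × ℝ)) := hmap
  refine ⟨k⁻¹, (inv_pos.2 hk0).le, fun F hF => ⟨?_, ?_⟩⟩
  · have : Integrable F (Measure.map shear.toHomeomorph.toMeasurableEquiv volume) := by
      rw [hmap']; exact hF.smul_measure ENNReal.ofReal_ne_top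
    exact (integrable_map_equiv _ _).1 this
  · have : ∫ z, F z ∂(Measure.map shear.toHomeomorph.toMeasurableEquiv volume) =
        ∫ z : ℝ × ℝ, F (z.1 + z.2, z.1 - z.2) := integral_map_equiv _ _
    rw [hmap', integral_smul_measure, ENNReal.toReal_ofReal hk0.le, smul_eq_mul] at this
    rw [← this, inv_mul_cancel_left₀ hk0.ne']

theorem LHCM.convolution {γ₁ γ₂ : ℝ → ℝ} (h₁ : LHCM γ₁) (h₂ : LHCM γ₂) (c₁ : Continuous γ₁)
    (c₂ : Continuous γ₂) (hfi : ∀ m, Integrable (fun x => γ₁ (m - x) * γ₂ x)) :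
    LHCM (fun m => ∫ x, γ₁ (m - x) * γ₂ x) := by
  intro m
  obtain ⟨c, hc0, hc⟩ := integral_comp_shear
  set G : ℝ → ℝ × ℝ → ℝ := fun p z =>
    γ₁ (m - z.1 + (p - z.2)) * γ₁ (m - z.1 - (p - z.2)) * (γ₂ (z.1 + z.2) * γ₂ (z.1 - z.2)) with hG
  have hGc : ∀ p, Continuous (G p) := fun p => by simp only [hG]; fun_prop
  have hGi : ∀ p, Integrable (G p) ∧ (∫ x, γ₁ (m + p - x) * γ₂ x) * (∫ x, γ₁ (m - p - x) * γ₂ x) =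
      c * ∫ z, G p z := by
    intro p
    have hp := (hfi (m + p)).mul_prod (hfi (m - p))
    obtain ⟨e1, e2⟩ := hc _ hp
    have e3 : (fun z : ℝ × ℝ => γ₁ (m + p - (z.1 + z.2)) * γ₂ (z.1 + z.2) *
        (γ₁ (m - p - (z.1 - z.2)) * γ₂ (z.1 - z.2))) = G p := by
      ext z
      simp only [hG]
      rw [show m + p - (z.1 + z.2) = m - z.1 + (p - z.2) by ring,
        show m - p - (z.1 - z.2) = m - z.1 - (p - z.2) by ring]
      ring
    simp only [e3] at e1 e2
    refine ⟨e1, ?_⟩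
    rw [← e2]
    exact (integral_prod_mul (μ := volume) (ν := volume) (fun x => γ₁ (m + p - x) * γ₂ x)
      (fun x => γ₁ (m - p - x) * γ₂ x)).symm
  have hdi : ∀ ε, 0 < ε → ∀ p, Integrable (fun z : ℝ × ℝ => damp ε p z.2 * G p z) := by
    intro ε hε p
    refine (hGi p).1.mono ((((continuous_damp ε p).comp continuous_snd).mul
      (hGc p)).aestronglyMeasurable) (Eventually.of_forall fun z => ?_)
    rw [norm_mul, Real.norm_of_nonneg (damp_nonneg _ _ _)]
    exact mul_le_of_le_one_left (norm_nonneg _) (damp_le_one hε.le _ _)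
  have hdcm : ∀ ε, 0 < ε → DCM (Ici 2) (fun w => ∫ z, damp ε (pOf w) z.2 * G (pOf w) z) := by
    intro ε hε
    have : ∀ w, ∫ z, damp ε (pOf w) z.2 * G (pOf w) z =
        ∫ s, ∫ τ, damp ε (pOf w) τ * G (pOf w) (s, τ) := fun w =>
      integral_prod _ (hdi ε hε (pOf w))
    simp only [this]
    refine DCM.integral (F := fun s w => ∫ τ, damp ε (pOf w) τ * G (pOf w) (s, τ))
      (isUpperSet_Ici 2) (Eventually.of_forall fun s => ?_)
      fun w _ => (hdi ε hε (pOf w)).integral_prod_left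
    exact dcm_integral_damp h₁ h₂ c₁ c₂ hε (m - s) s
  have hlim : DCM (Ici 2) (fun w => ∫ z, G (pOf w) z) := by
    refine DCM.of_tendsto (u := atTop)
      (F := fun (N : ℕ) w => ∫ z, damp (1 / (N + 1 : ℝ)) (pOf w) z.2 * G (pOf w) z)
      (isUpperSet_Ici 2) (Eventually.of_forall fun N => hdcm _ (by positivity)) fun w _ => ?_
    refine tendsto_integral_of_dominated_convergence (fun z => ‖G (pOf w) z‖)
      (fun N => (hdi _ (by positivity) _).1) (hGi _).1.norm (fun N => Eventually.of_forall fun z => ?_)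
      (Eventually.of_forall fun z => ?_)
    · rw [norm_mul, Real.norm_of_nonneg (damp_nonneg _ _ _)]
      exact mul_le_of_le_one_left (norm_nonneg _) (damp_le_one (by positivity) _ _)
    · have hε := tendsto_one_div_add_atTop_nhds_zero_nat (𝕜 := ℝ)
      have hcont : Continuous fun ε => damp ε (pOf w) z.2 * G (pOf w) z := by
        unfold damp; fun_prop
      have := (hcont.tendsto 0).comp hε
      simpa [damp, Function.comp_def] using this
  exact (hlim.const_mul hc0).congr (isUpperSet_Ici 2) fun w _ => (hGi (pOf w)).2

lemma laplace_gam {α : ℝ} (h0 : 0 < α) (h1 : α < 1 / 2) {ξ : ℂ} (hξ : |ξ.im| < π / 2) :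
    Integrable (fun a : ℝ => ((gam α a : ℝ) : ℂ) * cexp (-(cexp ξ * cexp a))) ∧
    hfun α 1 ξ = ∫ a : ℝ, ((gam α a : ℝ) : ℂ) * cexp (-(cexp ξ * cexp a)) := by
  obtain ⟨hi, he⟩ := laplace_N h0 h1 one_pos hξ
  have e : (fun a : ℝ => ((gam α a : ℝ) : ℂ) * cexp (-(cexp ξ * cexp a))) = fun a : ℝ =>
      ((1 / π : ℝ) : ℂ) * (((N α (1 * Real.exp (-(α * a))) : ℝ) : ℂ) *
        cexp (-(cexp ξ * cexp a))) := by
    ext a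
    rw [gam, one_mul]; push_cast; ring
  rw [e]
  refine ⟨hi.const_mul _, ?_⟩
  rw [integral_const_mul]
  exact he

lemma gam_nonneg {α : ℝ} (h0 : 0 < α) (h1 : α < 1 / 2) (p : ℝ) : 0 ≤ gam α p :=
  div_nonneg (N_nonneg h0 h1 (Real.exp_pos _)) Real.pi_pos.le

lemma integral_gam_mul_exp_le_one {α : ℝ} (h0 : 0 < α) (h1 : α < 1 / 2) {s : ℝ} (hs : 0 < s) :
    Integrable (fun a : ℝ => gam α a * Real.exp (-(s * Real.exp a))) ∧
    ∫ a : ℝ, gam α a * Real.exp (-(s * Real.exp a)) ≤ 1 := by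
  have hpi : 0 < π / 2 := by positivity
  obtain ⟨hi, he⟩ := laplace_gam h0 h1 (ξ := ((Real.log s : ℝ) : ℂ)) (by simpa using hpi)
  have hexp : cexp ((Real.log s : ℝ) : ℂ) = (s : ℂ) := by
    rw [← ofReal_exp, Real.exp_log hs]
  have e1 : ∀ a : ℝ, ((gam α a : ℝ) : ℂ) * cexp (-(cexp ((Real.log s : ℝ) : ℂ) * cexp a)) =
      ((gam α a * Real.exp (-(s * Real.exp a)) : ℝ) : ℂ) := by
    intro a; rw [hexp]; push_cast; rfl
  simp only [e1] at hi he
  refine ⟨hi.re, ?_⟩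
  rw [integral_complex_ofReal] at he
  have h2 : hfun α 1 ((Real.log s : ℝ) : ℂ) =
      ((Real.exp (-(Real.exp (α * Real.log s))) : ℝ) : ℂ) := by
    rw [hfun]; push_cast; ring_nf
  rw [h2] at he
  rw [← Complex.ofReal_inj.1 he, Real.exp_le_one_iff]
  exact neg_nonpos.2 (Real.exp_pos _).le

lemma E_mul_eq_integral {α β : ℝ} (h0 : 0 < α) (h1 : α < 1 / 2) (k0 : 0 < β) (k1 : β < 1 / 2)
    (p x : ℝ) :
    Integrable (fun a : ℝ => gam β a * E α (Real.exp (a - α * p)) x) ∧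
    E (α * β) (Real.exp (-(α * β * p))) x =
      ∫ a : ℝ, gam β a * E α (Real.exp (a - α * p)) x := by
  obtain ⟨hi, he⟩ := laplace_gam k0 k1 (ξ := (α : ℂ) * (((x - p : ℝ) : ℂ) + (π : ℝ) * I)) (by
    rw [Complex.im_ofReal_mul]
    simp only [add_im, ofReal_im, im_ofReal_mul, I_im, mul_one, zero_add]
    rw [abs_of_pos (mul_pos h0 Real.pi_pos)]
    nlinarith [Real.pi_pos])
  have e1 : ∀ a : ℝ, -((((gam β a : ℝ) : ℂ) *
      cexp (-(cexp ((α : ℂ) * (((x - p : ℝ) : ℂ) + (π : ℝ) * I)) * cexp a))).im) =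
      gam β a * E α (Real.exp (a - α * p)) x := by
    intro a
    rw [Complex.im_ofReal_mul, E, hfun, ofReal_exp, ← Complex.exp_add, ← Complex.exp_add]
    rw [show (α : ℂ) * (((x - p : ℝ) : ℂ) + (π : ℝ) * I) + a =
      ((a - α * p : ℝ) : ℂ) + α * (x + (π : ℝ) * I) by push_cast; ring]
    ring
  refine ⟨?_, ?_⟩
  · refine (hi.im.neg).congr (Eventually.of_forall fun a => ?_)
    exact e1 a
  · simp only [← e1]
    rw [integral_neg, E]
    have h := integral_im (𝕜 := ℂ) hi
    refine congrArg Neg.neg (Eq.trans ?_ h.symm)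
    change _ = (∫ a : ℝ, _ : ℂ).im
    rw [← he, hfun, hfun]
    congr 3
    rw [ofReal_exp, ← Complex.exp_add, ofReal_one, one_mul]
    congr 1; push_cast; ring

lemma continuous_E_uncurry (α : ℝ) : Continuous fun z : ℝ × ℝ => E α z.1 z.2 := by
  unfold E hfun; fun_prop

/-- Subordination: products of independent stable variables are stable. -/
lemma gam_mul {α β : ℝ} (h0 : 0 < α) (h1 : α < 1 / 2) (k0 : 0 < β) (k1 : β < 1 / 2) (p : ℝ) :
    Integrable (fun x => gam α (p - x) * gam β (α * x)) ∧
    gam (α * β) p = α * ∫ x, gam α (p - x) * gam β (α * x) := by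
  have hcg : Continuous (gam β) := continuous_gam k0 (by linarith)
  set f : ℝ × ℝ → ℝ := fun z => gam β z.2 * E α (Real.exp (z.2 - α * p)) z.1 * wt z.1 with hf
  have hfc : Continuous f := by
    have c1 := continuous_wt
    have c2 : Continuous fun z : ℝ × ℝ => E α (Real.exp (z.2 - α * p)) z.1 :=
      (continuous_E_uncurry α).comp
        (f := fun z : ℝ × ℝ => (Real.exp (z.2 - α * p), z.1)) (by fun_prop)
    simp only [hf]; fun_prop
  have hfi : Integrable f (volume.prod volume) := by
    refine (integrable_prod_iff hfc.aestronglyMeasurable).2 ⟨Eventually.of_forall fun x => ?_, ?_⟩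
    · exact (E_mul_eq_integral h0 h1 k0 k1 p x).1.mul_const (wt x)
    · refine integrable_wt.mono' (hfc.norm.aestronglyMeasurable.integral_prod_right')
        (Eventually.of_forall fun x => ?_)
      rw [Real.norm_of_nonneg (integral_nonneg fun _ => norm_nonneg _)]
      have hs : 0 < Real.exp (-(α * p)) * Real.cos (α * π) * Real.exp (α * x) :=
        mul_pos (mul_pos (Real.exp_pos _) (cos_pi_mul_pos h0 h1)) (Real.exp_pos _)
      obtain ⟨i1, i2⟩ := integral_gam_mul_exp_le_one k0 k1 hs
      calc ∫ a, ‖f (x, a)‖ ≤ ∫ a, gam β a * Real.exp (-(Real.exp (-(α * p)) * Real.cos (α * π) *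
            Real.exp (α * x) * Real.exp a)) * wt x := by
            refine integral_mono ?_ (i1.mul_const _) fun a => ?_
            · exact ((E_mul_eq_integral h0 h1 k0 k1 p x).1.mul_const (wt x)).norm
            · simp only [hf, norm_mul, Real.norm_of_nonneg (gam_nonneg k0 k1 a),
                Real.norm_of_nonneg (wt_pos x).le]
              refine mul_le_mul_of_nonneg_right (mul_le_mul_of_nonneg_left ?_
                (gam_nonneg k0 k1 a)) (wt_pos x).le
              refine (abs_E_le h0 h1 (Real.exp_pos _) x).trans (le_of_eq ?_)
              rw [sub_eq_add_neg, Real.exp_add]; ring_nf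
        _ ≤ 1 * wt x := by
            rw [integral_mul_const]
            exact mul_le_mul_of_nonneg_right i2 (wt_pos x).le
        _ = wt x := one_mul _
  have hα1 : α < 1 := by linarith
  have hin : ∀ a, ∫ x, f (x, a) = π * (gam α (p - a / α) * gam β a) := by
    intro a
    simp only [hf, mul_assoc]
    rw [integral_const_mul, ← N_eq_integral h0 hα1, gam.eq_1 α,
      show -(α * (p - a / α)) = a - α * p by field_simp; ring]
    have := Real.pi_ne_zero
    field_simp
  have hfi2 : Integrable fun a => gam α (p - a / α) * gam β a := by
    have := hfi.integral_prod_right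
    simp only [hin] at this
    refine (this.const_mul π⁻¹).congr (Eventually.of_forall fun a => ?_)
    exact inv_mul_cancel_left₀ Real.pi_ne_zero _
  have hαβ0 : 0 < α * β := mul_pos h0 k0
  have hαβ1 : α * β < 1 := by nlinarith
  have hN : gam (α * β) p = ∫ a, gam α (p - a / α) * gam β a := by
    rw [gam, N_eq_integral hαβ0 hαβ1]
    have : ∀ x, E (α * β) (Real.exp (-(α * β * p))) x * wt x = ∫ a, f (x, a) := by
      intro x
      rw [(E_mul_eq_integral h0 h1 k0 k1 p x).2, ← integral_mul_const]
    simp only [this]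
    rw [integral_integral_swap (f := fun x a => f (x, a)) hfi]
    simp only [hin]
    rw [integral_const_mul, mul_div_cancel_left₀ _ Real.pi_ne_zero]
  have hcan : ∀ x, p - α * x / α = p - x := fun x => by field_simp
  constructor
  · have := hfi2.comp_mul_left' h0.ne'
    simpa only [hcan] using this
  · rw [hN]
    have := Measure.integral_comp_mul_left (fun a => gam α (p - a / α) * gam β a) α
    simp only [hcan] at this
    rw [this, abs_of_pos (inv_pos.2 h0), smul_eq_mul, mul_inv_cancel_left₀ h0.ne']

lemma LHCM.gam_mul {α β : ℝ} (h0 : 0 < α) (h1 : α < 1 / 2) (k0 : 0 < β) (k1 : β < 1 / 2)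
    (h : LHCM (gam α)) (k : LHCM (gam β)) : LHCM (gam (α * β)) := by
  have c1 := continuous_gam h0 (by linarith)
  have c2 := continuous_gam k0 (by linarith : β < 1)
  have := (h.convolution (k.dilate c2 h0 (by linarith)) c1 (by fun_prop)
    fun m => (StableHCM.gam_mul h0 h1 k0 k1 m).1).const_mul α
  have e : gam (α * β) = fun m => α * ∫ x, gam α (m - x) * gam β (α * x) :=
    funext fun m => (StableHCM.gam_mul h0 h1 k0 k1 m).2
  rw [e]; exact this

lemma lhcm_gam_of_lt {n : ℕ} : ∀ {α : ℝ}, (1 / 9) * (9 / 20) ^ n < α → α < 1 / 4 →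
    LHCM (gam α) := by
  have base : ∀ {α : ℝ}, 1 / 9 < α → α < 1 / 4 → LHCM (gam α) := by
    intro α ha hb
    have s1 : 1 / 3 < √α := Real.lt_sqrt_of_sq_lt (by norm_num; linarith)
    have s2 : √α < 1 / 2 := (Real.sqrt_lt' (by norm_num)).2 (by norm_num; linarith)
    have := lhcm_gam_base s1 s2
    rw [← Real.mul_self_sqrt (show 0 ≤ α by linarith)]
    exact this.gam_mul (by linarith) s2 (by linarith) s2 this
  induction n with
  | zero => intro α ha hb; exact base (by simpa using ha) hb
  | succ n ih =>
    intro α ha hb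
    by_cases h : 1 / 9 < α
    · exact base h hb
    have h2 : (1 / 9) * (9 / 20) ^ n < 20 / 9 * α := by rw [pow_succ] at ha; linarith
    have hpos : (0:ℝ) < (1 / 9) * (9 / 20) ^ n := by positivity
    have h3 := ih h2 (by linarith)
    have := (lhcm_gam_base (α := 9 / 20) (by norm_num) (by norm_num)).gam_mul (by norm_num)
      (by norm_num) (by linarith) (by linarith) h3
    rwa [show 9 / 20 * (20 / 9 * α) = α by ring] at this

lemma lhcm_gam_of_lt_quarter {α : ℝ} (h0 : 0 < α) (h1 : α < 1 / 4) : LHCM (gam α) := by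
  obtain ⟨n, hn⟩ := exists_pow_lt_of_lt_one (show 0 < 9 * α by linarith)
    (show (9 / 20 : ℝ) < 1 by norm_num)
  exact lhcm_gam_of_lt (n := n) (by linarith) h1

lemma tendsto_gam {a : ℝ} (h0 : 0 < a) (h1 : a < 1) (p : ℝ) :
    Tendsto (fun α => gam α p) (𝓝 a) (𝓝 (gam a p)) := by
  obtain ⟨b, hab, hb1⟩ := exists_between h1
  have hb0 : 0 < b := h0.trans hab
  set B := Real.exp |p|
  have hnear : ∀ᶠ α in 𝓝 a, 0 < α ∧ α < b := (eventually_gt_nhds h0).and (eventually_lt_nhds hab)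
  have hQ : Tendsto (fun α => Q α (((Real.exp (-(α * p)) : ℝ) : ℂ) * cexp (-(π * α) * I))) (𝓝 a)
      (𝓝 (Q a (((Real.exp (-(a * p)) : ℝ) : ℂ) * cexp (-(π * a) * I)))) := by
    unfold Q
    refine tendsto_integral_filter_of_dominated_convergence
      (fun x => Real.exp B * (Real.exp (B * Real.exp (b * x)) * wt x)) ?_ ?_
      ((integrable_exp_mul_wt hb0 hb1 B).const_mul _) (Eventually.of_forall fun x => ?_)
    · have := continuous_wt
      exact Eventually.of_forall fun α => Continuous.aestronglyMeasurable (by fun_prop)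
    · filter_upwards [hnear] with α hα
      refine Eventually.of_forall fun x => ?_
      have hn : ‖((Real.exp (-(α * p)) : ℝ) : ℂ) * cexp (-(π * α) * I)‖ ≤ B := by
        rw [norm_mul, Complex.norm_exp, Complex.norm_real, Real.norm_of_nonneg (Real.exp_pos _).le]
        have : (-((π : ℂ) * α) * I).re = 0 := by
          rw [← ofReal_mul, ← ofReal_neg, Complex.re_ofReal_mul]; simp
        rw [this, Real.exp_zero, mul_one, Real.exp_le_exp]
        refine (neg_le_abs _).trans ?_
        rw [abs_mul, abs_of_pos hα.1]
        exact mul_le_of_le_one_left (abs_nonneg _) (by linarith [hα.2])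
      refine (norm_integrand_le α hn x).trans ?_
      rw [← mul_assoc, ← Real.exp_add B]
      refine mul_le_mul_of_nonneg_right (Real.exp_le_exp.2 ?_) (wt_pos x).le
      have hB : 0 < B := Real.exp_pos _
      have : Real.exp (α * x) ≤ 1 + Real.exp (b * x) := by
        rcases le_total x 0 with h | h
        · have : Real.exp (α * x) ≤ 1 :=
            Real.exp_le_one_iff.2 (mul_nonpos_of_nonneg_of_nonpos hα.1.le h)
          linarith [Real.exp_pos (b * x)]
        · have : Real.exp (α * x) ≤ Real.exp (b * x) :=
            Real.exp_le_exp.2 (mul_le_mul_of_nonneg_right hα.2.le h)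
          linarith
      nlinarith
    · refine Continuous.tendsto ?_ a
      fun_prop
  have h2 := (Complex.continuous_im.tendsto _).comp hQ
  exact h2.div_const π

theorem lhcm_gam {α : ℝ} (hα : α ∈ Set.Ioc (0:ℝ) (1/4) ∪ Set.Icc (1/3 : ℝ) (1/2)) :
    LHCM (gam α) := by
  rcases hα with ⟨h0, h1⟩ | ⟨h0, h1⟩
  · rcases h1.lt_or_eq with h1 | rfl
    · exact lhcm_gam_of_lt_quarter h0 h1
    · refine LHCM.of_tendsto (u := 𝓝[<] (1 / 4)) (F := gam) ?_ fun p =>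
        (tendsto_gam (by norm_num) (by norm_num) p).mono_left nhdsWithin_le_nhds
      filter_upwards [Ioo_mem_nhdsLT (show (0:ℝ) < 1 / 4 by norm_num)] with a ha
      exact lhcm_gam_of_lt_quarter ha.1 ha.2
  · rcases h0.lt_or_eq with h0 | rfl
    · rcases h1.lt_or_eq with h1 | rfl
      · exact lhcm_gam_base h0 h1
      · refine LHCM.of_tendsto (u := 𝓝[<] (1 / 2)) (F := gam) ?_ fun p =>
          (tendsto_gam (by norm_num) (by norm_num) p).mono_left nhdsWithin_le_nhds
        filter_upwards [Ioo_mem_nhdsLT (show (1/3:ℝ) < 1 / 2 by norm_num)] with a ha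
        exact lhcm_gam_base ha.1 ha.2
    · refine LHCM.of_tendsto (u := 𝓝[>] (1 / 3)) (F := gam) ?_ fun p =>
        (tendsto_gam (by norm_num) (by norm_num) p).mono_left nhdsWithin_le_nhds
      filter_upwards [Ioo_mem_nhdsGT (show (1/3:ℝ) < 1 / 2 by norm_num)] with a ha
      exact lhcm_gam_base ha.1 ha.2

lemma exists_comp_sq {f : ℂ → ℂ} (hf : DifferentiableOn ℂ f (Metric.ball 0 1))
    (heven : ∀ z, f (-z) = f z) :
    ∃ Ψ : ℂ → ℂ, DifferentiableOn ℂ Ψ (Metric.ball 0 1) ∧ ∀ r, Ψ (r ^ 2) = f r := by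
  have hsq : ∀ {z w : ℂ}, z ^ 2 = w ^ 2 → f z = f w := by
    intro z w h
    rcases sq_eq_sq_iff_eq_or_eq_neg.1 h with h | h <;> rw [h]
    exact heven w
  have hroot : ∀ u : ℂ, (u ^ (((2 : ℕ) : ℂ)⁻¹)) ^ 2 = u := fun u => cpow_nat_inv_pow u two_ne_zero
  have hlt : ∀ {u z : ℂ}, z ^ 2 = u → u ∈ Metric.ball (0:ℂ) 1 → z ∈ Metric.ball (0:ℂ) 1 := by
    intro u z hz hu
    rw [mem_ball_zero_iff] at *
    rw [← hz, norm_pow] at hu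
    by_contra h
    exact absurd hu (not_lt.2 (one_le_pow₀ (not_lt.1 h)))
  have hfd : ∀ {z : ℂ}, z ∈ Metric.ball (0:ℂ) 1 → DifferentiableAt ℂ f z := fun hz =>
    hf.differentiableAt (Metric.isOpen_ball.mem_nhds hz)
  refine ⟨fun u => f (u ^ (((2 : ℕ) : ℂ)⁻¹)), ?_, fun r => hsq (hroot _)⟩
  refine (differentiableOn_compl_singleton_and_continuousAt_iff
    (Metric.ball_mem_nhds (0:ℂ) one_pos)).1 ⟨fun u hu => ?_, ?_⟩
  · have hu0 : u ≠ 0 := hu.2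
    refine DifferentiableAt.differentiableWithinAt ?_
    by_cases hs : u ∈ slitPlane
    · exact (hfd (hlt (hroot u) hu.1)).comp u
        (differentiableAt_id.cpow (differentiableAt_const _) hs)
    · have hs' : -u ∈ slitPlane := by
        rw [mem_slitPlane_iff] at hs ⊢
        push Not at hs
        left
        rw [neg_re]
        rcases hs.1.lt_or_eq with h | h
        · linarith
        · exact absurd (Complex.ext h hs.2) hu0
      have hroot' : ∀ u : ℂ, (I * (-u) ^ (((2 : ℕ) : ℂ)⁻¹)) ^ 2 = u := fun u => by
        rw [mul_pow, hroot, I_sq]; ring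
      have e : (fun u : ℂ => f (u ^ (((2 : ℕ) : ℂ)⁻¹))) =
          fun u => f (I * (-u) ^ (((2 : ℕ) : ℂ)⁻¹)) := by
        ext u
        exact hsq (by rw [hroot, hroot'])
      rw [e]
      exact (hfd (hlt (hroot' u) hu.1)).comp u
        ((differentiableAt_id.neg.cpow (differentiableAt_const _) hs').const_mul I)
  · have h0 : (0:ℂ) ^ (((2 : ℕ) : ℂ)⁻¹) = 0 := by simp
    refine ContinuousAt.comp (g := f) ?_ (continuousAt_cpow_const_of_re_pos (by simp) ?_)
    · rw [h0]; exact (hfd (by simp)).continuousAt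
    · simp

/-- An even entire function of `ζ` is a holomorphic function of `w = 2 cosh ζ` on `Re w > 0`. -/
lemma exists_comp_add_inv {Φ : ℂ → ℂ} (hΦ : Differentiable ℂ Φ) (heven : ∀ z, Φ (-z) = Φ z) :
    ∃ F : ℂ → ℂ, DifferentiableOn ℂ F {w | 0 < w.re} ∧
      ∀ v : ℝ, 0 < v → F ((v + 1 / v : ℝ) : ℂ) = Φ ((Real.log v : ℝ) : ℂ) := by
  have hslit : ∀ {r : ℂ}, r ∈ Metric.ball (0:ℂ) 1 → 1 + r ∈ slitPlane := by
    intro r hr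
    rw [mem_ball_zero_iff] at hr
    refine mem_slitPlane_iff.2 (Or.inl ?_)
    have := (abs_le.1 (Complex.abs_re_le_norm r)).1
    simp only [add_re, one_re]; linarith
  obtain ⟨Ψ, hΨ, hΨ'⟩ := exists_comp_sq (f := fun r => Φ (log (1 + r) - log (1 - r)))
    (fun r hr => by
      refine DifferentiableAt.differentiableWithinAt ?_
      have s1 := hslit hr
      have s2 : 1 - r ∈ slitPlane := by
        rw [sub_eq_add_neg]; exact hslit (by simpa using hr)
      refine (hΦ _).comp r (DifferentiableAt.sub ?_ ?_)
      · exact DifferentiableAt.clog (by fun_prop) s1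
      · exact DifferentiableAt.clog (by fun_prop) s2)
    (fun z => by rw [← heven]; congr 1; rw [sub_neg_eq_add, ← sub_eq_add_neg]; ring)
  refine ⟨fun w => Ψ ((w - 2) / (w + 2)), ?_, fun v hv => ?_⟩
  · refine hΨ.comp (fun w hw => ?_) fun w hw => ?_
    all_goals
      have hw : 0 < w.re := hw
      have hne : w + 2 ≠ 0 := fun h => by
        have := congrArg Complex.re h
        simp at this; linarith
    · exact DifferentiableAt.differentiableWithinAt (by fun_prop (disch := exact hne))
    · rw [mem_ball_zero_iff, norm_div, div_lt_one (norm_pos_iff.2 hne)]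
      refine lt_of_pow_lt_pow_left₀ 2 (norm_nonneg _) ?_
      rw [← normSq_eq_norm_sq, ← normSq_eq_norm_sq, normSq_apply, normSq_apply]
      simp; nlinarith
  · have hv1 : (v:ℝ) + 1 ≠ 0 := by positivity
    have e : (((v + 1 / v : ℝ) : ℂ) - 2) / (((v + 1 / v : ℝ) : ℂ) + 2) =
        (((v - 1) / (v + 1) : ℝ) : ℂ) ^ 2 := by
      rw [show (2:ℂ) = ((2:ℝ):ℂ) by simp, ← ofReal_sub, ← ofReal_add, ← ofReal_div, ← ofReal_pow]
      congr 1
      have hw2 : v + 1 / v + 2 ≠ 0 := by positivity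
      rw [div_pow, div_eq_div_iff hw2 (by positivity)]
      field_simp
      ring
    simp only [e, hΨ']
    congr 1
    have a1 : 1 + (v - 1) / (v + 1) = 2 * v / (v + 1) := by field_simp; ring
    have a2 : 1 - (v - 1) / (v + 1) = 2 / (v + 1) := by field_simp; ring
    rw [← ofReal_one, ← ofReal_add, ← ofReal_sub, a1, a2, ← ofReal_log (by positivity),
      ← ofReal_log (by positivity), ← ofReal_sub, ← Real.log_div (by positivity) (by positivity)]
    congr 2
    field_simp

lemma isOpen_rightHalfPlane : IsOpen {w : ℂ | 0 < w.re} :=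
  isOpen_lt continuous_const Complex.continuous_re

lemma differentiableOn_iteratedDeriv {F : ℂ → ℂ} {U : Set ℂ} (hU : IsOpen U)
    (hF : DifferentiableOn ℂ F U) (n : ℕ) : DifferentiableOn ℂ (iteratedDeriv n F) U := by
  induction n with
  | zero => simpa using hF
  | succ n ih => rw [iteratedDeriv_succ]; exact ih.deriv hU

lemma iteratedDeriv_re {F : ℂ → ℂ} (hF : DifferentiableOn ℂ F {w | 0 < w.re}) (n : ℕ) :
    ∀ x : ℝ, 0 < x → iteratedDeriv n (fun x : ℝ => (F x).re) x = (iteratedDeriv n F x).re := by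
  induction n with
  | zero => intro x _; simp
  | succ n ih =>
    intro x hx
    have hd : HasDerivAt (iteratedDeriv n F) (iteratedDeriv (n + 1) F x) (x : ℂ) := by
      rw [iteratedDeriv_succ]
      exact ((differentiableOn_iteratedDeriv isOpen_rightHalfPlane hF n).differentiableAt
        (isOpen_rightHalfPlane.mem_nhds (by simpa using hx))).hasDerivAt
    rw [iteratedDeriv_succ, ← hd.real_of_complex.deriv]
    refine Filter.EventuallyEq.deriv_eq ?_
    filter_upwards [Ioi_mem_nhds hx] with y hy using ih y hy

lemma dcm_iteratedDeriv {φ : ℝ → ℝ} {a : ℝ} (hφ : DCM (Ioi a) φ)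
    (hd : ∀ n, DifferentiableOn ℝ (iteratedDeriv n φ) (Ioi a)) (n : ℕ) :
    DCM (Ioi a) (fun w => (-1) ^ n * iteratedDeriv n φ w) := by
  induction n with
  | zero => simpa using hφ
  | succ n ih =>
    refine DCM.of_tendsto (u := atTop) (F := fun (i : ℕ) w => ((i : ℝ) + 1) *
      ((-1) ^ n * iteratedDeriv n φ w - (-1) ^ n * iteratedDeriv n φ (w + 1 / ((i : ℝ) + 1))))
      (isUpperSet_Ioi a) (Eventually.of_forall fun i =>
        (ih.sub_shift (by positivity)).const_mul (by positivity)) fun w hw => ?_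
    have hder : HasDerivAt (iteratedDeriv n φ) (iteratedDeriv (n + 1) φ w) w := by
      rw [iteratedDeriv_succ]
      exact ((hd n).differentiableAt (Ioi_mem_nhds hw)).hasDerivAt
    have hs := hasDerivAt_iff_tendsto_slope_zero.1 hder
    have hε : Tendsto (fun i : ℕ => 1 / ((i : ℝ) + 1)) atTop (𝓝[≠] 0) :=
      tendsto_nhdsWithin_iff.2 ⟨tendsto_one_div_add_atTop_nhds_zero_nat,
        Eventually.of_forall fun i => by
          have : (0:ℝ) < 1 / ((i : ℝ) + 1) := by positivity
          exact this.ne'⟩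
    have := (hs.comp hε).const_mul ((-1) ^ (n + 1))
    refine this.congr fun i => ?_
    simp only [Function.comp_apply, smul_eq_mul, one_div, inv_inv, pow_succ]
    ring

lemma re_nonneg_of_taylor {F : ℂ → ℂ} (hF : DifferentiableOn ℂ F {w | 0 < w.re}) {c x : ℝ}
    (hx : 0 < x) (hxc : x ≤ c) (h : ∀ n : ℕ, 0 ≤ (-1) ^ n * (iteratedDeriv n F c).re) :
    0 ≤ (F x).re := by
  have hb : Metric.ball (c : ℂ) c ⊆ {w | 0 < w.re} := by
    intro w hw
    rw [Metric.mem_ball, Complex.dist_eq] at hw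
    have := (abs_le.1 (Complex.abs_re_le_norm (w - c))).1
    simp only [sub_re, ofReal_re] at this
    simp only [mem_ofPred_eq]; linarith
  have hs := hasSum_taylorSeries_on_ball (hF.mono hb) (z := (x : ℂ)) (by
    rw [Metric.mem_ball, Complex.dist_eq, ← ofReal_sub, Complex.norm_real, Real.norm_eq_abs,
      abs_of_nonpos (by linarith)]
    linarith)
  refine (Complex.hasSum_re hs).nonneg fun n => ?_
  have e : ((n.factorial : ℂ))⁻¹ • ((x : ℂ) - c) ^ n • iteratedDeriv n F c =
      (((n.factorial : ℝ)⁻¹ * (x - c) ^ n : ℝ) : ℂ) * iteratedDeriv n F c := by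
    push_cast; simp only [smul_eq_mul]; ring
  rw [e, Complex.re_ofReal_mul]
  have h2 : (x - c) ^ n = (-1) ^ n * (c - x) ^ n := by rw [← mul_pow]; ring
  rw [h2]
  have := mul_nonneg (mul_nonneg (inv_nonneg.2 (Nat.cast_nonneg (α := ℝ) n.factorial))
    (pow_nonneg (sub_nonneg.2 hxc) n)) (h n)
  calc (0:ℝ) ≤ _ := this
    _ = _ := by ring

lemma completelyMonotone_re {F : ℂ → ℂ} (hF : DifferentiableOn ℂ F {w | 0 < w.re})
    (h : DCM (Ici 2) (fun x : ℝ => (F x).re)) : CompletelyMonotone (fun x : ℝ => (F x).re) := by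
  have han : ∀ x : ℝ, 0 < x → AnalyticAt ℝ (fun x : ℝ => (F x).re) x := fun x hx =>
    (hF.analyticAt (isOpen_rightHalfPlane.mem_nhds (by simpa using hx))).re_ofReal
  refine ⟨fun x hx => (han x hx).contDiffAt.contDiffWithinAt, fun k x hx => ?_⟩
  have hbig : ∀ n : ℕ, ∀ c : ℝ, 2 < c → 0 ≤ (-1) ^ n * (iteratedDeriv n F c).re := by
    intro n c hc
    have h1 := (dcm_iteratedDeriv (h.mono Ioi_subset_Ici_self) (fun m y hy => ?_) n).nonneg
      (mem_Ioi.2 hc)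
    · rwa [iteratedDeriv_re hF n c (by linarith)] at h1
    · have hy0 : (0:ℝ) < y := lt_trans two_pos hy
      rw [iteratedDeriv_eq_iterate]
      exact ((han y hy0).iterated_deriv m).differentiableAt.differentiableWithinAt
  rw [iteratedDeriv_re hF k x hx]
  have hk := re_nonneg_of_taylor (F := fun w => (-1) ^ k * iteratedDeriv k F w)
    ((differentiableOn_iteratedDeriv isOpen_rightHalfPlane hF k).const_mul _) (c := max x 3) hx
    (le_max_left _ _) fun n => ?_
  · have e : ((-1 : ℂ) ^ k * iteratedDeriv k F x).re = (-1) ^ k * (iteratedDeriv k F x).re := by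
      rw [show (-1 : ℂ) ^ k = (((-1) ^ k : ℝ) : ℂ) by push_cast; rfl, Complex.re_ofReal_mul]
    rwa [e] at hk
  · have h3 := hbig (n + k) (max x 3) (lt_of_lt_of_le (by norm_num) (le_max_right _ _))
    rw [iteratedDeriv_const_mul_field, show iteratedDeriv n (iteratedDeriv k F) =
      iteratedDeriv (n + k) F by
        simp only [iteratedDeriv_eq_iterate, Function.iterate_add_apply],
      show (-1 : ℂ) ^ k = (((-1) ^ k : ℝ) : ℂ) by push_cast; rfl, Complex.re_ofReal_mul]
    rwa [← mul_assoc, ← pow_add]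

theorem hcm_stableDensity {α : ℝ} (h0 : 0 < α) (h1 : α < 1) (h : LHCM (gam α)) :
    HCM (stableDensity α 1) := by
  intro u hu
  set m := Real.log u with hm
  set k : ℂ := ((-(α / (1 - α)) : ℝ) : ℂ) with hk
  have hW : Differentiable ℂ (W α) := by
    have := differentiable_Q h0 h1
    unfold W; fun_prop
  have hgam : ∀ p : ℝ, W α (k * p) = gam α p := fun p => by
    rw [gam_eq_W h1, hk]; congr 1; push_cast; ring
  obtain ⟨F, hF, hF'⟩ := exists_comp_add_inv (Φ := fun ζ =>
    ((u⁻¹ ^ 2 : ℝ) : ℂ) * (W α (k * (m + ζ)) * W α (k * (m - ζ)))) (by fun_prop) fun z => by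
      rw [sub_neg_eq_add, ← sub_eq_add_neg]; ring
  have hval : ∀ v : ℝ, 0 < v → (F ((v + 1 / v : ℝ) : ℂ)).re =
      u⁻¹ ^ 2 * (gam α (m + Real.log v) * gam α (m - Real.log v)) := by
    intro v hv
    rw [hF' v hv]
    simp only [← ofReal_add, ← ofReal_sub, hgam, ← ofReal_mul, ofReal_re]
  refine ⟨fun x => (F x).re, completelyMonotone_re hF ?_, fun v hv => ?_⟩
  · refine ((h m).const_mul (sq_nonneg u⁻¹)).congr (isUpperSet_Ici 2) fun w hw => ?_
    have := hval (Real.exp (pOf w)) (Real.exp_pos _)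
    rw [Real.log_exp, one_div, ← Real.exp_neg] at this
    rw [← this, ← two_cosh_pOf hw, pOf_two_cosh (pOf_nonneg hw), Real.cosh_eq]
    congr 3; ring
  · simp only [hval v hv]
    rw [stableDensity_eq h0 h1 (mul_pos hu hv), stableDensity_eq h0 h1 (div_pos hu hv),
      Real.log_mul hu.ne' hv.ne', Real.log_div hu.ne' hv.ne']
    field_simp
    rw [hm]

end StableHCM

/-- For `α ∈ (0,1/4] ∪ [1/3,1/2]`, the positive `α`-stable density
`g_α` is hyperbolically completely monotone. -/
theorem stableDensity_HCM (α : ℝ) (hα : α ∈ Set.Ioc (0:ℝ) (1/4) ∪ Set.Icc (1/3 : ℝ) (1/2)) :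
    HCM (stableDensity α 1) := by
  have h : 0 < α ∧ α < 1 := by
    rcases hα with ⟨h0, h1⟩ | ⟨h0, h1⟩ <;> constructor <;> linarith
  exact StableHCM.hcm_stableDensity h.1 h.2 (StableHCM.lhcm_gam hα)
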